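/- Let F be a CPLIFS with attractor Λ whose generated self-similar IFS S_F satisfies the Exponential Separation Condition. Then the Hausdorff dimension of Λ equals min{1, s_F}, where s_F is the natural dimension of F. -/

import Mathlib

open Set Filter MeasureTheory

noncomputable section

/-- Composition `f_{i₁} ∘ ⋯ ∘ f_{iₙ}` of a family of maps of `ℝ` along a finite word
(the empty composition being the identity). -/
def compFam {ι : Type*} (S : ι → ℝ → ℝ) (w : List ι) : ℝ → ℝ :=
  w.foldr (fun k g => S k ∘ g) id

/-- A family of maps of `ℝ` has *no exact overlapping* if for every `n ≥ 1` and all words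
`ī, j̄` of length `n`, equality of the compositions `S_ī = S_j̄` (as functions) implies
`ī = j̄`. -/
def NoExactOverlap {ι : Type*} (S : ι → ℝ → ℝ) : Prop :=
  ∀ n : ℕ, 1 ≤ n → ∀ i j : Fin n → ι,
    compFam S (List.ofFn i) = compFam S (List.ofFn j) → i = j

/-- The supporting interval `I` of the system `{f_1, …, f_m}`:  if the maps have a common
fixed point `φ` (i.e. the attractor is the single point `φ`) it is `[φ - 1/2, φ + 1/2]`;
otherwise it is the smallest nonempty compact interval sent into itself by all the maps,
i.e. the intersection of all such intervals. -/
def suppInt {m : ℕ} (f : Fin m → ℝ → ℝ) : Set ℝ :=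
  haveI := Classical.propDecidable (∃ φ : ℝ, ∀ k, f k φ = φ)
  if h : ∃ φ : ℝ, ∀ k, f k φ = φ then
    Set.Icc (h.choose - 1 / 2) (h.choose + 1 / 2)
  else
    ⋂₀ {J : Set ℝ | J.Nonempty ∧ (∃ a b : ℝ, J = Set.Icc a b) ∧ ∀ k, f k '' J ⊆ J}

/-- The natural pressure function
`Φ(s) = limsup_{n → ∞} (1/n) log ∑_{(i₁,…,iₙ)} |I_{i₁…iₙ}|ˢ`,
where `I_{i₁…iₙ} = f_{i₁} ∘ ⋯ ∘ f_{iₙ} (I)` are the cylinder intervals and `|·|` denotes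
the length (diameter) of an interval. -/
def pressure {m : ℕ} (f : Fin m → ℝ → ℝ) (s : ℝ) : ℝ :=
  Filter.limsup
    (fun n : ℕ =>
      (n : ℝ)⁻¹ * Real.log (∑ w : Fin n → Fin m,
        Metric.diam (compFam f (List.ofFn w) '' suppInt f) ^ s))
    Filter.atTop

/-- A continuous piecewise linear iterated function system (CPLIFS) consisting of `m ≥ 2`
continuous piecewise linear maps `f k : ℝ → ℝ`; the map `f k` has the `l k` breaking points
`b k 0 < … < b k (l k - 1)` and on the `i`-th open interval of linearity determined by them
it coincides with the affine map `x ↦ ρ k i * x + t k i`, where the slopes satisfy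
`0 < |ρ k i| < 1` and consecutive slopes of each map are distinct. -/
structure CPLIFS (m : ℕ) (l : Fin m → ℕ) : Type where
  f : Fin m → ℝ → ℝ
  b : (k : Fin m) → Fin (l k) → ℝ
  ρ : (k : Fin m) → Fin (l k + 1) → ℝ
  t : (k : Fin m) → Fin (l k + 1) → ℝ
  hm : 2 ≤ m
  hb : ∀ k, StrictMono (b k)
  hρ0 : ∀ k i, ρ k i ≠ 0
  hρ1 : ∀ k i, |ρ k i| < 1
  hconsec : ∀ k (i : Fin (l k)), ρ k i.castSucc ≠ ρ k i.succ
  hcont : ∀ k, Continuous (f k)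
  haff : ∀ (k : Fin m) (i : Fin (l k + 1)) (x : ℝ),
    (∀ j : Fin (l k), (j : ℕ) < (i : ℕ) → b k j < x) →
    (∀ j : Fin (l k), (i : ℕ) ≤ (j : ℕ) → x < b k j) →
    f k x = ρ k i * x + t k i

namespace CPLIFS

variable {m : ℕ} {l : Fin m → ℕ}

/-- The index set of the affine pieces of a CPLIFS. -/
abbrev Idx (m : ℕ) (l : Fin m → ℕ) := Σ k : Fin m, Fin (l k + 1)

/-- The self-similar IFS generated by a CPLIFS: the family of affine maps
`S_{k,i} x = ρ_{k,i} x + t_{k,i}` coinciding with `f k` on its `i`-th interval of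
linearity. -/
def S (F : CPLIFS m l) (p : Idx m l) : ℝ → ℝ :=
  fun x => F.ρ p.1 p.2 * x + F.t p.1 p.2

/-- The supporting interval of a CPLIFS. -/
def supp (F : CPLIFS m l) : Set ℝ := suppInt F.f

/-- `𝓘 = f_1(I) ∪ … ∪ f_m(I)`. -/
def bigI (F : CPLIFS m l) : Set ℝ := ⋃ k, F.f k '' F.supp

/-- The `i`-th open interval of linearity of `f k`. -/
def J (F : CPLIFS m l) (k : Fin m) (i : Fin (l k + 1)) : Set ℝ :=
  {x : ℝ | (∀ j : Fin (l k), (j : ℕ) < (i : ℕ) → F.b k j < x) ∧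
           (∀ j : Fin (l k), (i : ℕ) ≤ (j : ℕ) → x < F.b k j)}

/-- The set of critical points of a CPLIFS: the `f k`-images of the endpoints of `I` and of
the breaking points, together with the points of `𝓘` at which two different branches
(local inverses of affine pieces) agree. -/
def crit (F : CPLIFS m l) : Set ℝ :=
  (⋃ k, ({F.f k (sInf F.supp), F.f k (sSup F.supp)} : Set ℝ)) ∪
  (⋃ k, ⋃ j : Fin (l k), ({F.f k (F.b k j)} : Set ℝ)) ∪
  {x ∈ F.bigI | ∃ p q : Idx m l, p ≠ q ∧
      x ∈ F.f p.1 '' F.J p.1 p.2 ∧ x ∈ F.f q.1 '' F.J q.1 q.2 ∧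
      (x - F.t p.1 p.2) / F.ρ p.1 p.2 = (x - F.t q.1 q.2) / F.ρ q.1 q.2}

/-- `Z : Fin N → ℝ × ℝ` is an (ordered) monotonicity partition of the CPLIFS `F` if the
closed intervals `[Z i .1, Z i .2]` are nondegenerate, ordered, cover `𝓘`, their endpoints
are critical points, and their interiors contain no critical point. -/
def IsMonoPartition (F : CPLIFS m l) (N : ℕ) (Z : Fin N → ℝ × ℝ) : Prop :=
  (∀ i, (Z i).1 < (Z i).2) ∧
  (∀ i j : Fin N, i < j → (Z i).2 ≤ (Z j).1) ∧
  (⋃ i, Set.Icc (Z i).1 (Z i).2) = F.bigI ∧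
  (∀ i, (Z i).1 ∈ F.crit ∧ (Z i).2 ∈ F.crit) ∧
  (∀ i, Set.Ioo (Z i).1 (Z i).2 ∩ F.crit = ∅)

/-- Two CPLIFSs (necessarily with the same number of maps and the same numbers of breaking
points) are ε-close if (a) their monotonicity partitions have the same cardinality and
corresponding intervals have endpoints within ε, (c) the logarithms of the absolute values
of corresponding slopes differ by less than ε, and (d) `sup_x |f_k x - g_k x| < ε`. -/
def Close (ε : ℝ) (F G : CPLIFS m l) : Prop :=
  (∃ (N : ℕ) (Z W : Fin N → ℝ × ℝ), F.IsMonoPartition N Z ∧ G.IsMonoPartition N W ∧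
      ∀ i, |(Z i).1 - (W i).1| < ε ∧ |(Z i).2 - (W i).2| < ε) ∧
  (∀ k i, abs (Real.log |F.ρ k i| - Real.log |G.ρ k i|) < ε) ∧
  (∀ k x, |F.f k x - G.f k x| < ε)

end CPLIFS


/-- A family of affine contractions `x ↦ r p * x + t p` satisfies the *Exponential
Separation Condition* if there are `c > 0` and a strictly increasing sequence `(n_L)` of
naturals such that for every `L` and all distinct words `ī ≠ j̄` of length `n_L`, the
compositions `S_ī` and `S_j̄` either have different slopes or satisfy
`|S_ī(0) - S_j̄(0)| ≥ c ^ (n_L)`. -/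
def ESCfam {ι : Type*} (r t : ι → ℝ) : Prop :=
  ∃ c : ℝ, 0 < c ∧ ∃ nl : ℕ → ℕ, StrictMono nl ∧
    ∀ L : ℕ, ∀ i j : Fin (nl L) → ι, i ≠ j →
      ((∏ q, r (i q)) ≠ ∏ q, r (j q)) ∨
      c ^ nl L ≤
        |compFam (fun p x => r p * x + t p) (List.ofFn i) 0 -
         compFam (fun p x => r p * x + t p) (List.ofFn j) 0|

section
set_option linter.unusedSectionVars false
set_option linter.unusedVariables false
open List (ofFn cons_append map_cons prod_cons map_ofFn prod_ofFn replicate map_append prod_append flatMap_cons append_inj length_append length_cons ofFn_succ ofFn_injective map_reverse prod_reverse length_ofFn replicate_succ length_replicate)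
open Real (log log_le_log log_nonneg log_mul log_div log_pow log_inv norm_eq_abs ofDigits dist_eq rpow_le_rpow rpow_natCast rpow_mul log_neg exp exp_add rpow_pos_of_pos log_rpow mul_rpow exp_pos exp_lt_one_iff exp_nat_mul rpow_nonneg)
open Metric (diam diam_nonneg infDist)
open Finset (mem_filter sum_le_sum sum_nonneg sum_add_distrib sum_sub_distrib sum_filter sum_const sum_congr sum_comm sum_div card_product mul_sum univ_product_univ sum_mul card_univ single_le_sum mem_product sum_range_succ card_le_univ sum_boole card_range inf'_le card_image_le)
open Nat (cast_nonneg cast_pos)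
open Int (floor_le lt_floor_add_one emod_nonneg)
open Fintype (card card_fin piFinset)
open ENNReal (ofReal ofReal_le_ofReal ofReal_coe_nnreal)
/-! ### Entropy -/
open Classical in
def eN {Ω β : Type*} (A : Finset Ω) (X : Ω → β) (ω : Ω) : ℕ :=
  (A.filter (fun ω' => X ω' = X ω)).card
def eH {Ω β : Type*} (A : Finset Ω) (X : Ω → β) : ℝ :=
  (∑ ω ∈ A, log ((A.card : ℝ) / eN A X ω)) / A.card
section ent
variable {Ω Ω' β γ δ : Type*}
lemma eN_pos {A : Finset Ω} {X : Ω → β} {ω : Ω} (h : ω ∈ A) : 0 < eN A X ω := by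
  classical
  unfold eN
  exact Finset.card_pos.2 ⟨ω, by simp [h]⟩
lemma eN_le {A : Finset Ω} {X : Ω → β} {ω : Ω} : eN A X ω ≤ A.card := by
  classical
  unfold eN
  exact Finset.card_filter_le _ _
lemma eN_mono {A : Finset Ω} {X : Ω → β} {Y : Ω → γ} {ω : Ω}
    (h : ∀ ω' ∈ A, X ω' = X ω → Y ω' = Y ω) : eN A X ω ≤ eN A Y ω := by
  classical
  unfold eN
  apply Finset.card_le_card
  intro x hx
  simp only [mem_filter] at hx ⊢
  exact ⟨hx.1, h x hx.1 hx.2⟩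
lemma eH_mono {A : Finset Ω} {X : Ω → β} {Y : Ω → γ}
    (h : ∀ ω ∈ A, ∀ ω' ∈ A, X ω' = X ω → Y ω' = Y ω) : eH A Y ≤ eH A X := by
  unfold eH
  apply div_le_div_of_nonneg_right _ (cast_nonneg _)
  apply sum_le_sum
  intro ω hω
  have h1 : (0:ℝ) < eN A X ω := by exact_mod_cast eN_pos hω
  have h2 : (0:ℝ) < eN A Y ω := by exact_mod_cast eN_pos hω
  have h3 : (0:ℝ) < A.card := by exact_mod_cast Finset.card_pos.2 ⟨ω, hω⟩
  apply log_le_log (by positivity)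
  apply div_le_div_of_nonneg_left h3.le h1
  exact_mod_cast eN_mono (h ω hω)
lemma eH_congr {A : Finset Ω} {X : Ω → β} {Y : Ω → γ}
    (h : ∀ ω ∈ A, ∀ ω' ∈ A, X ω' = X ω ↔ Y ω' = Y ω) : eH A X = eH A Y :=
  le_antisymm (eH_mono fun a ha b hb => (h a ha b hb).2) (eH_mono fun a ha b hb => (h a ha b hb).1)
lemma eH_nonneg {A : Finset Ω} {X : Ω → β} : 0 ≤ eH A X := by
  unfold eH
  apply div_nonneg _ (cast_nonneg _)
  apply sum_nonneg
  intro ω hω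
  have h1 : (0:ℝ) < eN A X ω := by exact_mod_cast eN_pos hω
  apply log_nonneg
  rw [one_le_div h1]
  exact_mod_cast eN_le
lemma eH_ge {A : Finset Ω} (hA : A.Nonempty) {X : Ω → β} {K : ℝ}
    (h : ∀ ω ∈ A, (eN A X ω : ℝ) ≤ K) : log (A.card / K) ≤ eH A X := by
  unfold eH
  have h3 : (0:ℝ) < A.card := by exact_mod_cast Finset.card_pos.2 hA
  rw [le_div_iff₀ h3, mul_comm, ← nsmul_eq_mul]
  apply Finset.card_nsmul_le_sum
  intro ω hω
  have h1 : (0:ℝ) < eN A X ω := by exact_mod_cast eN_pos hω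
  have := h ω hω
  apply log_le_log (div_pos h3 (by linarith))
  exact div_le_div_of_nonneg_left h3.le h1 this
open Classical in
/-- conditional Gibbs inequality -/
lemma eH_gibbs {A : Finset Ω} (hA : A.Nonempty) (X : Ω → β) (Y : Ω → γ) (Q : β → γ → ℝ)
    (hpos : ∀ ω ∈ A, 0 < Q (X ω) (Y ω))
    (hsum : ∀ ω ∈ A, ∑ x ∈ (A.filter (fun ω' => Y ω' = Y ω)).image X, Q x (Y ω) ≤ 1) :
    eH A (fun ω => (X ω, Y ω)) ≤ eH A Y + (∑ ω ∈ A, - log (Q (X ω) (Y ω))) / A.card := by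
  have h3 : (0:ℝ) < A.card := by exact_mod_cast Finset.card_pos.2 hA
  unfold eH
  rw [← add_div, div_le_div_iff_of_pos_right h3, ← sum_add_distrib, ← sub_nonpos,
    ← sum_sub_distrib]
  set N := fun ω => eN A (fun ω => (X ω, Y ω)) ω with hN
  have key : ∑ ω ∈ A, (eN A Y ω : ℝ) * (Q (X ω) (Y ω) / N ω) ≤ A.card := by
    have e1 : ∀ ω ∈ A, (eN A Y ω : ℝ) * (Q (X ω) (Y ω) / N ω)
        = ∑ ω' ∈ A, if Y ω' = Y ω then (Q (X ω) (Y ω) / N ω) else 0 := by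
      intro ω hω
      rw [← sum_filter, sum_const, nsmul_eq_mul]
      rfl
    rw [sum_congr rfl e1, sum_comm]
    have e2 : ∀ ω' ∈ A, (∑ ω ∈ A, if Y ω' = Y ω then (Q (X ω) (Y ω) / N ω) else 0) ≤ 1 := by
      intro ω' hω'
      refine le_trans (le_of_eq ?_) (hsum ω' hω')
      rw [← sum_filter]
      have e3 : ∀ ω ∈ A.filter (fun a => Y ω' = Y a), Q (X ω) (Y ω) / N ω =
          (fun x => Q x (Y ω') / ((A.filter (fun a => Y a = Y ω')).filter (fun a => X a = x)).card)
            (X ω) := by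
        intro ω hω
        simp only [mem_filter] at hω
        simp only [hN, eN, ← hω.2, Finset.filter_filter, Prod.mk.injEq]
        congr 3
        ext a; simp only [mem_filter]; tauto
      rw [sum_congr rfl e3]
      have e4 : A.filter (fun a => Y ω' = Y a) = A.filter (fun a => Y a = Y ω') := by
        ext a; simp only [mem_filter, eq_comm]
      rw [e4, Finset.sum_comp (fun x => Q x (Y ω') / ((A.filter (fun a => Y a = Y ω')).filter (fun a => X a = x)).card)]
      apply sum_congr rfl
      intro x hx
      have : (0:ℝ) < (({a ∈ A.filter (fun a => Y a = Y ω') | X a = x}).card : ℝ) := by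
        rw [Finset.mem_image] at hx
        obtain ⟨a, ha, rfl⟩ := hx
        exact_mod_cast Finset.card_pos.2 ⟨a, by simp [mem_filter.1 ha]⟩
      simp only [nsmul_eq_mul]
      field_simp
    calc _ ≤ ∑ ω' ∈ A, (1:ℝ) := sum_le_sum e2
      _ = A.card := by simp
  calc _ ≤ ∑ ω ∈ A, ((eN A Y ω : ℝ) * (Q (X ω) (Y ω) / N ω) - 1) := by
        apply sum_le_sum
        intro ω hω
        have h1 : (0:ℝ) < N ω := by exact_mod_cast eN_pos hω
        have h2 : (0:ℝ) < eN A Y ω := by exact_mod_cast eN_pos hω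
        have h4 := hpos ω hω
        refine le_trans (le_of_eq ?_) (Real.log_le_sub_one_of_pos (by positivity))
        rw [log_mul (by positivity) (by positivity), log_div h4.ne' h1.ne']
        simp only [← hN]
        rw [log_div h3.ne' h2.ne', log_div h3.ne' h1.ne']
        ring
    _ ≤ 0 := by
      rw [sum_sub_distrib]; simp; linarith
lemma eH_submod {A : Finset Ω} (X : Ω → β) (Y : Ω → γ) (Z : Ω → δ) :
    eH A (fun ω => (X ω, (Y ω, Z ω))) + eH A Z ≤
      eH A (fun ω => (X ω, Z ω)) + eH A (fun ω => (Y ω, Z ω)) := by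
  classical
  rcases A.eq_empty_or_nonempty with rfl | hA
  · simp [eH]
  have h3 : (0:ℝ) < A.card := by exact_mod_cast Finset.card_pos.2 hA
  have := eH_gibbs hA X (fun ω => (Y ω, Z ω))
    (fun x yz => ((A.filter (fun a => X a = x ∧ Z a = yz.2)).card : ℝ) /
      (A.filter (fun a => Z a = yz.2)).card) ?_ ?_
  · refine le_trans (add_le_add_left this _) ?_
    have e : (∑ ω ∈ A, - log (((A.filter (fun a => X a = X ω ∧ Z a = (Y ω, Z ω).2)).card : ℝ) /
      (A.filter (fun a => Z a = (Y ω, Z ω).2)).card)) / A.card =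
        eH A (fun ω => (X ω, Z ω)) - eH A Z := by
      unfold eH
      rw [← sub_div, ← sum_sub_distrib]
      congr 1
      apply sum_congr rfl
      intro ω hω
      have h1 : (0:ℝ) < eN A (fun ω => (X ω, Z ω)) ω := by exact_mod_cast eN_pos hω
      have h2 : (0:ℝ) < eN A Z ω := by exact_mod_cast eN_pos hω
      rw [log_div h3.ne' h2.ne', log_div h3.ne' h1.ne']
      have e1 : ((A.filter (fun a => X a = X ω ∧ Z a = (Y ω, Z ω).2)).card : ℝ)
        = eN A (fun ω => (X ω, Z ω)) ω := by
        simp only [eN, Prod.mk.injEq]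
      have e2 : ((A.filter (fun a => Z a = (Y ω, Z ω).2)).card : ℝ)
        = eN A Z ω := by
        simp only [eN]
      rw [e1, e2, log_div h1.ne' h2.ne']
      ring
    linarith
  · intro ω hω
    apply div_pos
    · exact_mod_cast Finset.card_pos.2 ⟨ω, by simp [hω]⟩
    · exact_mod_cast Finset.card_pos.2 ⟨ω, by simp [hω]⟩
  · intro ω hω
    rw [← sum_div]
    have : (0:ℝ) < (A.filter (fun a => Z a = Z ω)).card := by
      exact_mod_cast Finset.card_pos.2 ⟨ω, by simp [hω]⟩
    rw [div_le_one this]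
    rw [← Nat.cast_sum]
    norm_cast
    rw [← Finset.card_biUnion]
    · apply Finset.card_le_card
      intro a ha
      simp only [Finset.mem_biUnion, mem_filter] at ha ⊢
      tauto
    · intro x _ y _ hxy
      rw [Function.onFun, Finset.disjoint_left]
      intro a ha hb
      simp only [mem_filter] at ha hb
      exact hxy (ha.2.1.symm.trans hb.2.1)
/-- conditioning on more decreases conditional entropy -/
lemma eH_cond_mono {A : Finset Ω} (T : Ω → β) (U : Ω → γ) (G : Ω → δ)
    (h : ∀ ω ∈ A, ∀ ω' ∈ A, U ω' = U ω → G ω' = G ω) :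
    eH A (fun ω => (T ω, U ω)) - eH A U ≤ eH A (fun ω => (T ω, G ω)) - eH A G := by
  have h1 := eH_submod (A := A) T U G
  have h2 : eH A (fun ω => (T ω, (U ω, G ω))) = eH A (fun ω => (T ω, U ω)) := by
    apply eH_congr; intro a ha b hb
    have := h a ha b hb
    simp only [Prod.mk.injEq]; tauto
  have h3 : eH A (fun ω => (U ω, G ω)) = eH A U := by
    apply eH_congr; intro a ha b hb
    have := h a ha b hb
    simp only [Prod.mk.injEq]; tauto
  linarith
lemma eH_subadd {A : Finset Ω} (hA : A.Nonempty) (X : Ω → β) (Y : Ω → γ) :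
    eH A (fun ω => (X ω, Y ω)) ≤ eH A X + eH A Y := by
  have h3 : (0:ℝ) < A.card := by exact_mod_cast Finset.card_pos.2 hA
  have := eH_cond_mono (A := A) X Y (fun _ => ()) (by simp)
  have e1 : eH A (fun _ => ()) = 0 := by
    unfold eH eN; simp [h3.ne']
  have e2 : eH A (fun ω => (X ω, ())) = eH A X := by
    apply eH_congr; simp
  linarith
lemma eH_map {A : Finset Ω} (e : Ω ↪ Ω') (X : Ω' → β) :
    eH (A.map e) X = eH A (fun ω => X (e ω)) := by
  classical
  unfold eH
  simp only [Finset.sum_map, Finset.card_map]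
  congr 1
  apply sum_congr rfl
  intro ω _
  congr 3
  unfold eN
  rw [Finset.filter_map, Finset.card_map]
  rfl
lemma eH_equiv [Fintype Ω] [Fintype Ω'] (e : Ω ≃ Ω') (X : Ω' → β) :
    eH Finset.univ (fun ω => X (e ω)) = eH Finset.univ X := by
  rw [← Finset.map_univ_equiv e, eH_map]; rfl
open Classical in
lemma eH_chain {A : Finset Ω} (X : Ω → β) (Y : Ω → γ) :
    eH A (fun ω => (X ω, Y ω)) =
      eH A Y + (∑ ω ∈ A, eH (A.filter (fun a => Y a = Y ω)) X) / A.card := by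
  rcases A.eq_empty_or_nonempty with rfl | hA
  · simp [eH]
  have h3 : (0:ℝ) < A.card := by exact_mod_cast Finset.card_pos.2 hA
  unfold eH
  rw [← add_div]; congr 1
  rw [← sub_eq_iff_eq_add', ← sum_sub_distrib]
  have e1 : ∀ ω ∈ A, (∑ a ∈ A.filter (fun a => Y a = Y ω),
      log (((A.filter (fun a => Y a = Y ω)).card : ℝ) / eN (A.filter (fun a => Y a = Y ω)) X a)) /
        ((A.filter (fun a => Y a = Y ω)).card : ℝ) =
      ∑ a ∈ A, if Y a = Y ω then log ((eN A Y a : ℝ) / eN A (fun ω => (X ω, Y ω)) a) / eN A Y a else 0 := by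
    intro ω hω
    rw [← sum_filter, sum_div]
    apply sum_congr rfl
    intro a ha
    rw [mem_filter] at ha
    have : eN (A.filter (fun a => Y a = Y ω)) X a = eN A (fun ω => (X ω, Y ω)) a := by
      unfold eN
      rw [Finset.filter_filter]
      congr 1; ext c; simp only [mem_filter, Prod.mk.injEq, ha.2]; tauto
    rw [this]
    have : (A.filter (fun a => Y a = Y ω)).card = eN A Y a := by
      unfold eN; rw [ha.2]
    rw [this]
  rw [sum_congr rfl e1, sum_comm]
  apply sum_congr rfl
  intro a ha
  have h1 : (0:ℝ) < eN A (fun ω => (X ω, Y ω)) a := by exact_mod_cast eN_pos ha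
  have h2 : (0:ℝ) < eN A Y a := by exact_mod_cast eN_pos ha
  rw [← sum_filter, sum_const, nsmul_eq_mul]
  have : (A.filter (fun x => Y a = Y x)).card = eN A Y a := by
    unfold eN; congr 1; ext; simp [eq_comm]
  rw [this, log_div h3.ne' h1.ne', log_div h3.ne' h2.ne', log_div h2.ne' h1.ne']
  field_simp
  ring
lemma eH_chain' [DecidableEq γ] {A : Finset Ω} (X : Ω → β) (Y : Ω → γ) :
    eH A (fun ω => (X ω, Y ω)) =
      eH A Y + (∑ ω ∈ A, eH (A.filter (fun a => Y a = Y ω)) X) / A.card := by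
  convert eH_chain X Y
lemma eH_prod {A : Finset Ω} {B : Finset Ω'} (hA : A.Nonempty) (hB : B.Nonempty)
    (X : Ω → β) (Y : Ω' → γ) :
    eH (A ×ˢ B) (fun p => (X p.1, Y p.2)) = eH A X + eH B Y := by
  classical
  have h3 : (0:ℝ) < A.card := by exact_mod_cast Finset.card_pos.2 hA
  have h4 : (0:ℝ) < B.card := by exact_mod_cast Finset.card_pos.2 hB
  unfold eH
  rw [Finset.sum_product]
  have e1 : ∀ a ∈ A, (∑ b ∈ B, log (((A ×ˢ B).card : ℝ) / eN (A ×ˢ B) (fun p => (X p.1, Y p.2)) (a, b)))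
      = (B.card : ℝ) * log (A.card / eN A X a) + ∑ b ∈ B, log (B.card / eN B Y b) := by
    intro a ha
    rw [← nsmul_eq_mul, ← sum_const, ← sum_add_distrib]
    apply sum_congr rfl
    intro b hb
    have h1 : (0:ℝ) < eN A X a := by exact_mod_cast eN_pos ha
    have h2 : (0:ℝ) < eN B Y b := by exact_mod_cast eN_pos hb
    rw [← log_mul (by positivity) (by positivity)]
    have : eN (A ×ˢ B) (fun p => (X p.1, Y p.2)) (a, b) = eN A X a * eN B Y b := by
      unfold eN
      rw [← card_product, ← Finset.filter_product]
      congr 1; ext; simp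
    rw [this, card_product]; push_cast
    congr 1
    field_simp
  rw [sum_congr rfl e1, sum_add_distrib, ← mul_sum, sum_const, card_product]
  push_cast
  simp only [nsmul_eq_mul]
  field_simp
lemma eH_fst {A : Finset Ω} {B : Finset Ω'} (hA : A.Nonempty) (hB : B.Nonempty)
    (X : Ω → β) : eH (A ×ˢ B) (fun p => X p.1) = eH A X := by
  have h := eH_prod hA hB X (fun _ => ())
  have h3 : (0:ℝ) < B.card := by exact_mod_cast Finset.card_pos.2 hB
  have e1 : eH B (fun _ => ()) = 0 := by
    unfold eH eN; simp [h3.ne']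
  rw [e1, add_zero] at h
  rw [← h]; apply eH_congr; simp
lemma eH_snd {A : Finset Ω} {B : Finset Ω'} (hA : A.Nonempty) (hB : B.Nonempty)
    (X : Ω' → β) : eH (A ×ˢ B) (fun p => X p.2) = eH B X := by
  have h := eH_prod hA hB (fun _ => ()) X
  have h3 : (0:ℝ) < A.card := by exact_mod_cast Finset.card_pos.2 hA
  have e1 : eH A (fun _ => ()) = 0 := by
    unfold eH eN; simp [h3.ne']
  rw [e1, zero_add] at h
  rw [← h]; apply eH_congr; simp
lemma int_card_le (s : Finset ℤ) (c R : ℝ) (hR : 0 ≤ R) (h : ∀ z ∈ s, |(z:ℝ) - c| ≤ R) :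
    (s.card : ℝ) ≤ 2 * R + 1 := by
  have h1 : s ⊆ Finset.Icc ⌈c - R⌉ ⌊c + R⌋ := by
    intro z hz
    have := abs_le.1 (h z hz)
    rw [Finset.mem_Icc]
    exact ⟨Int.ceil_le.2 (by linarith), Int.le_floor.2 (by linarith)⟩
  have h2 := Finset.card_le_card h1
  rw [Int.card_Icc] at h2
  have h3 : ((⌊c + R⌋ + 1 - ⌈c - R⌉).toNat : ℝ) ≤ 2 * R + 1 := by
    rcases le_or_gt 0 (⌊c + R⌋ + 1 - ⌈c - R⌉) with h | h
    · have : ((⌊c + R⌋ + 1 - ⌈c - R⌉).toNat : ℝ) = ((⌊c + R⌋ + 1 - ⌈c - R⌉ : ℤ) : ℝ) := by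
        exact_mod_cast Int.toNat_of_nonneg h
      rw [this]; push_cast
      have := floor_le (c+R); have := Int.le_ceil (c-R); linarith
    · rw [Int.toNat_of_nonpos h.le]; simp; linarith
  calc (s.card:ℝ) ≤ _ := by exact_mod_cast h2
    _ ≤ _ := h3
open Classical in
/-- `X` takes at most `K (Y)` values given `Y` -/
lemma eH_cond_card {A : Finset Ω} (hA : A.Nonempty) (X : Ω → β) (Y : Ω → γ) (K : γ → ℝ)
    (h : ∀ ω ∈ A, (((A.filter (fun a => Y a = Y ω)).image X).card : ℝ) ≤ K (Y ω)) :
    eH A (fun ω => (X ω, Y ω)) ≤ eH A Y + (∑ ω ∈ A, log (K (Y ω))) / A.card := by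
  have hK : ∀ ω ∈ A, 0 < K (Y ω) := by
    intro ω hω
    refine lt_of_lt_of_le ?_ (h ω hω)
    exact_mod_cast Finset.card_pos.2 ⟨X ω, Finset.mem_image_of_mem _ (by simp [hω])⟩
  have := eH_gibbs hA X Y (fun _ y => (K y)⁻¹) (fun ω hω => inv_pos.2 (hK ω hω)) (by
    intro ω hω
    rw [sum_const, nsmul_eq_mul, mul_inv_le_iff₀ (hK ω hω), one_mul]
    exact h ω hω)
  simpa using this
lemma avg_const {A : Finset Ω} (hA : A.Nonempty) (c : ℝ) : (∑ _ω ∈ A, c) / A.card = c := by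
  have h3 : (0:ℝ) < A.card := by exact_mod_cast Finset.card_pos.2 hA
  simp; field_simp
lemma eH_cond_int {A : Finset Ω} (hA : A.Nonempty) (X : Ω → ℤ) (Y : Ω → γ) (R : ℝ) (hR : 0 ≤ R)
    (h : ∀ ω ∈ A, ∀ ω' ∈ A, Y ω' = Y ω → |(X ω' : ℝ) - X ω| ≤ R) :
    eH A (fun ω => (X ω, Y ω)) ≤ eH A Y + log (2 * R + 1) := by
  classical
  have := eH_cond_card hA X Y (fun _ => 2 * R + 1) (by
    intro ω hω
    apply int_card_le _ (X ω) R hR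
    intro z hz
    obtain ⟨a, ha, rfl⟩ := (@Finset.mem_image _ _ (fun a b => Classical.propDecidable (a = b)) _ _ _).1 hz
    rw [mem_filter] at ha
    exact h ω hω a ha.1 ha.2)
  rwa [avg_const hA] at this
lemma eH_int {A : Finset Ω} (hA : A.Nonempty) (X : Ω → ℤ) (Y : Ω → γ) (R : ℝ) (hR : 0 ≤ R)
    (h : ∀ ω ∈ A, ∀ ω' ∈ A, Y ω' = Y ω → |(X ω' : ℝ) - X ω| ≤ R) :
    eH A X ≤ eH A Y + log (2 * R + 1) := by
  refine le_trans (eH_mono ?_) (eH_cond_int hA X Y R hR h)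
  intro a _ b _ hab
  exact (Prod.mk.inj hab).1
lemma eH_le_log_card {A : Finset Ω} (hA : A.Nonempty) (X : Ω → β) : eH A X ≤ log A.card := by
  have h3 : (0:ℝ) < A.card := by exact_mod_cast Finset.card_pos.2 hA
  rw [← avg_const hA (log A.card)]
  unfold eH
  apply div_le_div_of_nonneg_right _ h3.le
  apply sum_le_sum
  intro ω hω
  have h1 : (0:ℝ) < eN A X ω := by exact_mod_cast eN_pos hω
  apply log_le_log (by positivity)
  apply div_le_self h3.le
  exact_mod_cast eN_pos hω
lemma eH_inj {A : Finset Ω} (hA : A.Nonempty) (X : Ω → β) (h : ∀ a ∈ A, ∀ b ∈ A, X a = X b → a = b) :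
    eH A X = log A.card := by
  classical
  apply le_antisymm (eH_le_log_card hA X)
  have := eH_ge hA (X := X) (K := 1) (by
    intro ω hω
    unfold eN
    norm_cast
    rw [Finset.card_le_one]
    intro a ha b hb
    rw [mem_filter] at ha hb
    exact h a ha.1 b hb.1 (ha.2.trans hb.2.symm))
  simpa using this
lemma sum_two_pow_abs (s : Finset ℤ) : ∑ n ∈ s, (1/3 : ℝ) * (2⁻¹ : ℝ) ^ n.natAbs ≤ 1 := by
  have key : ∀ M : ℕ, ∑ n ∈ Finset.Icc (-(M:ℤ)) M, (1/3 : ℝ) * (2⁻¹ : ℝ) ^ n.natAbs = 1 - (2/3) * (2⁻¹:ℝ)^M := by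
    intro M
    induction M with
    | zero => norm_num
    | succ M ih =>
      have : Finset.Icc (-((M+1:ℕ):ℤ)) ((M+1:ℕ):ℤ) =
        insert (-((M:ℤ)+1)) (insert ((M:ℤ)+1) (Finset.Icc (-(M:ℤ)) M)) := by
        ext x; simp only [Finset.mem_Icc, Finset.mem_insert]; omega
      rw [this, Finset.sum_insert, Finset.sum_insert, ih]
      · have h1 : (-((M:ℤ)+1)).natAbs = M+1 := by omega
        have h2 : (((M:ℤ)+1)).natAbs = M+1 := by omega
        rw [h1, h2, pow_succ]; ring
      · simp
      · simp only [Finset.mem_Icc, Finset.mem_insert]; omega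
  obtain ⟨M, hM⟩ : ∃ M : ℕ, s ⊆ Finset.Icc (-(M:ℤ)) M := by
    refine ⟨s.sup Int.natAbs, fun x hx => ?_⟩
    have := Finset.le_sup (f := Int.natAbs) hx
    rw [Finset.mem_Icc]; omega
  calc _ ≤ _ := Finset.sum_le_sum_of_subset_of_nonneg hM (fun _ _ _ => by positivity)
    _ = _ := key M
    _ ≤ 1 := by have : (0:ℝ) < (2⁻¹:ℝ)^M := by positivity
                linarith
lemma eH_sq {A : Finset Ω} (hA : A.Nonempty) (X : Ω → ℤ) (Y : Ω → γ) :
    eH A (fun ω => (X ω, Y ω)) ≤ eH A Y + (∑ ω ∈ A, (X ω : ℝ)^2) / A.card + log 3 := by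
  classical
  have h3 : (0:ℝ) < A.card := by exact_mod_cast Finset.card_pos.2 hA
  have := eH_gibbs hA X Y (fun x _ => (1/3 : ℝ) * (2⁻¹ : ℝ) ^ x.natAbs) (fun ω hω => by positivity) (by
    intro ω hω
    exact sum_two_pow_abs _)
  refine le_trans this ?_
  rw [add_assoc]
  gcongr
  rw [← avg_const hA (log 3), ← add_div, ← sum_add_distrib]
  gcongr with ω hω
  rw [log_mul (by norm_num) (by positivity), log_pow, log_inv, one_div, log_inv]
  have h1 : ((X ω).natAbs : ℝ) ≤ (X ω : ℝ)^2 := by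
    have : ((X ω).natAbs : ℤ) ≤ (X ω)^2 := by
      rw [← Int.natAbs_sq]
      rcases Nat.eq_zero_or_pos (X ω).natAbs with h | h
      · rw [h]; simp
      · have : (1:ℤ) ≤ (X ω).natAbs := by exact_mod_cast h
        nlinarith
    calc ((X ω).natAbs : ℝ) = (((X ω).natAbs : ℤ) : ℝ) := (Int.cast_natCast _).symm
      _ ≤ (((X ω)^2 : ℤ) : ℝ) := by exact_mod_cast this
      _ = _ := by push_cast; rfl
  have h2 : log 2 ≤ 1 := by have := Real.log_two_lt_d9; linarith
  have h4 : (0:ℝ) ≤ (X ω).natAbs := by positivity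
  nlinarith
end ent
/-! ### Self-similar sums -/
def wS {Ω : Type*} (lm : ℝ) (d : Ω → ℝ) (n : ℕ) (w : Fin n → Ω) : ℝ :=
  ∑ i : Fin n, lm ^ (i : ℕ) * d (w i)
def fl (lm : ℝ) (n : ℕ) (x : ℝ) : ℤ := ⌊x / lm ^ n⌋
def hh {Ω : Type*} [Fintype Ω] (lm : ℝ) (d : Ω → ℝ) (n : ℕ) : ℝ :=
  eH Finset.univ (fun w : Fin n → Ω => fl lm n (wS lm d n w))
section univ
variable {U V β γ : Type*} [Fintype U] [Fintype V] [Nonempty U] [Nonempty V]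
lemma eH_prod_univ (X : U → β) (Y : V → γ) :
    eH Finset.univ (fun p : U × V => (X p.1, Y p.2)) = eH Finset.univ X + eH Finset.univ Y := by
  rw [← univ_product_univ]; exact eH_prod Finset.univ_nonempty Finset.univ_nonempty X Y
lemma eH_fst_univ (X : U → β) :
    eH Finset.univ (fun p : U × V => X p.1) = eH Finset.univ X := by
  rw [← univ_product_univ]; exact eH_fst Finset.univ_nonempty Finset.univ_nonempty X
lemma eH_snd_univ (Y : V → γ) :
    eH Finset.univ (fun p : U × V => Y p.2) = eH Finset.univ Y := by
  rw [← univ_product_univ]; exact eH_snd Finset.univ_nonempty Finset.univ_nonempty Y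
/-- Kaimanovich–Vershik / Madiman -/
lemma eH_KV {W : Type*} [Fintype W] [Nonempty W] (a : U → ℤ) (b : V → ℤ) (c : W → ℤ) :
    eH Finset.univ (fun p : U × V × W => a p.1 + b p.2.1 + c p.2.2) + eH Finset.univ b ≤
      eH Finset.univ (fun p : U × V => a p.1 + b p.2) +
      eH Finset.univ (fun p : V × W => b p.1 + c p.2) := by
  have h := eH_submod (A := (Finset.univ : Finset (U × V × W)))
    (fun p => (a p.1, b p.2.1 + c p.2.2)) (fun p => (a p.1 + b p.2.1, c p.2.2))
    (fun p => a p.1 + b p.2.1 + c p.2.2)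
  have e1 : eH (Finset.univ : Finset (U × V × W)) (fun ω => ((a ω.1, b ω.2.1 + c ω.2.2),
      (a ω.1 + b ω.2.1, c ω.2.2), a ω.1 + b ω.2.1 + c ω.2.2)) =
      eH Finset.univ a + (eH Finset.univ b + eH Finset.univ c) := by
    rw [← eH_prod_univ b c, ← eH_prod_univ a]
    apply eH_congr; intro x _ y _
    simp only [Prod.mk.injEq]; omega
  have e2 : eH (Finset.univ : Finset (U × V × W)) (fun ω => ((a ω.1, b ω.2.1 + c ω.2.2),
      a ω.1 + b ω.2.1 + c ω.2.2)) =
      eH Finset.univ a + eH Finset.univ (fun p : V × W => b p.1 + c p.2) := by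
    rw [← eH_prod_univ a]
    apply eH_congr; intro x _ y _
    simp only [Prod.mk.injEq]; omega
  have e3 : eH (Finset.univ : Finset (U × V × W)) (fun ω => ((a ω.1 + b ω.2.1, c ω.2.2),
      a ω.1 + b ω.2.1 + c ω.2.2)) =
      eH Finset.univ (fun p : U × V => a p.1 + b p.2) + eH Finset.univ c := by
    rw [← eH_prod_univ _ c, ← eH_equiv (Equiv.prodAssoc U V W)]
    apply eH_congr; intro x _ y _
    simp only [Prod.mk.injEq, Equiv.prodAssoc_apply]; omega
  rw [e1, e2, e3] at h
  linarith
/-- second moment of i.i.d. centred sums -/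
lemma second_moment (y : U → ℝ) (hy : ∑ u, y u = 0) (k : ℕ) :
    (∑ x : Fin k → U, (∑ j, y (x j))^2) / (card (Fin k → U)) =
      k * ((∑ u, (y u)^2) / card U) := by
  have hc : (0:ℝ) < card U := by exact_mod_cast Fintype.card_pos
  have key : ∀ k : ℕ, (∑ x : Fin k → U, (∑ j, y (x j))^2) * (card U) =
      k * (card U : ℝ)^k * (∑ u, (y u)^2) := by
    intro k
    induction k with
    | zero => simp
    | succ k ih =>
      rw [← (Fin.consEquiv (fun _ : Fin (k+1) => U)).sum_comp, Fintype.sum_prod_type]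
      simp only [Fin.consEquiv_apply, Fin.sum_univ_succ, Fin.cons_zero, Fin.cons_succ, add_sq,
        sum_add_distrib, sum_const, ← mul_sum, ← sum_mul, hy]
      simp only [card_univ, nsmul_eq_mul, Fintype.card_pi, Finset.prod_const, card_fin]
      rw [add_mul, mul_assoc (card U : ℝ), ih]
      push_cast
      rw [← mul_sum]
      ring
  have := key k
  rw [div_eq_iff (by positivity)]
  simp only [Fintype.card_pi, Finset.prod_const, card_univ, card_fin]
  push_cast
  field_simp
  linarith
end univ
section wsum
variable {Ω : Type*} [Fintype Ω] [Nonempty Ω] {lm : ℝ} (h0 : 0 < lm) (h1 : lm < 1) (d : Ω → ℝ)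
lemma wS_append (n m : ℕ) (u : Fin n → Ω) (v : Fin m → Ω) :
    wS lm d (n + m) (Fin.append u v) = wS lm d n u + lm ^ n * wS lm d m v := by
  unfold wS
  rw [Fin.sum_univ_add, mul_sum]
  simp [pow_add, mul_assoc]
/-- bound of all sums -/
def wD (lm : ℝ) (d : Ω → ℝ) : ℝ := (∑ ω, |d ω|) / (1 - lm)
include h1 in
lemma wD_nonneg : 0 ≤ wD lm d := by
  unfold wD
  apply div_nonneg (sum_nonneg fun _ _ => abs_nonneg _); linarith
include h0 h1 in
lemma wS_le (n : ℕ) (w : Fin n → Ω) : |wS lm d n w| ≤ wD lm d := by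
  unfold wS wD
  refine le_trans (Finset.abs_sum_le_sum_abs _ _) ?_
  rw [div_eq_mul_inv, mul_comm]
  calc ∑ i : Fin n, |lm ^ (i:ℕ) * d (w i)| ≤ ∑ i : Fin n, lm ^ (i:ℕ) * ∑ ω, |d ω| := by
        apply sum_le_sum; intro i _
        rw [abs_mul, abs_of_pos (pow_pos h0 _)]
        apply mul_le_mul_of_nonneg_left _ (pow_pos h0 _).le
        exact single_le_sum (f := fun ω => |d ω|) (fun _ _ => abs_nonneg _) (Finset.mem_univ _)
    _ = (∑ i ∈ Finset.range n, lm ^ i) * ∑ ω, |d ω| := by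
        rw [← sum_mul, ← Fin.sum_univ_eq_sum_range (fun i => lm ^ i)]
    _ ≤ _ := by
        apply mul_le_mul_of_nonneg_right _ (sum_nonneg fun _ _ => abs_nonneg _)
        rw [← tsum_geometric_of_lt_one h0.le h1]
        exact (summable_geometric_of_lt_one h0.le h1).sum_le_tsum _ (fun i _ => (pow_pos h0 i).le)
include h0 in
lemma fl_close (n : ℕ) (x y E : ℝ) (h : |x - y| ≤ E * lm ^ n) :
    |(fl lm n x : ℝ) - fl lm n y| ≤ E + 1 := by
  unfold fl
  have hp := pow_pos h0 n
  have := floor_le (x / lm ^ n); have := lt_floor_add_one (x / lm ^ n)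
  have := floor_le (y / lm ^ n); have := lt_floor_add_one (y / lm ^ n)
  have h2 : |x / lm ^ n - y / lm ^ n| ≤ E := by
    rw [← sub_div, abs_div, abs_of_pos hp, div_le_iff₀ hp]; exact h
  rw [abs_le] at h2 ⊢
  constructor <;> linarith [h2.1, h2.2]
include h0 in
lemma fl_eq {n : ℕ} {x y : ℝ} (h : fl lm n x = fl lm n y) : |x - y| < lm ^ n := by
  unfold fl at h
  have hp := pow_pos h0 n
  have := Int.abs_sub_lt_one_of_floor_eq_floor h
  rwa [← sub_div, abs_div, abs_of_pos hp, div_lt_one hp] at this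
include h0 h1 in
lemma hh_superadd (n m : ℕ) :
    hh lm d n + hh lm d m ≤ hh lm d (n + m) + (log (4 * wD lm d + 5) + log 5) := by
  set A : Finset ((Fin n → Ω) × (Fin m → Ω)) := Finset.univ with hA
  have hAn : A.Nonempty := Finset.univ_nonempty
  set T : (Fin n → Ω) × (Fin m → Ω) → ℤ :=
    fun p => fl lm (n+m) (wS lm d n p.1 + lm ^ n * wS lm d m p.2) with hT
  set G : (Fin n → Ω) × (Fin m → Ω) → ℤ := fun p => fl lm n (wS lm d n p.1) with hG
  set Y : (Fin n → Ω) × (Fin m → Ω) → ℤ := fun p => fl lm m (wS lm d m p.2) with hY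
  have e0 : hh lm d (n+m) = eH A T := by
    unfold hh
    rw [← eH_equiv (Fin.appendEquiv n m)]
    congr 1; ext p
    simp [hT, Fin.appendEquiv, wS_append]
  have hD := wD_nonneg h1 d
  have e1 : eH A (fun p => (G p, T p)) ≤ eH A T + log (2 * (2 * wD lm d + 2) + 1) := by
    apply eH_cond_int hAn G T _ (by linarith)
    intro p _ p' _ h
    have h2 := fl_eq h0 h
    have := fl_close h0 n (wS lm d n p'.1) (wS lm d n p.1) (2 * wD lm d + 1) (by
      have hp := pow_pos h0 n
      have b1 := abs_le.1 (wS_le h0 h1 d m p.2)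
      have b2 := abs_le.1 (wS_le h0 h1 d m p'.2)
      have h3 : lm ^ (n+m) ≤ lm ^ n := pow_le_pow_of_le_one h0.le h1.le (by omega)
      rw [abs_lt] at h2
      rw [abs_le]
      constructor <;> nlinarith)
    linarith
  have e2 := eH_cond_mono (A := A) T Prod.fst G (by
    intro p _ p' _ h; simp only [hG, h])
  have e3 : eH A (fun p => (Y p, p.1)) ≤ eH A (fun p => (T p, p.1)) + log (2 * 2 + 1) := by
    have := eH_cond_int hAn Y (fun p => (T p, p.1)) 2 (by norm_num) (by
      intro ω _ ω' _ h
      rw [Prod.mk.injEq] at h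
      have h2 := fl_eq h0 h.1
      have := fl_close h0 m (wS lm d m ω'.2) (wS lm d m ω.2) 1 (by
        rw [h.2] at h2
        have e : wS lm d n ω.1 + lm ^ n * wS lm d m ω'.2 - (wS lm d n ω.1 + lm ^ n * wS lm d m ω.2)
          = lm ^ n * (wS lm d m ω'.2 - wS lm d m ω.2) := by ring
        rw [e, abs_mul, abs_of_pos (pow_pos h0 n), pow_add] at h2
        have := lt_of_mul_lt_mul_left h2 (pow_pos h0 n).le
        linarith)
      linarith)
    refine le_trans (eH_mono ?_) this
    intro a _ b _ h
    simp only [Prod.mk.injEq] at h ⊢; tauto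
  have e4 : eH A (fun p => (Y p, p.1)) = eH A (Prod.fst) + hh lm d m := by
    have h2 : eH A (Prod.fst) = eH Finset.univ (fun u : Fin n → Ω => u) := by
      exact eH_fst_univ (V := Fin m → Ω) (fun u : Fin n → Ω => u)
    rw [h2]; unfold hh
    rw [← eH_prod_univ]
    apply eH_congr; intro a _ b _
    simp only [Prod.mk.injEq, hY]; tauto
  have e5 : eH A G = hh lm d n := eH_fst_univ (V := Fin m → Ω) (fun u => fl lm n (wS lm d n u))
  have e6 : eH A (fun p => (G p, T p)) = eH A (fun p => (T p, G p)) := by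
    apply eH_congr; intro a _ b _; simp only [Prod.mk.injEq]; tauto
  have e7 : 2 * (2 * wD lm d + 2) + 1 = 4 * wD lm d + 5 := by ring
  have e8 : (2 * 2 + 1 : ℝ) = 5 := by norm_num
  rw [e7] at e1; rw [e8] at e3
  linarith
include h0 h1 in
lemma hh_limit : ∃ α C : ℝ, 0 ≤ C ∧ 0 ≤ α ∧ (∀ n, hh lm d n ≤ α * n + C) ∧
    Tendsto (fun n : ℕ => hh lm d n / n) atTop (nhds α) := by
  set C := log (4 * wD lm d + 5) + log 5 with hC
  have hD := wD_nonneg h1 d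
  have hC0 : 0 ≤ C := add_nonneg (log_nonneg (by linarith)) (log_nonneg (by norm_num))
  have hs : Subadditive (fun n => C - hh lm d n) := by
    intro n m
    have := hh_superadd h0 h1 d n m
    simp only
    linarith
  have hub : ∀ n, hh lm d n ≤ n * log (card Ω) := by
    intro n
    refine le_trans (eH_le_log_card Finset.univ_nonempty _) ?_
    simp [card_univ]
  have hbdd : BddBelow (Set.range fun n : ℕ => (C - hh lm d n) / n) := by
    refine ⟨- log (card Ω), ?_⟩
    rintro _ ⟨n, rfl⟩
    rcases Nat.eq_zero_or_pos n with rfl | hn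
    · simp
      exact log_nonneg (by exact_mod_cast Fintype.card_pos)
    · have : (0:ℝ) < n := by exact_mod_cast hn
      simp only
      rw [le_div_iff₀ this]
      have := hub n
      linarith
  have ht : Tendsto (fun n : ℕ => hh lm d n / n) atTop (nhds (-hs.lim)) := by
    have t1 := hs.tendsto_lim hbdd
    have t2 : Tendsto (fun n : ℕ => C / (n:ℝ)) atTop (nhds 0) := tendsto_const_div_atTop_nhds_zero_nat C
    have := t2.sub t1
    simp only [zero_sub] at this
    refine this.congr (fun n => ?_)
    rw [← sub_div]; congr 1; ring
  refine ⟨-hs.lim, C, hC0, ?_, ?_, ht⟩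
  · apply ge_of_tendsto' ht
    intro n
    exact div_nonneg eH_nonneg (cast_nonneg _)
  · intro n
    rcases Nat.eq_zero_or_pos n with rfl | hn
    · have := hub 0; simp at this ⊢; linarith
    · have h := hs.lim_le_div hbdd (n := n) (by omega)
      have : (0:ℝ) < n := by exact_mod_cast hn
      rw [le_div_iff₀ this] at h
      linarith
end wsum
section step1
variable {Ω : Type*} [Fintype Ω] [Nonempty Ω] {lm : ℝ} (h0 : 0 < lm) (h1 : lm < 1) (d : Ω → ℝ)
include h0 in
lemma eH_add_ge {U : Type*} {A : Finset U} (hA : A.Nonempty) (X : U → ℝ) (i q : ℕ) :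
    hh lm d q ≤ eH (A ×ˢ (Finset.univ : Finset (Fin q → Ω)))
      (fun p => fl lm (i+q) (X p.1 + lm ^ i * wS lm d q p.2)) + log 5 := by
  set B := A ×ˢ (Finset.univ : Finset (Fin q → Ω)) with hB
  have hBn : B.Nonempty := hA.product Finset.univ_nonempty
  set T : U × (Fin q → Ω) → ℤ := fun p => fl lm (i+q) (X p.1 + lm ^ i * wS lm d q p.2) with hT
  set Y : U × (Fin q → Ω) → ℤ := fun p => fl lm q (wS lm d q p.2) with hY
  have e3 : eH B (fun p => (Y p, p.1)) ≤ eH B (fun p => (T p, p.1)) + log (2 * 2 + 1) := by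
    have := eH_cond_int hBn Y (fun p => (T p, p.1)) 2 (by norm_num) (by
      intro ω _ ω' _ h
      rw [Prod.mk.injEq] at h
      have h2 := fl_eq h0 h.1
      have := fl_close h0 q (wS lm d q ω'.2) (wS lm d q ω.2) 1 (by
        rw [h.2] at h2
        have e : X ω.1 + lm ^ i * wS lm d q ω'.2 - (X ω.1 + lm ^ i * wS lm d q ω.2)
          = lm ^ i * (wS lm d q ω'.2 - wS lm d q ω.2) := by ring
        rw [e, abs_mul, abs_of_pos (pow_pos h0 i), pow_add] at h2
        have := lt_of_mul_lt_mul_left h2 (pow_pos h0 i).le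
        linarith)
      linarith)
    refine le_trans (eH_mono ?_) this
    intro a _ b _ h
    simp only [Prod.mk.injEq] at h ⊢; tauto
  have e4 : eH B (fun p => (Y p, p.1)) = eH A (fun u => u) + hh lm d q := by
    unfold hh
    rw [← eH_prod hA Finset.univ_nonempty]
    apply eH_congr; intro a _ b _
    simp only [Prod.mk.injEq, hY]; tauto
  have e5 : eH B Prod.fst = eH A (fun u => u) :=
    eH_fst hA Finset.univ_nonempty (fun u : U => u)
  have e6 := eH_subadd hBn T Prod.fst
  have e8 : (2 * 2 + 1 : ℝ) = 5 := by norm_num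
  rw [e8] at e3
  linarith
set_option maxHeartbeats 800000 in
include h0 h1 in
lemma hoch_step1 {α C c : ℝ} (hα0 : 0 ≤ α) (hC : 0 ≤ C) (hub : ∀ n, hh lm d n ≤ α * n + C)
    (hlim : Tendsto (fun n : ℕ => hh lm d n / n) atTop (nhds α)) (hc : 0 < c)
    (hsep : ∃ᶠ n in atTop, ∀ u v : Fin n → Ω, u ≠ v → c ^ n ≤ |wS lm d n u - wS lm d n v|)
    (hlt : α < log (card Ω)) :
    ∃ β' > 0, ∀ θ > 0, ∀ N0 : ℕ, ∃ N ≥ N0, ∃ (n : ℕ) (A : Finset (Fin n → Ω)), A.Nonempty ∧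
      ∃ Z : (Fin n → Ω) → ℝ, (∀ x ∈ A, ∀ y ∈ A, |Z x - Z y| ≤ 1) ∧
        β' * N ≤ eH A (fun x => fl lm N (Z x)) ∧
        eH (A ×ˢ (Finset.univ : Finset (Fin N → Ω))) (fun p => fl lm N (Z p.1 + wS lm d N p.2))
          ≤ (α + θ) * N := by
  classical
  obtain ⟨Q0, hQ0⟩ := exists_pow_lt_of_lt_one hc h1
  set Q := Q0 + 1 with hQ
  have hQc : lm ^ (Q+1) ≤ c := by
    refine le_trans (pow_le_pow_of_le_one h0.le h1.le (by omega)) hQ0.le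
  have hQpos : (0:ℝ) < Q := by rw [hQ]; positivity
  have hQ1 : (1:ℝ) ≤ Q := by rw [hQ]; push_cast; linarith [(cast_nonneg Q0 : (0:ℝ) ≤ Q0)]
  set M := log (card Ω) with hM
  have hMpos : 0 < M := lt_of_le_of_lt hα0 hlt
  set β := M - α with hβ
  have hβpos : 0 < β := by linarith
  set β' := β / (4 * Q) with hβ'
  have hβ'pos : 0 < β' := by positivity
  refine ⟨β', hβ'pos, ?_⟩
  intro θ hθ N0
  set κ := θ / (4 * M) with hκ
  have hκpos : 0 < κ := by positivity
  set ε := κ * β' / 2 with hε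
  have hεpos : 0 < ε := by positivity
  set C' := log (2 * (2 * wD lm d + 2) + 1) with hC'
  obtain ⟨n1, hn1⟩ := eventually_atTop.1 (hlim.eventually (lt_mem_nhds (show α - ε < α by linarith)))
  obtain ⟨n2, hn2⟩ := exists_nat_gt ((C + C' + log 5 + κ * C) / (κ * β'))
  obtain ⟨n3, hn3⟩ := exists_nat_gt (C / (θ / 2))
  obtain ⟨n, hn, hs⟩ := (frequently_atTop.1 hsep) (n1 + n2 + n3 + N0 + 1)
  set N := Q * n with hN
  have hnN : n ≤ N := by rw [hN, hQ]; nlinarith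
  have hNr : (N:ℝ) = Q * n := by rw [hN]; push_cast; ring
  have hnNr : (n:ℝ) ≤ N := by exact_mod_cast hnN
  have hnpos : (0:ℝ) < n := by exact_mod_cast (by omega : 0 < n)
  have hlow : ∀ k ≥ n1 + 1, (α - ε) * k ≤ hh lm d k := by
    intro k hk
    have := hn1 k (by omega)
    have hk0 : (0:ℝ) < k := by exact_mod_cast (by omega : 0 < k)
    rw [lt_div_iff₀ hk0] at this
    exact this.le
  have hN2 : C + C' + log 5 + κ * C ≤ κ * β' * N := by
    have : (n2:ℝ) ≤ N := by exact_mod_cast (by omega : n2 ≤ N)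
    rw [div_lt_iff₀ (by positivity)] at hn2
    nlinarith [mul_pos hκpos hβ'pos]
  have hN3 : C ≤ θ / 2 * N := by
    have : (n3:ℝ) ≤ N := by exact_mod_cast (by omega : n3 ≤ N)
    rw [div_lt_iff₀ (by positivity)] at hn3
    nlinarith
  refine ⟨N, by omega, n, ?_⟩
  set Z : (Fin n → Ω) → ℝ := fun u => wS lm d n u / lm ^ n with hZ
  set J : (Fin n → Ω) → ℤ := fun u => fl lm n (wS lm d n u) with hJ
  set F : (Fin n → Ω) × (Fin N → Ω) → ℤ := fun p => fl lm N (Z p.1 + wS lm d N p.2) with hF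
  have hpn := pow_pos h0 n
  have hpN := pow_pos h0 N
  have hFe : F = fun p => fl lm (n + N) (wS lm d n p.1 + lm ^ n * wS lm d N p.2) := by
    ext p
    simp only [hF, fl, hZ, pow_add]
    congr 1; field_simp
  have hhF : hh lm d (n+N) = eH Finset.univ F := by
    unfold hh
    rw [← eH_equiv (Fin.appendEquiv n N), hFe]
    congr 1; ext p
    simp [Fin.appendEquiv, wS_append]
  have hD := wD_nonneg h1 d
  set cell : (Fin n → Ω) → Finset (Fin n → Ω) := fun u => Finset.univ.filter (fun v => J v = J u) with hcell
  have hcn : ∀ u, (cell u).Nonempty := fun u => ⟨u, by simp [hcell]⟩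
  set aF : (Fin n → Ω) → ℝ := fun u => eH (cell u ×ˢ (Finset.univ : Finset (Fin N → Ω))) F with haF
  set zZ : (Fin n → Ω) → ℝ := fun u => eH (cell u) (fun x => fl lm N (Z x)) with hzZ
  have hcU : (0:ℝ) < (Finset.univ : Finset (Fin n → Ω)).card := by
    exact_mod_cast Finset.card_pos.2 Finset.univ_nonempty
  have hcW : (0:ℝ) < (Finset.univ : Finset (Fin N → Ω)).card := by
    exact_mod_cast Finset.card_pos.2 Finset.univ_nonempty
  have hhn : hh lm d n = eH Finset.univ J := rfl
  have hz : (∑ u, zZ u) / (Finset.univ : Finset (Fin n → Ω)).card ≥ 4 * β' * N - C := by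
    have e1 := eH_chain' (A := (Finset.univ : Finset (Fin n → Ω))) (fun x => fl lm N (Z x)) J
    have e2 : eH (Finset.univ : Finset (Fin n → Ω)) (fun x => (fl lm N (Z x), J x)) = n * M := by
      rw [eH_inj Finset.univ_nonempty]
      · simp [card_univ, hM]
      · intro a _ b _ hab
        by_contra hne
        have h2 := hs a b hne
        have h3 := fl_eq h0 (Prod.mk.inj hab).1
        simp only [hZ] at h3
        rw [← sub_div, abs_div, abs_of_pos hpn, div_lt_iff₀ hpn, ← pow_add] at h3
        have h4 : lm ^ (N + n) ≤ c ^ n := by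
          have : N + n = (Q+1) * n := by rw [hN]; ring
          rw [this, pow_mul]
          exact pow_le_pow_left₀ (pow_nonneg h0.le _) hQc n
        linarith
    have e3 := hub n
    have e4 : 4 * β' * N = (M - α) * n := by
      rw [hNr, hβ', hβ]; field_simp
    rw [hhn] at e3
    rw [e4]
    simp only [ge_iff_le, hzZ, hcell]
    linarith
  have ha : (∑ u, aF u) / (Finset.univ : Finset (Fin n → Ω)).card ≤ α * N + ε * n + C + C' := by
    have e1 := eH_chain' (A := (Finset.univ : Finset ((Fin n → Ω) × (Fin N → Ω)))) F (fun p => J p.1)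
    have e2 : ∀ p ∈ (Finset.univ : Finset ((Fin n → Ω) × (Fin N → Ω))),
        eH (Finset.univ.filter (fun a : (Fin n → Ω) × (Fin N → Ω) => J a.1 = J p.1)) F = aF p.1 := by
      intro p _
      simp only [haF, hcell]
      congr 1
      ext a; simp
    rw [sum_congr rfl e2, ← univ_product_univ, Finset.sum_product, card_product] at e1
    simp only [sum_const, nsmul_eq_mul, ← mul_sum] at e1
    push_cast at e1
    have e3 : ((Finset.univ : Finset (Fin N → Ω)).card * ∑ u, aF u) /
      (((Finset.univ : Finset (Fin n → Ω)).card : ℝ) * (Finset.univ : Finset (Fin N → Ω)).card) =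
      (∑ u, aF u) / (Finset.univ : Finset (Fin n → Ω)).card := by
      field_simp
    rw [e3, eH_fst Finset.univ_nonempty Finset.univ_nonempty J, univ_product_univ] at e1
    have e4 : eH Finset.univ (fun p => (J p.1, F p)) ≤ eH Finset.univ F + C' := by
      apply eH_cond_int Finset.univ_nonempty _ F _ (by linarith)
      intro p _ p' _ h
      have h2 := fl_eq h0 h
      have := fl_close h0 n (wS lm d n p'.1) (wS lm d n p.1) (2 * wD lm d + 1) (by
        have b1 := abs_le.1 (wS_le h0 h1 d N p.2)
        have b2 := abs_le.1 (wS_le h0 h1 d N p'.2)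
        have h3 : lm ^ N ≤ 1 := pow_le_one₀ h0.le h1.le
        rw [abs_lt] at h2
        have h4 : wS lm d n p'.1 - wS lm d n p.1 = (Z p'.1 - Z p.1) * lm ^ n := by
          simp only [hZ]; field_simp
        rw [h4, abs_mul, abs_of_pos hpn]
        apply mul_le_mul_of_nonneg_right _ hpn.le
        rw [abs_le]
        constructor <;> linarith [h2.1, h2.2, b1.1, b1.2, b2.1, b2.2])
      linarith
    have e5 : eH Finset.univ (fun p => (J p.1, F p)) = eH Finset.univ (fun p => (F p, J p.1)) := by
      apply eH_congr; intro a _ b _; simp only [Prod.mk.injEq]; tauto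
    have e6 := hub (n + N)
    have e7 := hlow n (by omega)
    push_cast at e6
    linarith
  set ℓ := hh lm d N - log 5 with hℓ
  have hal : ∀ u, ℓ ≤ aF u := by
    intro u
    have := eH_add_ge h0 d (hcn u) Z 0 N
    simp only [zero_add, pow_zero, one_mul] at this
    simp only [haF, hF, hℓ]; linarith
  have hℓl : (α - ε) * N - log 5 ≤ ℓ := by
    have := hlow N (by omega); linarith
  obtain ⟨u, -, hu⟩ := Finset.exists_le_of_sum_le (s := (Finset.univ : Finset (Fin n → Ω)))
    (f := fun u => aF u - κ * zZ u) (g := fun _ => ℓ - 2 * κ * β' * N) Finset.univ_nonempty (by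
      rw [sum_sub_distrib, ← mul_sum, sum_const, nsmul_eq_mul]
      rw [ge_iff_le, le_div_iff₀ hcU] at hz
      rw [div_le_iff₀ hcU] at ha
      have : κ * ((4 * β' * N - C) * (Finset.univ : Finset (Fin n → Ω)).card) ≤ κ * ∑ i, zZ i :=
        mul_le_mul_of_nonneg_left hz hκpos.le
      have k1 : α * N + ε * n + C + C' - κ * (4 * β' * N - C) ≤ ℓ - 2 * κ * β' * N := by
        have : ε * n ≤ ε * N := mul_le_mul_of_nonneg_left hnNr hεpos.le
        have : 2 * (ε * N) = κ * β' * N := by rw [hε]; ring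
        linarith
      have k2 := mul_le_mul_of_nonneg_right k1 hcU.le
      linarith)
  have hau := hal u
  have hzu : zZ u ≤ n * M := by
    refine le_trans (eH_le_log_card (hcn u) _) ?_
    have : n * M = log (Finset.univ : Finset (Fin n → Ω)).card := by simp [card_univ, hM]
    rw [this]
    apply log_le_log
    · exact_mod_cast Finset.card_pos.2 (hcn u)
    · exact_mod_cast Finset.card_le_card (Finset.subset_univ _)
  refine ⟨cell u, hcn u, Z, ?_, ?_, ?_⟩
  · intro x hx y hy
    simp only [hcell, mem_filter, Finset.mem_univ, true_and] at hx hy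
    have := fl_eq h0 (hx.trans hy.symm)
    simp only [hZ]
    rw [← sub_div, abs_div, abs_of_pos hpn, div_le_one hpn]
    exact this.le
  · have : κ * (β' * N) ≤ κ * zZ u := by
      have : 0 ≤ κ * (β' * N) := by positivity
      linarith
    exact le_of_mul_le_mul_left this hκpos
  · have k1 : κ * zZ u ≤ θ / 4 * N := by
      calc κ * zZ u ≤ κ * (n * M) := mul_le_mul_of_nonneg_left hzu hκpos.le
        _ = θ / 4 * n := by rw [hκ]; field_simp
        _ ≤ θ / 4 * N := by gcongr
    have k2 := hub N
    have k3 : 0 < κ * β' * N := by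
      have : (0:ℝ) < N := lt_of_lt_of_le hnpos hnNr
      positivity
    have k4 : (0:ℝ) ≤ log 5 := log_nonneg (by norm_num)
    have k5 : 0 ≤ θ * N := by positivity
    have : aF u ≤ (α + θ) * N := by linarith
    exact this
end step1
section step2
variable {Ω : Type*} [Fintype Ω] [Nonempty Ω] {lm : ℝ} (h0 : 0 < lm) (h1 : lm < 1) (d : Ω → ℝ)
/-- iterated Kaimanovich–Vershik -/
lemma eH_KV_iter {W X : Type*} [Fintype W] [Nonempty W] [Fintype X] [Nonempty X]
    (s : W → ℤ) (z : X → ℤ) (k : ℕ) :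
    eH Finset.univ (fun p : (Fin k → X) × W => (∑ j, z (p.1 j)) + s p.2) ≤
      eH Finset.univ s + k * (eH Finset.univ (fun p : X × W => z p.1 + s p.2) - eH Finset.univ s) := by
  induction k with
  | zero =>
    have := eH_snd_univ (U := Fin 0 → X) s
    simp only [Finset.univ_eq_empty, Finset.sum_empty, zero_add] 
    rw [this]; simp
  | succ k ih =>
    have h := eH_KV (fun p : Fin k → X => ∑ j, z (p j)) s z
    have e1 : eH Finset.univ (fun p : (Fin (k+1) → X) × W => (∑ j, z (p.1 j)) + s p.2) =
        eH Finset.univ (fun p : (Fin k → X) × W × X => ∑ j, z (p.1 j) + s p.2.1 + z p.2.2) := by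
      rw [← eH_equiv (Equiv.prodCongr (Fin.consEquiv (fun _ : Fin (k+1) => X)) (Equiv.refl W))]
      let e : (Fin k → X) × W × X ≃ (X × (Fin k → X)) × W :=
        { toFun := fun p => ((p.2.2, p.1), p.2.1)
          invFun := fun p => (p.1.2, p.2, p.1.1)
          left_inv := fun p => rfl
          right_inv := fun p => rfl }
      rw [← eH_equiv e]
      congr 1; ext p
      simp [e, Fin.sum_univ_succ]; ring
    have e2 : eH Finset.univ (fun p : W × X => s p.1 + z p.2) =
        eH Finset.univ (fun p : X × W => z p.1 + s p.2) := by
      rw [← eH_equiv (Equiv.prodComm W X)]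
      congr 1; ext p; simp [add_comm]
    rw [e1]; push_cast
    rw [e2] at h
    linarith
include h0 in
lemma hoch_step2 {X : Type*} [Fintype X] [Nonempty X] (Z : X → ℝ) (N k : ℕ) :
    eH Finset.univ (fun p : (Fin k → X) × (Fin N → Ω) => fl lm N (∑ j, Z (p.1 j) + wS lm d N p.2)) ≤
      hh lm d N + k * (eH Finset.univ (fun p : X × (Fin N → Ω) => fl lm N (Z p.1 + wS lm d N p.2))
        + log 13 - hh lm d N) + log (4 * k + 9) := by
  have hp := pow_pos h0 N
  have hfl : ∀ x : ℝ, |(fl lm N x : ℝ) - x / lm ^ N| ≤ 1 := by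
    intro x; unfold fl
    have := floor_le (x / lm ^ N); have := lt_floor_add_one (x / lm ^ N)
    rw [abs_le]; constructor <;> linarith
  have h := eH_KV_iter (fun w : Fin N → Ω => fl lm N (wS lm d N w)) (fun x => fl lm N (Z x)) k
  have e1 : eH Finset.univ (fun p : X × (Fin N → Ω) => fl lm N (Z p.1) + fl lm N (wS lm d N p.2)) ≤
      eH Finset.univ (fun p : X × (Fin N → Ω) => fl lm N (Z p.1 + wS lm d N p.2)) + log (2 * 6 + 1) := by
    apply eH_int (A := Finset.univ) Finset.univ_nonempty
      (fun p : X × (Fin N → Ω) => fl lm N (Z p.1) + fl lm N (wS lm d N p.2))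
      (fun p : X × (Fin N → Ω) => fl lm N (Z p.1 + wS lm d N p.2)) 6 (by norm_num)
    intro a _ b _ hab
    have b1 := abs_le.1 (hfl (Z a.1)); have b2 := abs_le.1 (hfl (Z b.1))
    have b3 := abs_le.1 (hfl (wS lm d N a.2)); have b4 := abs_le.1 (hfl (wS lm d N b.2))
    have b5 := abs_le.1 (hfl (Z a.1 + wS lm d N a.2))
    have b6 := abs_le.1 (hfl (Z b.1 + wS lm d N b.2))
    have b7 : (fl lm N (Z b.1 + wS lm d N b.2) : ℝ) = fl lm N (Z a.1 + wS lm d N a.2) := by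
      exact_mod_cast hab
    rw [add_div] at b5 b6
    push_cast
    rw [abs_le]; constructor <;> linarith [b1.1, b1.2, b2.1,b2.2,b3.1,b3.2,b4.1,b4.2,b5.1,b5.2,b6.1,b6.2]
  have e2 : eH Finset.univ (fun p : (Fin k → X) × (Fin N → Ω) => fl lm N (∑ j, Z (p.1 j) + wS lm d N p.2)) ≤
      eH Finset.univ (fun p : (Fin k → X) × (Fin N → Ω) => (∑ j, fl lm N (Z (p.1 j))) + fl lm N (wS lm d N p.2))
        + log (2 * (2 * (k + 2)) + 1) := by
    apply eH_int (A := Finset.univ) Finset.univ_nonempty _ _ (2 * (k + 2)) (by positivity)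
    intro a _ b _ hab
    have hs : ∀ x : Fin k → X, |((∑ j, fl lm N (Z (x j)) : ℤ) : ℝ) - (∑ j, Z (x j)) / lm ^ N| ≤ k := by
      intro x
      push_cast
      rw [sum_div, ← sum_sub_distrib]
      refine le_trans (Finset.abs_sum_le_sum_abs _ _) ?_
      calc _ ≤ ∑ j : Fin k, (1:ℝ) := sum_le_sum (fun j _ => hfl _)
        _ = k := by simp
    have b1 := abs_le.1 (hs a.1); have b2 := abs_le.1 (hs b.1)
    have b3 := abs_le.1 (hfl (wS lm d N a.2)); have b4 := abs_le.1 (hfl (wS lm d N b.2))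
    have b5 := abs_le.1 (hfl (∑ j, Z (a.1 j) + wS lm d N a.2))
    have b6 := abs_le.1 (hfl (∑ j, Z (b.1 j) + wS lm d N b.2))
    have b7 : ((∑ j, fl lm N (Z (b.1 j)) : ℤ) : ℝ) + fl lm N (wS lm d N b.2)
      = ((∑ j, fl lm N (Z (a.1 j)) : ℤ) : ℝ) + fl lm N (wS lm d N a.2) := by
      exact_mod_cast hab
    rw [add_div] at b5 b6
    rw [abs_le]; constructor <;> linarith [b1.1, b1.2, b2.1,b2.2,b3.1,b3.2,b4.1,b4.2,b5.1,b5.2,b6.1,b6.2]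
  have e3 : (2 * (2 * (k + 2)) + 1 : ℝ) = 4 * k + 9 := by ring
  have e4 : (2 * 6 + 1 : ℝ) = 13 := by norm_num
  rw [e3] at e2; rw [e4] at e1
  have h' : eH Finset.univ (fun w : Fin N → Ω => fl lm N (wS lm d N w)) = hh lm d N := rfl
  rw [h'] at h
  have : (k:ℝ) * (eH Finset.univ (fun p : X × (Fin N → Ω) => fl lm N (Z p.1) + fl lm N (wS lm d N p.2)) - hh lm d N)
    ≤ k * (eH Finset.univ (fun p : X × (Fin N → Ω) => fl lm N (Z p.1 + wS lm d N p.2)) + log 13 - hh lm d N) := by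
    apply mul_le_mul_of_nonneg_left _ (cast_nonneg k); linarith
  linarith
end step2
section secHoch3
lemma centralBinom_sq_le (n : ℕ) : (n.centralBinom)^2 * (2*n+1) ≤ 16^n := by
  induction n with
  | zero => simp
  | succ n ih =>
    have h := Nat.succ_mul_centralBinom_succ n
    have h2 : ((n+1) * (n+1).centralBinom)^2 * (2*(n+1)+1) ≤ (n+1)^2 * 16^(n+1) := by
      rw [h]
      calc (2 * (2*n+1) * n.centralBinom)^2 * (2*(n+1)+1)
          = 4 * ((2*n+1) * (2*n+3)) * ((n.centralBinom)^2 * (2*n+1)) := by ring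
        _ ≤ 4 * (4 * (n+1)^2) * 16^n :=
          Nat.mul_le_mul (Nat.mul_le_mul_left 4 (by nlinarith)) ih
        _ = _ := by ring
    rw [mul_pow, mul_assoc] at h2
    exact Nat.le_of_mul_le_mul_left h2 (by positivity)
lemma choose_half_sq_le (n : ℕ) : (n.choose (n/2))^2 * n ≤ 4^n := by
  rcases Nat.even_or_odd' n with ⟨m, rfl | rfl⟩
  · have h := centralBinom_sq_le m
    have e : 2 * m / 2 = m := by omega
    rw [e]
    have : (4:ℕ)^(2*m) = 16^m := by rw [pow_mul]; norm_num
    rw [this]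
    rw [Nat.centralBinom_eq_two_mul_choose] at h
    exact le_trans (Nat.mul_le_mul_left _ (by omega)) h
  · have h := centralBinom_sq_le (m+1)
    have e : (2 * m + 1) / 2 = m := by omega
    rw [e]
    have h2 : (m+1).centralBinom = 2 * (2*m+1).choose m := by
      rw [Nat.centralBinom_eq_two_mul_choose]
      have : 2 * (m+1) = (2*m+1) + 1 := by ring
      have h3 : (2*m+1).choose (m+1) = (2*m+1).choose m := Nat.choose_symm_half m
      rw [this, Nat.choose_succ_succ', h3]
      ring
    rw [h2] at h
    have h3 : (4:ℕ)^(2*m+1) * 4 = 16^(m+1) := by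
      rw [← pow_succ, show 2*m+1+1 = 2*(m+1) by ring, pow_mul]; norm_num
    nlinarith [sq_nonneg ((2*m+1).choose m)]
lemma log_choose_half (n : ℕ) (hn : 0 < n) :
    log n / 2 ≤ log ((2:ℝ)^n / (n.choose (n/2))) := by
  have h := choose_half_sq_le n
  have hc : 0 < n.choose (n/2) := Nat.choose_pos (by omega)
  have hc' : (0:ℝ) < n.choose (n/2) := by exact_mod_cast hc
  have hn' : (0:ℝ) < n := by exact_mod_cast hn
  have h2 : (n:ℝ) ≤ ((2:ℝ)^n / (n.choose (n/2)))^2 := by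
    rw [div_pow, le_div_iff₀ (by positivity), ← pow_mul, mul_comm n 2, pow_mul]
    norm_num
    rw [mul_comm]
    exact_mod_cast h
  have h3 := log_le_log hn' h2
  rw [log_pow] at h3
  push_cast at h3
  linarith
lemma exists_involution {X : Type*} [Fintype X] (R : X → X → Prop) (hs : ∀ x y, R x y → R y x)
    (hi : ∀ x, ¬ R x x) : ∃ τ : X → X, Function.Involutive τ ∧ (∀ x, τ x ≠ x → R x (τ x)) ∧
      ∀ x y, τ x = x → τ y = y → ¬ R x y := by
  classical
  set P : Finset (X → X) := Finset.univ.filter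
    (fun τ => Function.Involutive τ ∧ (∀ x, τ x ≠ x → R x (τ x))) with hP
  have hne : P.Nonempty := ⟨id, mem_filter.2 ⟨Finset.mem_univ _, fun x => rfl, fun x hx => absurd rfl hx⟩⟩
  obtain ⟨τ, hτ, hmax⟩ := Finset.exists_max_image P (fun τ => (Finset.univ.filter (fun x => τ x ≠ x)).card) hne
  simp only [hP, mem_filter, Finset.mem_univ, true_and] at hτ hmax
  refine ⟨τ, hτ.1, hτ.2, ?_⟩
  intro x y hx hy hxy
  have hxy' : x ≠ y := by rintro rfl; exact hi _ hxy
  set τ' : X → X := fun z => if z = x then y else if z = y then x else τ z with hτ'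
  have hinv : ∀ z, τ (τ z) = z := hτ.1
  have h1 : Function.Involutive τ' := by
    intro z
    by_cases hzx : z = x
    · subst hzx; simp [hτ']
    by_cases hzy : z = y
    · subst hzy; simp [hτ', hzx]
    have a1 : τ z ≠ x := by intro h; apply hzx; rw [← hinv z, h, hx]
    have a2 : τ z ≠ y := by intro h; apply hzy; rw [← hinv z, h, hy]
    simp [hτ', hzx, hzy, a1, a2, hinv]
  have h2 : ∀ z, τ' z ≠ z → R z (τ' z) := by
    intro z hz
    by_cases hzx : z = x
    · subst hzx; simpa [hτ'] using hxy
    by_cases hzy : z = y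
    · subst hzy; simpa [hτ', hzx] using hs _ _ hxy
    simp only [hτ', hzx, hzy, if_false] at hz ⊢
    exact hτ.2 z hz
  have h3 := hmax τ' ⟨h1, h2⟩
  have h4 : (Finset.univ.filter (fun x => τ x ≠ x)) ⊂ (Finset.univ.filter (fun x => τ' x ≠ x)) := by
    rw [Finset.ssubset_iff_of_subset]
    · refine ⟨x, ?_, ?_⟩
      · simp [hτ', hxy'.symm]
      · simp [hx]
    · intro z hz
      simp only [mem_filter, Finset.mem_univ, true_and] at hz ⊢
      have a1 : z ≠ x := by rintro rfl; exact hz hx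
      have a2 : z ≠ y := by rintro rfl; exact hz hy
      simpa [hτ', a1, a2] using hz
  exact absurd (Finset.card_lt_card h4) (not_lt.2 h3)
/-- the involutions used at scale `i` -/
structure GoodInv {X : Type*} (lm : ℝ) (Z : X → ℝ) (i g : ℕ) (τ : X → X) : Prop where
  inv : Function.Involutive τ
  cell : ∀ x, fl lm i (Z x) = fl lm i (Z (τ x))
  sep : ∀ x, τ x ≠ x → lm ^ (i+g) ≤ |Z x - Z (τ x)|
  fix : ∀ x y, τ x = x → τ y = y → fl lm i (Z x) = fl lm i (Z y) → |Z x - Z y| < lm ^ (i+g)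
lemma exists_goodInv {X : Type*} [Fintype X] {lm : ℝ} (h0 : 0 < lm) (Z : X → ℝ) (i g : ℕ) :
    ∃ τ, GoodInv lm Z i g τ := by
  obtain ⟨τ, a1, a2, a3⟩ := exists_involution
    (fun x y => fl lm i (Z x) = fl lm i (Z y) ∧ lm ^ (i+g) ≤ |Z x - Z y|)
    (fun x y h => ⟨h.1.symm, by rw [abs_sub_comm]; exact h.2⟩)
    (fun x h => by have := pow_pos h0 (i+g); simp at h; linarith)
  refine ⟨τ, a1, ?_, fun x hx => (a2 x hx).2, ?_⟩
  · intro x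
    by_cases hx : τ x = x
    · rw [hx]
    · exact (a2 x hx).1
  · intro x y hx hy h
    by_contra hc
    exact a3 x y hx hy ⟨h, not_lt.1 hc⟩
open Classical in
/-- fraction of moved points -/
def mvp {X : Type*} [Fintype X] (τ : X → X) : ℝ :=
  ((Finset.univ.filter (fun x => τ x ≠ x)).card : ℝ) / card X
lemma mvp_entropy {X : Type*} [Fintype X] [Nonempty X] {lm : ℝ} (h0 : 0 < lm) (h1 : lm < 1) (Z : X → ℝ) (i g : ℕ)
    (τ : X → X) (h : GoodInv lm Z i g τ) :
    eH Finset.univ (fun x => fl lm (i+g) (Z x)) ≤ eH Finset.univ (fun x => fl lm i (Z x)) +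
      log 3 + log 5 + mvp τ * log (2 * (lm ^ g)⁻¹ + 3) := by
  classical
  have hn := (Finset.univ_nonempty : (Finset.univ : Finset X).Nonempty)
  have hpg := pow_pos h0 g
  have hpi := pow_pos h0 i
  set mv : X → ℤ := fun x => if τ x ≠ x then 1 else 0 with hmv
  have hcl : ∀ x y, fl lm i (Z x) = fl lm i (Z y) →
      |(fl lm (i+g) (Z x) : ℝ) - fl lm (i+g) (Z y)| ≤ (lm ^ g)⁻¹ + 1 := by
    intro x y hxy
    apply fl_close h0
    have := fl_eq h0 hxy
    rw [pow_add]
    have e : (lm^g)⁻¹ * (lm ^ i * lm ^ g) = lm ^ i := by field_simp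
    rw [e]; exact this.le
  have e1 := eH_cond_int hn mv (fun x => fl lm i (Z x)) 1 (by norm_num) (by
    intro x _ y _ _
    simp only [hmv]
    split_ifs <;> simp)
  have e2 := eH_cond_card hn (fun x => fl lm (i+g) (Z x)) (fun x => (mv x, fl lm i (Z x)))
    (fun y => if y.1 = 1 then 2 * (lm ^ g)⁻¹ + 3 else 5) (by
      intro x _
      have mem : ∀ z : ℤ, z ∈ @Finset.image _ _ (fun a b => Classical.propDecidable (a = b)) (fun x => fl lm (i+g) (Z x))
          ((Finset.univ : Finset X).filter (fun a => (mv a, fl lm i (Z a)) = (mv x, fl lm i (Z x)))) →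
          ∃ y, mv y = mv x ∧ fl lm i (Z y) = fl lm i (Z x) ∧ fl lm (i+g) (Z y) = z := by
        intro z hz
        obtain ⟨y, hy, hyz⟩ := (@Finset.mem_image _ _ (fun a b => Classical.propDecidable (a = b)) _ _ _).1 hz
        simp only [mem_filter, Finset.mem_univ, true_and, Prod.mk.injEq] at hy
        exact ⟨y, hy.1, hy.2, hyz⟩
      by_cases hx : mv x = 1
      · show _ ≤ (if mv x = 1 then 2 * (lm ^ g)⁻¹ + 3 else (5:ℝ))
        rw [if_pos hx]
        have := int_card_le _ (fl lm (i+g) (Z x)) ((lm^g)⁻¹ + 1) (by positivity) (fun z hz => by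
          obtain ⟨y, -, h2, rfl⟩ := mem z hz
          exact hcl y x h2)
        have t2 := this.trans (show 2 * ((lm^g)⁻¹ + 1) + 1 ≤ 2 * (lm ^ g)⁻¹ + 3 by linarith)
        exact le_trans (le_of_eq (by congr!)) t2
      · show _ ≤ (if mv x = 1 then 2 * (lm ^ g)⁻¹ + 3 else (5:ℝ))
        rw [if_neg hx]
        have := int_card_le _ (fl lm (i+g) (Z x)) 2 (by positivity) (fun z hz => by
          obtain ⟨y, h1, h2, rfl⟩ := mem z hz
          have hx' : τ x = x := by
            by_contra hne; apply hx; simp [hmv, hne]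
          have hy' : τ y = y := by
            by_contra hne; apply hx; rw [← h1]; simp [hmv, hne]
          have := h.fix y x hy' hx' h2
          have := fl_close h0 (i+g) (Z y) (Z x) 1 (by linarith)
          linarith)
        have t2 := this.trans (show (2:ℝ) * 2 + 1 ≤ 5 by norm_num)
        exact le_trans (le_of_eq (by congr!)) t2)
  have e3 : eH Finset.univ (fun x => fl lm (i+g) (Z x)) ≤
      eH Finset.univ (fun x => (fl lm (i+g) (Z x), (mv x, fl lm i (Z x)))) := by
    apply eH_mono; intro a _ b _ hab; exact (Prod.mk.inj hab).1
  have hcX : (0:ℝ) < (Finset.univ : Finset X).card := by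
    exact_mod_cast Finset.card_pos.2 Finset.univ_nonempty
  have e4 : (∑ x : X, log (if mv x = 1 then 2 * (lm ^ g)⁻¹ + 3 else 5)) / (Finset.univ : Finset X).card
      ≤ log 5 + mvp τ * log (2 * (lm ^ g)⁻¹ + 3) := by
    rw [← avg_const hn (log 5)]
    unfold mvp
    rw [div_mul_eq_mul_div, ← card_univ, ← add_div]
    apply div_le_div_of_nonneg_right _ hcX.le
    have : (((Finset.univ.filter (fun x => τ x ≠ x)).card : ℝ) * log (2 * (lm ^ g)⁻¹ + 3)) =
      ∑ x : X, if τ x ≠ x then log (2 * (lm ^ g)⁻¹ + 3) else 0 := by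
      rw [← sum_filter, sum_const, nsmul_eq_mul]
    rw [this, ← sum_add_distrib]
    apply sum_le_sum
    intro x _
    have l5 : 0 ≤ log 5 := log_nonneg (by norm_num)
    by_cases hx : τ x ≠ x
    · simp [hmv, hx]; exact l5
    · simp [hmv, hx]
  have e5 : (2 * 1 + 1 : ℝ) = 3 := by norm_num
  rw [e5] at e1
  linarith
/-- Sperner bound -/
lemma sperner_entropy {X : Type*} [DecidableEq X] {lm : ℝ} (h0 : 0 < lm) (Z : X → ℝ) (i g k : ℕ)
    (τ : X → X) (h : GoodInv lm Z i g τ) (x0 : Fin k → X) (c : ℝ)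
    (hn : 0 < (Finset.univ.filter (fun j => τ (x0 j) ≠ x0 j)).card) :
    log ((Finset.univ.filter (fun j => τ (x0 j) ≠ x0 j)).card) / 2
      - log (2 * (lm ^ g)⁻¹ + 3) ≤
    eH (piFinset (fun j => ({x0 j, τ (x0 j)} : Finset X)))
      (fun x => fl lm i (∑ j, Z (x j) + c)) := by
  set Xs := piFinset (fun j => ({x0 j, τ (x0 j)} : Finset X)) with hXs
  have hpg := pow_pos h0 g
  have hXn : Xs.Nonempty := ⟨x0, by simp [hXs]⟩
  set n := (Finset.univ.filter (fun j => τ (x0 j) ≠ x0 j)).card with hnd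
  have e1 : eH Xs (fun x => fl lm (i+g) (∑ j, Z (x j) + c)) ≤
      eH Xs (fun x => fl lm i (∑ j, Z (x j) + c)) + log (2 * ((lm ^ g)⁻¹ + 1) + 1) := by
    apply eH_int hXn _ _ _ (by positivity)
    intro x _ y _ hxy
    apply fl_close h0
    have := fl_eq h0 hxy
    rw [pow_add]
    have e : (lm^g)⁻¹ * (lm ^ i * lm ^ g) = lm ^ i := by field_simp
    rw [e]; exact this.le
  have hcard : (Xs.card : ℝ) = 2 ^ n := by
    have : Xs.card = 2 ^ n := by
      rw [hXs, Fintype.card_piFinset, hnd, Finset.card_filter, ← Finset.prod_pow_eq_pow_sum]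
      apply Finset.prod_congr rfl
      intro j _
      split_ifs with hj
      · rw [Finset.card_pair (Ne.symm hj)]; simp
      · push Not at hj; simp [hj]
    rw [this]; push_cast; rfl
  set MJ := {j : Fin k // τ (x0 j) ≠ x0 j} with hMJ
  have hMJc : card MJ = n := by
    rw [hnd, Fintype.card_subtype]
  set hi : Fin k → X := fun j => if Z (x0 j) < Z (τ (x0 j)) then τ (x0 j) else x0 j with hhi
  have hmem : ∀ x ∈ Xs, ∀ j, x j = x0 j ∨ x j = τ (x0 j) := by
    intro x hx j
    have := Fintype.mem_piFinset.1 hx j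
    simpa using this
  have hle : ∀ x ∈ Xs, ∀ j, Z (x j) ≤ Z (hi j) := by
    intro x hx j
    simp only [hhi]
    rcases hmem x hx j with h' | h' <;> rw [h'] <;> split_ifs with h2 <;> linarith
  have hlt : ∀ x ∈ Xs, ∀ j, τ (x0 j) ≠ x0 j → x j ≠ hi j → Z (x j) + lm ^ (i+g) ≤ Z (hi j) := by
    intro x hx j hj hne
    have hs := h.sep (x0 j) hj
    simp only [hhi] at hne ⊢
    split_ifs at hne ⊢ with h2
    · rcases hmem x hx j with h' | h'
      · rw [h']; rw [abs_of_neg (by linarith)] at hs; linarith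
      · exact absurd h' hne
    · rcases hmem x hx j with h' | h'
      · exact absurd h' hne
      · rw [h']; rw [abs_of_nonneg (by linarith)] at hs; linarith
  have hunm : ∀ x ∈ Xs, ∀ j, ¬ (τ (x0 j) ≠ x0 j) → x j = x0 j := by
    intro x hx j hj
    push Not at hj
    rcases hmem x hx j with h' | h'
    · exact h'
    · rw [h', hj]
  have hhi2 : ∀ j, hi j = x0 j ∨ hi j = τ (x0 j) := by
    intro j
    by_cases h2 : Z (x0 j) < Z (τ (x0 j))
    · right; exact if_pos h2
    · left; exact if_neg h2
  have hnhi : ∀ x ∈ Xs, ∀ y ∈ Xs, ∀ j, x j ≠ hi j → y j ≠ hi j → x j = y j := by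
    intro x hx y hy j h3 h4
    rcases hhi2 j with e | e <;> rw [e] at h3 h4
    · rw [(hmem x hx j).resolve_left h3, (hmem y hy j).resolve_left h4]
    · rw [(hmem x hx j).resolve_right h3, (hmem y hy j).resolve_right h4]
  set φ : (Fin k → X) → Finset MJ := fun x => Finset.univ.filter (fun j => x j.1 = hi j.1) with hφ
  have hinj : ∀ x ∈ Xs, ∀ y ∈ Xs, φ x = φ y → x = y := by
    intro x hx y hy hxy
    funext j
    by_cases hj : τ (x0 j) ≠ x0 j
    · have h2 : x j = hi j ↔ y j = hi j := by
        have := Finset.ext_iff.1 hxy ⟨j, hj⟩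
        simpa [hφ] using this
      by_cases h3 : x j = hi j
      · rw [h3, h2.1 h3]
      · have h4 : y j ≠ hi j := fun h => h3 (h2.2 h)
        exact hnhi x hx y hy j h3 h4
    · rw [hunm x hx j hj, hunm y hy j hj]
  have e2 : log (Xs.card / (n.choose (n/2) : ℝ)) ≤ eH Xs (fun x => fl lm (i+g) (∑ j, Z (x j) + c)) := by
    apply eH_ge hXn
    intro x hx
    unfold eN
    norm_cast
    classical
    set B := Xs.filter (fun y => fl lm (i+g) (∑ j, Z (y j) + c) = fl lm (i+g) (∑ j, Z (x j) + c)) with hB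
    have hanti : IsAntichain (· ⊆ ·) ((B.image φ : Finset (Finset MJ)) : Set (Finset MJ)) := by
      intro s hs t ht hst hsub
      simp only [Finset.coe_image, Set.mem_image, Finset.mem_coe] at hs ht
      obtain ⟨y, hy, rfl⟩ := hs
      obtain ⟨z, hz, rfl⟩ := ht
      rw [hB, mem_filter] at hy hz
      have hyz := fl_eq h0 (hy.2.trans hz.2.symm)
      have hle2 : ∀ j, Z (y j) ≤ Z (z j) := by
        intro j
        by_cases hj : τ (x0 j) ≠ x0 j
        · by_cases h3 : y j = hi j
          · have : (⟨j, hj⟩ : MJ) ∈ φ z := hsub (by simp [hφ, h3])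
            have h4 : z j = hi j := by simpa [hφ] using this
            rw [h3, h4]
          · by_cases h4 : z j = hi j
            · rw [h4]; exact hle y hy.1 j
            · rw [hnhi y hy.1 z hz.1 j h3 h4]
        · rw [hunm y hy.1 j hj, hunm z hz.1 j hj]
      obtain ⟨j, hj1, hj2⟩ : ∃ j : MJ, j ∈ φ z ∧ j ∉ φ y := by
        by_contra hcon
        push Not at hcon
        exact hst (Finset.Subset.antisymm hsub hcon)
      have h4 : z j.1 = hi j.1 := by simpa [hφ] using hj1
      have h3 : y j.1 ≠ hi j.1 := by simpa [hφ] using hj2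
      have h5 := hlt y hy.1 j.1 j.2 h3
      rw [← h4] at h5
      have h6 : ∑ j, Z (y j) + lm ^ (i+g) ≤ ∑ j, Z (z j) := by
        rw [← Finset.add_sum_erase _ _ (Finset.mem_univ j.1), ← Finset.add_sum_erase Finset.univ (fun j => Z (z j)) (Finset.mem_univ j.1)]
        have := sum_le_sum (s := Finset.univ.erase j.1) (fun j _ => hle2 j)
        linarith
      rw [abs_lt] at hyz
      linarith [hyz.1]
    have := hanti.sperner
    rw [Finset.card_image_of_injOn, hMJc] at this
    · exact le_trans (le_of_eq (by rw [hB]; congr!)) this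
    · intro y hy z hz hyz
      rw [hB, Finset.mem_coe, mem_filter] at hy hz
      exact hinj y hy.1 z hz.1 hyz
  rw [hcard] at e2
  have e3 := log_choose_half n hn
  have e4 : (2 * ((lm ^ g)⁻¹ + 1) + 1) = 2 * (lm ^ g)⁻¹ + 3 := by ring
  rw [e4] at e1
  linarith
end secHoch3
section secHoch4
lemma avg_fst {U V : Type*} [Fintype U] [Fintype V] [Nonempty V] (f : U → ℝ) :
    (∑ p : U × V, f p.1) / ((Finset.univ : Finset (U × V)).card : ℝ)
      = (∑ u, f u) / ((Finset.univ : Finset U).card : ℝ) := by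
  have hV : (card V : ℝ) ≠ 0 := by exact_mod_cast Fintype.card_ne_zero
  rw [Fintype.sum_prod_type]
  simp only [sum_const, card_univ, nsmul_eq_mul, Fintype.card_prod, Nat.cast_mul]
  rw [← mul_sum]
  by_cases h : (card U : ℝ) = 0
  · simp [h]
  · field_simp
lemma eH_prod_ge {U V β : Type*} {A : Finset U} {B : Finset V} (hA : A.Nonempty) (hB : B.Nonempty)
    (F : U × V → β) (b : ℝ) (h : ∀ v ∈ B, b ≤ eH A (fun x => F (x, v))) : b ≤ eH (A ×ˢ B) F := by
  classical
  have hAB : (A ×ˢ B).Nonempty := hA.product hB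
  have h1 := eH_subadd hAB F (fun p => p.2)
  have h2 := eH_chain' (A := A ×ˢ B) F (fun p => p.2)
  have h3 : b ≤ (∑ ω ∈ A ×ˢ B, eH ((A ×ˢ B).filter (fun a => a.2 = ω.2)) F) / (A ×ˢ B).card := by
    rw [← avg_const hAB b]
    refine div_le_div_of_nonneg_right (sum_le_sum ?_) (by positivity)
    rintro ⟨x, v⟩ hxv
    rw [mem_product] at hxv
    have e : (A ×ˢ B).filter (fun a => a.2 = v) =
        A.map ⟨fun x => (x, v), fun a b h => (Prod.mk.inj h).1⟩ := by
      ext ⟨y, z⟩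
      simp only [mem_filter, mem_product, Finset.mem_map]
      constructor
      · rintro ⟨⟨h1, _⟩, h3⟩; exact ⟨y, h1, Prod.ext rfl h3.symm⟩
      · rintro ⟨a, ha, hz⟩
        obtain ⟨rfl, rfl⟩ := Prod.mk.inj (show (a, v) = (y, z) from hz)
        exact ⟨⟨ha, hxv.2⟩, rfl⟩
    simp only
    rw [e, eH_map]
    exact h v hxv.2
  linarith
lemma tele_q (u : ℕ → ℝ) (q R : ℕ) :
    ∑ i ∈ Finset.range R, (u (i+q) - u i) = ∑ j ∈ Finset.range q, (u (R+j) - u j) := by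
  induction R with
  | zero => simp
  | succ R ih =>
    rw [sum_range_succ, ih]
    have h := Finset.sum_range_sub (fun j => u (R+j)) q
    have : ∑ j ∈ Finset.range q, (u (R+1+j) - u j) =
      ∑ j ∈ Finset.range q, (u (R+j) - u j) + ∑ j ∈ Finset.range q, (u (R+(j+1)) - u (R+j)) := by
      rw [← sum_add_distrib]
      apply sum_congr rfl
      intro j _
      rw [show R+1+j = R+(j+1) by ring]; ring
    rw [this, h]; simp
open Classical in
/-- number of moved coordinates -/
def mvc {X : Type*} {k : ℕ} (τ : X → X) (x : Fin k → X) : ℕ :=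
  (Finset.univ.filter (fun j => τ (x j) ≠ x j)).card
lemma mvp_nonneg {X : Type*} [Fintype X] (τ : X → X) : 0 ≤ mvp τ := by unfold mvp; positivity
lemma mvp_le_one {X : Type*} [Fintype X] (τ : X → X) : mvp τ ≤ 1 := by
  unfold mvp
  apply div_le_one_of_le₀ _ (by positivity)
  exact_mod_cast card_le_univ _
open Classical in
lemma mv_cheb {X : Type*} [Fintype X] [Nonempty X] (τ : X → X) (k : ℕ) (ps : ℝ) (hps : 0 < ps)
    (hp : ps ≤ mvp τ) (hk : 8 ≤ k * ps) :
    (1/2 : ℝ) ≤ ((Finset.univ.filter (fun x : Fin k → X => k * ps / 2 ≤ mvc τ x)).card : ℝ) /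
      ((Finset.univ : Finset (Fin k → X)).card : ℝ) := by
  set p := mvp τ with hpdef
  have hcX : (0:ℝ) < card X := by exact_mod_cast Fintype.card_pos
  have hcK : (0:ℝ) < (Finset.univ : Finset (Fin k → X)).card := by
    exact_mod_cast Finset.card_pos.2 Finset.univ_nonempty
  have hp1 : p ≤ 1 := mvp_le_one τ
  set y : X → ℝ := fun x => (if τ x ≠ x then 1 else 0) - p with hy
  have hsum1 : ∑ x, (if τ x ≠ x then (1:ℝ) else 0) = p * card X := by
    rw [hpdef, mvp, div_mul_cancel₀ _ hcX.ne', sum_boole]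
  have hy0 : ∑ x, y x = 0 := by
    simp only [hy, sum_sub_distrib]
    rw [hsum1]; simp; ring
  have hy2 : (∑ x, (y x)^2) / card X ≤ p := by
    rw [div_le_iff₀ hcX]
    have : ∀ x, (y x)^2 ≤ (if τ x ≠ x then (1:ℝ) else 0) * (1 - 2 * p) + p * p := by
      intro x; simp only [hy]; split_ifs <;> nlinarith
    refine le_trans (sum_le_sum (fun x _ => this x)) ?_
    rw [sum_add_distrib, ← sum_mul, hsum1]
    simp
    nlinarith [mul_nonneg (mvp_nonneg τ) hcX.le, mul_nonneg (mul_nonneg (mvp_nonneg τ) (mvp_nonneg τ)) hcX.le]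
  have hsm := second_moment y hy0 k
  have hmv : ∀ x : Fin k → X, ∑ j, y (x j) = mvc τ x - k * p := by
    intro x
    simp only [hy, sum_sub_distrib]
    rw [sum_boole]; simp [mvc]
  set G := Finset.univ.filter (fun x : Fin k → X => k * ps / 2 ≤ mvc τ x) with hG
  have hkp : 8 ≤ k * p := le_trans hk (by gcongr)
  have hcheb : ((Finset.univ : Finset (Fin k → X)).card - (G.card:ℝ)) * ((k*p/2)^2) ≤ ∑ x : Fin k → X, (∑ j, y (x j))^2 := by
    have e : ((Finset.univ : Finset (Fin k → X)).card - (G.card:ℝ)) = (Gᶜ.card : ℝ) := by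
      rw [Finset.card_compl, Nat.cast_sub (card_le_univ _), card_univ]
    rw [e, ← nsmul_eq_mul, ← sum_const]
    refine le_trans (sum_le_sum ?_) (Finset.sum_le_univ_sum_of_nonneg (fun x => sq_nonneg _))
    intro x hx
    have hx' : (mvc τ x : ℝ) < k * ps / 2 := by simpa [hG] using hx
    rw [hmv]
    have : (k:ℝ) * ps ≤ k * p := by gcongr
    nlinarith
  rw [div_eq_iff (by rw [← card_univ]; exact hcK.ne')] at hsm
  rw [hsm, ← card_univ] at hcheb
  rw [le_div_iff₀ hcK]
  set c := ((Finset.univ : Finset (Fin k → X)).card : ℝ) with hc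
  rw [← card_univ] at hy2
  have h3 : (c - G.card) * ((k*p/2)^2) ≤ k * p * c := by
    refine hcheb.trans ?_
    refine mul_le_mul (mul_le_mul_of_nonneg_left hy2 (by positivity)) le_rfl (by positivity) (by linarith)
  have h4 : (c - G.card) * (k*p) ≤ 4 * c := by
    have : (0:ℝ) < k * p := by linarith
    by_contra hcon
    push Not at hcon
    nlinarith
  have h5 : (0:ℝ) ≤ c - G.card := by
    have : (G.card : ℝ) ≤ c := by rw [hc, card_univ]; exact_mod_cast card_le_univ G
    linarith
  nlinarith
variable {Ω : Type*} [Fintype Ω] [Nonempty Ω] {lm : ℝ} (h0 : 0 < lm) (h1 : lm < 1) (d : Ω → ℝ)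
include h0 h1 in
lemma scale_upper {X W : Type*} [Fintype X] [Nonempty X] [Fintype W] [Nonempty W] (Z : X → ℝ) (A : W → ℝ)
    (i q g k : ℕ) (τ : X → X) (h : GoodInv lm Z (i+q) g τ) (hk : k * (lm ^ q)^2 ≤ 2) :
    eH Finset.univ (fun p : ((Fin k → X) × W) × (Fin q → Ω) =>
      (fl lm i (∑ j, Z (p.1.1 j) + A p.1.2 + lm ^ i * wS lm d q p.2), (p.1.2, fun j => s(p.1.1 j, τ (p.1.1 j)))))
    ≤ eH Finset.univ (fun p : ((Fin k → X) × W) × (Fin q → Ω) => (p.1.2, fun j => s(p.1.1 j, τ (p.1.1 j))))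
      + (1 + 2 * (wD lm d + 1)^2) + log 3 := by
  set V : ((Fin k → X) × W) × (Fin q → Ω) → W × (Fin k → Sym2 X) :=
    fun p => (p.1.2, fun j => s(p.1.1 j, τ (p.1.1 j))) with hV
  set T : ((Fin k → X) × W) × (Fin q → Ω) → ℤ :=
    fun p => fl lm i (∑ j, Z (p.1.1 j) + A p.1.2 + lm ^ i * wS lm d q p.2) with hT
  set ce : ((Fin k → X) × W) × (Fin q → Ω) → ℤ :=
    fun p => fl lm i (∑ j, (Z (p.1.1 j) + Z (τ (p.1.1 j)))/2 + A p.1.2) with hce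
  have hpi := pow_pos h0 i
  have hceV : ∀ p p', V p = V p' → ce p = ce p' := by
    intro p p' hp
    simp only [hV, Prod.mk.injEq] at hp
    simp only [hce]
    rw [hp.1]
    congr 2
    apply sum_congr rfl
    intro j _
    have := congrFun hp.2 j
    rw [Sym2.eq_iff] at this
    rcases this with ⟨e1, e2⟩ | ⟨e1, e2⟩
    · rw [e1]
    · rw [e2, e1]; ring
  have e1 : eH Finset.univ (fun p => (T p, V p)) ≤ eH Finset.univ (fun p => (T p - ce p, V p)) := by
    apply eH_mono
    intro p _ p' _ hp
    simp only [Prod.mk.injEq] at hp ⊢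
    have := hceV _ _ hp.2
    exact ⟨by omega, hp.2⟩
  have e2 := eH_sq (A := Finset.univ) Finset.univ_nonempty (fun p => T p - ce p) V
  set y : X → ℝ := fun x => (Z x - Z (τ x)) / 2 with hy
  have hy0 : ∑ x, y x = 0 := by
    simp only [hy]
    rw [← sum_div, sum_sub_distrib]
    have : ∑ x, Z (τ x) = ∑ x, Z x := Equiv.sum_comp (h.inv.toPerm τ) Z
    rw [this]; simp
  have hsm := second_moment y hy0 k
  have hcX : (0:ℝ) < card X := by exact_mod_cast Fintype.card_pos
  have hy2 : (∑ x, (y x)^2) / card X ≤ (lm^(i+q))^2/4 := by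
    rw [div_le_iff₀ hcX]
    have : ∀ x, (y x)^2 ≤ (lm^(i+q))^2/4 := by
      intro x
      have := (fl_eq h0 (h.cell x)).le
      rw [← sq_abs]
      have hab : |y x| ≤ lm^(i+q)/2 := by simp only [hy, abs_div]; norm_num; linarith
      nlinarith [abs_nonneg (y x)]
    refine le_trans (sum_le_sum (fun x _ => this x)) ?_
    simp; linarith
  have hpt : ∀ p, ((T p - ce p : ℤ) : ℝ)^2 ≤ 2 * ((∑ j, y (p.1.1 j))^2 / (lm^i)^2) + 2 * (wD lm d + 1)^2 := by
    intro p
    have hb : |(∑ j, Z (p.1.1 j) + A p.1.2 + lm ^ i * wS lm d q p.2) -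
        (∑ j, (Z (p.1.1 j) + Z (τ (p.1.1 j)))/2 + A p.1.2)| ≤ (|∑ j, y (p.1.1 j)| / lm^i + wD lm d) * lm ^ i := by
      have e : (∑ j, Z (p.1.1 j) + A p.1.2 + lm ^ i * wS lm d q p.2) -
        (∑ j, (Z (p.1.1 j) + Z (τ (p.1.1 j)))/2 + A p.1.2) = ∑ j, y (p.1.1 j) + lm ^ i * wS lm d q p.2 := by
        have : ∑ j, y (p.1.1 j) = ∑ j, Z (p.1.1 j) - ∑ j, (Z (p.1.1 j) + Z (τ (p.1.1 j)))/2 := by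
          rw [← sum_sub_distrib]; apply sum_congr rfl; intro j _; simp only [hy]; ring
        rw [this]; ring
      rw [e, add_mul, div_mul_cancel₀ _ hpi.ne']
      refine (abs_add_le _ _).trans ?_
      rw [abs_mul, abs_of_pos hpi, mul_comm (wD lm d)]
      gcongr
      exact wS_le h0 h1 d q p.2
    have hf := fl_close h0 i _ _ _ hb
    have hD := wD_nonneg h1 d
    set Y := |∑ j, y (p.1.1 j)| / lm^i with hY
    have hY0 : 0 ≤ Y := by positivity
    have e2 : (∑ j, y (p.1.1 j))^2 / (lm^i)^2 = Y^2 := by rw [hY, div_pow, sq_abs]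
    rw [e2]
    push_cast
    rw [← sq_abs]
    have : |(T p:ℝ) - ce p| ^2 ≤ (Y + (wD lm d + 1))^2 := by
      apply pow_le_pow_left₀ (abs_nonneg _)
      refine hf.trans (by linarith)
    nlinarith [sq_nonneg (Y - (wD lm d + 1))]
  have e3 : (∑ p, ((T p - ce p : ℤ) : ℝ)^2) / ((Finset.univ : Finset (((Fin k → X) × W) × (Fin q → Ω))).card : ℝ)
      ≤ 1 + 2 * (wD lm d + 1)^2 := by
    refine le_trans (div_le_div_of_nonneg_right (sum_le_sum (fun p _ => hpt p)) (by positivity)) ?_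
    rw [avg_fst (fun a : (Fin k → X) × W => 2 * ((∑ j, y (a.1 j))^2 / (lm^i)^2) + 2 * (wD lm d + 1)^2),
      avg_fst (fun a : (Fin k → X) => 2 * ((∑ j, y (a j))^2 / (lm^i)^2) + 2 * (wD lm d + 1)^2),
      sum_add_distrib, add_div, avg_const Finset.univ_nonempty]
    have : (∑ a : Fin k → X, 2 * ((∑ j, y (a j))^2 / (lm^i)^2)) / ((Finset.univ : Finset (Fin k → X)).card : ℝ) ≤ 1 := by
      rw [← mul_sum, ← sum_div, mul_div_assoc, div_right_comm, card_univ, hsm]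
      have : (k:ℝ) * ((∑ x, (y x)^2) / card X) ≤ k * ((lm^(i+q))^2/4) := by gcongr
      have h5 : (k:ℝ) * ((lm^(i+q))^2/4) ≤ (lm^i)^2 / 2 := by
        rw [pow_add]; nlinarith [sq_nonneg (lm^i)]
      have h6 := this.trans h5
      have : (k:ℝ) * ((∑ x, (y x)^2) / card X) / (lm^i)^2 ≤ 1/2 := by
        rw [div_le_iff₀ (by positivity)]; linarith
      linarith
    linarith
  push_cast at e3
  push_cast at e2
  linarith
include h0 in
open Classical in
lemma scale_lower {X W : Type*} [Fintype X] [Nonempty X] [Fintype W] [Nonempty W] (Z : X → ℝ) (A : W → ℝ)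
    (i q g k : ℕ) (τ : X → X) (h : GoodInv lm Z (i+q) g τ) (ps : ℝ) (hps : 0 < ps) (hk : 8 ≤ k * ps)
    (a b : ℝ) (ha : a = hh lm d q - log 5)
    (hb : b = log (k * ps / 2) / 2 - log (2 * (lm ^ g)⁻¹ + 3)) (hab : a ≤ b) :
    eH Finset.univ (fun p : ((Fin k → X) × W) × (Fin q → Ω) => (p.1.2, fun j => s(p.1.1 j, τ (p.1.1 j))))
      + a + (b - a) / 2 * (mvp τ - ps) ≤
    eH Finset.univ (fun p : ((Fin k → X) × W) × (Fin q → Ω) =>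
      (fl lm (i+q) (∑ j, Z (p.1.1 j) + A p.1.2 + lm ^ i * wS lm d q p.2), (p.1.2, fun j => s(p.1.1 j, τ (p.1.1 j))))) := by
  set V : ((Fin k → X) × W) × (Fin q → Ω) → W × (Fin k → Sym2 X) :=
    fun p => (p.1.2, fun j => s(p.1.1 j, τ (p.1.1 j))) with hV
  set T : ((Fin k → X) × W) × (Fin q → Ω) → ℤ :=
    fun p => fl lm (i+q) (∑ j, Z (p.1.1 j) + A p.1.2 + lm ^ i * wS lm d q p.2) with hT
  rw [eH_chain' T V, add_assoc]
  gcongr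
  set fb : ((Fin k → X) × W) → ℝ := fun p => a + (b - a) * (if k * ps / 2 ≤ mvc τ p.1 then 1 else 0) with hfb
  have key : ∀ p, fb p.1 ≤ eH (Finset.univ.filter (fun p' => V p' = V p)) T := by
    rintro ⟨⟨x0, w0⟩, v0⟩
    set P := piFinset (fun j => ({x0 j, τ (x0 j)} : Finset X)) with hP
    have hPn : P.Nonempty := ⟨x0, by simp [hP]⟩
    set em : (Fin k → X) ↪ (Fin k → X) × W := ⟨fun x => (x, w0), fun a b h => (Prod.mk.inj h).1⟩ with hem
    have e : (Finset.univ.filter (fun p' => V p' = V ((x0, w0), v0))) = (P.map em) ×ˢ Finset.univ := by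
      ext ⟨⟨x, w⟩, v⟩
      simp only [hV, hP, hem, mem_filter, Finset.mem_univ, true_and, Prod.mk.injEq, mem_product,
        Finset.mem_map, Fintype.mem_piFinset, Finset.mem_insert, Finset.mem_singleton, and_true]
      constructor
      · rintro ⟨rfl, hs⟩
        refine ⟨x, ?_, rfl⟩
        intro j
        have := congrFun hs j
        rw [Sym2.eq_iff] at this
        rcases this with ⟨e1, _⟩ | ⟨e1, _⟩
        · left; exact e1
        · right; exact e1
      · rintro ⟨y, hy, hz⟩
        obtain ⟨rfl, rfl⟩ := Prod.mk.inj (show (y, w0) = (x, w) from hz)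
        refine ⟨rfl, ?_⟩
        funext j
        rw [Sym2.eq_iff]
        rcases hy j with e1 | e1
        · left; rw [e1]; exact ⟨rfl, rfl⟩
        · right; rw [e1, h.inv]; exact ⟨rfl, rfl⟩
    rw [e]
    have hlow : a ≤ eH ((P.map em) ×ˢ Finset.univ) T := by
      have := eH_add_ge h0 d (hPn.map (f := em)) (fun y => ∑ j, Z (y.1 j) + A y.2) i q
      rw [ha]; linarith
    simp only [hfb]
    split_ifs with hg
    · have hpos : (0:ℝ) < mvc τ x0 := by linarith
      have : b ≤ eH ((P.map em) ×ˢ Finset.univ) T := by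
        apply eH_prod_ge (hPn.map) Finset.univ_nonempty
        intro v _
        rw [eH_map]
        have hs := sperner_entropy h0 Z (i+q) g k τ h x0 (A w0 + lm ^ i * wS lm d q v)
          (by have : 0 < mvc τ x0 := by exact_mod_cast hpos
              exact this)
        have e3 : (fun ω => T (em ω, v)) = fun x => fl lm (i+q) (∑ j, Z (x j) + (A w0 + lm ^ i * wS lm d q v)) := by
          funext x; exact congrArg (fl lm (i+q)) (add_assoc _ _ _)
        rw [e3]
        refine le_trans ?_ hs
        rw [hb]
        have : log (k * ps / 2) ≤ log (mvc τ x0) := log_le_log (by linarith) hg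
        have e4 : log (mvc τ x0) = log ((Finset.univ.filter (fun j => τ (x0 j) ≠ x0 j)).card) := rfl
        linarith
      linarith
    · linarith
  have havg : a + (b - a) / 2 * (mvp τ - ps) ≤ (∑ p : ((Fin k → X) × W) × (Fin q → Ω), fb p.1) /
      ((Finset.univ : Finset (((Fin k → X) × W) × (Fin q → Ω))).card : ℝ) := by
    rw [avg_fst fb]
    simp only [hfb]
    rw [avg_fst (fun x : Fin k → X => a + (b - a) * (if k * ps / 2 ≤ mvc τ x then 1 else 0)),
      sum_add_distrib, add_div, avg_const Finset.univ_nonempty, ← mul_sum, sum_boole,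
      mul_div_assoc]
    have hba : 0 ≤ b - a := by linarith
    by_cases hp : ps ≤ mvp τ
    · have h1 := mv_cheb τ k ps hps hp hk
      have h2 := mvp_le_one τ
      have := mul_le_mul_of_nonneg_left h1 hba
      nlinarith
    · have : (b - a) / 2 * (mvp τ - ps) ≤ 0 := by
        apply mul_nonpos_of_nonneg_of_nonpos <;> linarith
      have : 0 ≤ (b - a) * (((Finset.univ.filter (fun x : Fin k → X => k * ps / 2 ≤ mvc τ x)).card : ℝ) /
        ((Finset.univ : Finset (Fin k → X)).card : ℝ)) := by positivity
      linarith
  refine havg.trans (div_le_div_of_nonneg_right (sum_le_sum (fun p _ => key p)) (by positivity))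
end secHoch4
section secHoch5
variable {Ω : Type*} [Fintype Ω] [Nonempty Ω] {lm : ℝ} (h0 : 0 < lm) (h1 : lm < 1) (d : Ω → ℝ)
include h0 h1 in
lemma fl_coarse {E : Type*} {A : Finset E} (hA : A.Nonempty) (T : E → ℝ) {i j : ℕ} (hij : i ≤ j) :
    eH A (fun p => (fl lm i (T p), fl lm j (T p))) ≤ eH A (fun p => fl lm j (T p)) + log 5 := by
  have := eH_cond_int hA (fun p => fl lm i (T p)) (fun p => fl lm j (T p)) 2 (by norm_num) (by
    intro ω _ ω' _ h
    have h2 := fl_eq h0 h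
    have h3 : lm ^ j ≤ lm ^ i := pow_le_pow_of_le_one h0.le h1.le hij
    have := fl_close h0 i (T ω') (T ω) 1 (by linarith)
    linarith)
  norm_num at this ⊢
  exact this
include h0 h1 in
lemma fl_coarse' {E : Type*} {A : Finset E} (hA : A.Nonempty) (T : E → ℝ) {i j : ℕ} (hij : i ≤ j) :
    eH A (fun p => fl lm i (T p)) ≤ eH A (fun p => fl lm j (T p)) + log 5 :=
  le_trans (eH_mono (fun _ _ _ _ h => (Prod.mk.inj h).1)) (fl_coarse h0 h1 hA T hij)
include h0 h1 in
lemma scale_step {X : Type*} [Fintype X] [Nonempty X] (Z : X → ℝ)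
    (i q g k N : ℕ) (hN : i + q ≤ N) (τ : X → X) (h : GoodInv lm Z (i+q) g τ) (ps : ℝ) (hps : 0 < ps) (hk : 8 ≤ k * ps)
    (hk2 : k * (lm ^ q)^2 ≤ 2)
    (a b : ℝ) (ha : a = hh lm d q - log 5)
    (hb : b = log (k * ps / 2) / 2 - log (2 * (lm ^ g)⁻¹ + 3)) (hab : a ≤ b) :
    a + (b - a) / 2 * (mvp τ - ps) - (log 5 + (1 + 2 * (wD lm d + 1)^2) + log 3) ≤
    eH Finset.univ (fun p : (Fin k → X) × (Fin N → Ω) => fl lm (i+q) (∑ j, Z (p.1 j) + wS lm d N p.2))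
    - eH Finset.univ (fun p : (Fin k → X) × (Fin N → Ω) => fl lm i (∑ j, Z (p.1 j) + wS lm d N p.2)) := by
  obtain ⟨r, rfl⟩ := Nat.exists_eq_add_of_le hN
  set A : (Fin i → Ω) × (Fin r → Ω) → ℝ := fun w => wS lm d i w.1 + lm^(i+q) * wS lm d r w.2 with hA
  set e : ((Fin k → X) × ((Fin i → Ω) × (Fin r → Ω))) × (Fin q → Ω) ≃ (Fin k → X) × (Fin (i+q+r) → Ω) :=
    { toFun := fun p => (p.1.1, Fin.appendEquiv (i+q) r (Fin.appendEquiv i q (p.1.2.1, p.2), p.1.2.2))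
      invFun := fun p => ((p.1, (((Fin.appendEquiv i q).symm ((Fin.appendEquiv (i+q) r).symm p.2).1).1,
        ((Fin.appendEquiv (i+q) r).symm p.2).2)), ((Fin.appendEquiv i q).symm ((Fin.appendEquiv (i+q) r).symm p.2).1).2)
      left_inv := fun p => by simp only [Equiv.symm_apply_apply]
      right_inv := fun p => by simp only [Prod.mk.eta, Equiv.apply_symm_apply] } with he
  have hT : ∀ j, (fun p => (fun p : (Fin k → X) × (Fin (i+q+r) → Ω) => fl lm j (∑ j, Z (p.1 j) + wS lm d (i+q+r) p.2)) (e p)) =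
      fun p : ((Fin k → X) × ((Fin i → Ω) × (Fin r → Ω))) × (Fin q → Ω) =>
        fl lm j (∑ j, Z (p.1.1 j) + A p.1.2 + lm ^ i * wS lm d q p.2) := by
    intro j; funext p
    have e1 : (e p).2 = Fin.append (Fin.append p.1.2.1 p.2) p.1.2.2 := rfl
    have e2 : (e p).1 = p.1.1 := rfl
    simp only [e1, e2, wS_append, hA]
    congr 1; ring
  rw [← eH_equiv e, ← eH_equiv e, hT, hT]
  have s1 := scale_upper h0 h1 d Z A i q g k τ h hk2
  have s2 := scale_lower h0 d Z A i q g k τ h ps hps hk a b ha hb hab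
  set V : ((Fin k → X) × ((Fin i → Ω) × (Fin r → Ω))) × (Fin q → Ω) → ((Fin i → Ω) × (Fin r → Ω)) × (Fin k → Sym2 X) :=
    fun p => (p.1.2, fun j => s(p.1.1 j, τ (p.1.1 j))) with hV
  set T : ((Fin k → X) × ((Fin i → Ω) × (Fin r → Ω))) × (Fin q → Ω) → ℝ :=
    fun p => ∑ j, Z (p.1.1 j) + A p.1.2 + lm ^ i * wS lm d q p.2 with hTT
  have m1 := eH_submod (A := Finset.univ) (fun p => fl lm (i+q) (T p)) V (fun p => fl lm i (T p))
  have m2 := fl_coarse h0 h1 (A := Finset.univ) Finset.univ_nonempty T (show i ≤ i + q by omega)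
  have m3 : eH Finset.univ (fun p => (fl lm (i+q) (T p), fl lm i (T p))) ≤ eH Finset.univ (fun p => (fl lm i (T p), fl lm (i+q) (T p))) :=
    eH_mono (fun a _ b _ h => by simp only [Prod.mk.injEq] at h ⊢; exact h.symm)
  have m4 : eH Finset.univ (fun p => (V p, fl lm i (T p))) ≤ eH Finset.univ (fun p => (fl lm i (T p), V p)) :=
    eH_mono (fun a _ b _ h => by simp only [Prod.mk.injEq] at h ⊢; exact h.symm)
  have m5 : eH Finset.univ (fun p => (fl lm (i+q) (T p), V p)) ≤ eH Finset.univ (fun p => (fl lm (i+q) (T p), (V p, fl lm i (T p)))) :=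
    eH_mono (fun a _ b _ h => by simp only [Prod.mk.injEq] at h ⊢; exact ⟨h.1, h.2.1⟩)
  linarith
include h0 h1 in
/-- lower bound for the total amount of moved mass -/
lemma mvp_sum {X : Type*} [Fintype X] [Nonempty X] (Z : X → ℝ) (hZ : ∀ x y, |Z x - Z y| ≤ 1)
    (q g R N : ℕ) (hN : R + q + g = N) (τ : ℕ → X → X) (h : ∀ i, GoodInv lm Z (i+q) g (τ i)) (B : ℝ)
    (hB : B ≤ eH Finset.univ (fun x => fl lm N (Z x))) :
    g * (B - log (2 * (lm ^ g)⁻¹ + 3) - log (2 * (lm ^ (q+g))⁻¹ + 3)) - R * (log 3 + log 5) ≤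
      (∑ i ∈ Finset.range R, mvp (τ i)) * log (2 * (lm ^ g)⁻¹ + 3) := by
  set e : ℕ → ℝ := fun j => eH Finset.univ (fun x => fl lm j (Z x)) with he
  set G := log (2 * (lm ^ g)⁻¹ + 3) with hG
  set G' := log (2 * (lm ^ (q+g))⁻¹ + 3) with hG'
  have h1' : ∑ i ∈ Finset.range R, (e (i+q+g) - e (i+q)) ≤ ∑ i ∈ Finset.range R, ((log 3 + log 5) + mvp (τ i) * G) := by
    apply sum_le_sum
    intro i _
    have := mvp_entropy h0 h1 Z (i+q) g (τ i) (h i)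
    simp only [he]; linarith
  rw [sum_add_distrib, ← sum_mul, sum_const, card_range, nsmul_eq_mul] at h1'
  have h2 := tele_q (fun j => e (j+q)) g R
  have h3 : ∑ i ∈ Finset.range R, (e (i+q+g) - e (i+q)) = ∑ j ∈ Finset.range g, (e (R+j+q) - e (j+q)) := by
    rw [← h2]; apply sum_congr rfl; intro i _; rw [show i+q+g = i+g+q by ring]
  have h4 : ∑ _j ∈ Finset.range g, (B - G - G') ≤ ∑ j ∈ Finset.range g, (e (R+j+q) - e (j+q)) := by
    apply sum_le_sum
    intro j hj
    have hj := Finset.mem_range.1 hj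
    have a1 : e N ≤ e (R+j+q) + log (2 * ((lm^g)⁻¹ + 1) + 1) := by
      apply eH_int Finset.univ_nonempty _ _ _ (by have := pow_pos h0 g; positivity)
      intro x _ y _ hxy
      apply fl_close h0
      have := (fl_eq h0 hxy).le
      refine this.trans ?_
      have hp := pow_pos h0 g
      rw [inv_mul_eq_div, le_div_iff₀ hp, ← pow_add]
      exact pow_le_pow_of_le_one h0.le h1.le (by omega)
    have a2 : e (j+q) ≤ 0 + log (2 * ((lm^(q+g))⁻¹ + 1) + 1) := by
      have e0 : eH (Finset.univ : Finset X) (fun _ => (0:ℕ)) ≤ 0 := by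
        rw [show (0:ℝ) = log ((card X : ℝ) / card X) by
          rw [div_self (by exact_mod_cast Fintype.card_ne_zero)]; simp]
        unfold eH eN
        simp [card_univ]
      refine le_trans (eH_int Finset.univ_nonempty _ (fun _ => (0:ℕ)) _ (by have := pow_pos h0 (q+g); positivity) ?_) (add_le_add e0 le_rfl)
      intro x _ y _ _
      apply fl_close h0
      refine (hZ y x).trans ?_
      have hp := pow_pos h0 (q+g)
      rw [inv_mul_eq_div, le_div_iff₀ hp, one_mul]
      exact pow_le_pow_of_le_one h0.le h1.le (by omega)
    have e4 : (2 * ((lm ^ g)⁻¹ + 1) + 1) = 2 * (lm ^ g)⁻¹ + 3 := by ring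
    have e5 : (2 * ((lm ^ (q+g))⁻¹ + 1) + 1) = 2 * (lm ^ (q+g))⁻¹ + 3 := by ring
    rw [e4, ← hG] at a1
    rw [e5, ← hG'] at a2
    linarith
  rw [sum_const, card_range, nsmul_eq_mul] at h4
  linarith
end secHoch5
section secHoch6
variable {Ω : Type*} [Fintype Ω] [Nonempty Ω] {lm : ℝ} (h0 : 0 < lm) (h1 : lm < 1) (d : Ω → ℝ)
lemma eH_sub {U β : Type*} (A : Finset U) (f : U → β) :
    eH (Finset.univ : Finset {x // x ∈ A}) (fun x => f x.1) = eH A f := by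
  have := eH_map (A := (Finset.univ : Finset {x // x ∈ A})) (Function.Embedding.subtype _) f
  rw [← Finset.attach_eq_univ, Finset.attach_map_val] at this
  rw [← Finset.attach_eq_univ, this]; rfl
lemma eH_sub_prod {U V β : Type*} [Fintype V] (A : Finset U) (f : U × V → β) :
    eH (Finset.univ : Finset ({x // x ∈ A} × V)) (fun p => f (p.1.1, p.2)) = eH (A ×ˢ Finset.univ) f := by
  have := eH_map (A := (Finset.univ : Finset ({x // x ∈ A} × V)))
    ((Function.Embedding.subtype (· ∈ A)).prodMap (Function.Embedding.refl V)) f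
  have e : (Finset.univ : Finset ({x // x ∈ A} × V)).map
    ((Function.Embedding.subtype (· ∈ A)).prodMap (Function.Embedding.refl V)) = A ×ˢ Finset.univ := by
    ext ⟨x, v⟩; simp
  rw [e] at this
  rw [this]; rfl
lemma sum_lin (R : ℕ) (f : ℕ → ℝ) (a e p K : ℝ) : ∑ i ∈ Finset.range R, (a + e * (f i - p) - K) =
      R * (a - K) + e * (∑ i ∈ Finset.range R, f i - R * p) := by
  have h : ∀ i, a + e * (f i - p) - K = (a - K - e * p) + e * f i := fun i => by ring
  simp only [h]
  rw [sum_add_distrib, ← mul_sum, sum_const, card_range, nsmul_eq_mul]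
  ring
lemma hoch_arith {R N q g k L13 L4 L5 a Δ b C C1 P ps θ δ α K bTN : ℝ} (hRr : R = N - q - g) (hg : 0 ≤ g)
    (hR0 : 0 ≤ R) (hN0 : 0 ≤ N) (hq0 : 0 < q) (hps0 : 0 < ps) (hδ0 : 0 < δ) (hK0 : 0 < K) (hl5 : 0 ≤ L5)
    (hP3 : ps * N - C1 ≤ P - R * ps) (hba : δ * q / 4 ≤ Δ)
    (hau : (α - δ * ps / 16) * q - L5 ≤ a)
    (hT : bTN ≤ α * N + C + k * (2 * θ * N + L13) + L4) (hkθ : k * θ = δ * ps / 32)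
    (hN2 : (q+g) * (α * q) + Δ * C1 + q * (C + k * L13 + L4 + L5) + 1 ≤ N * (δ * q * ps / 16))
    (hq4 : K + L5 ≤ q * (δ * ps / 16))
    (hsum : R * (a - K) + Δ * (P - R * ps) ≤ q * (bTN + L5)) : False := by
  have hΔ : 0 ≤ Δ := le_trans (by positivity) hba
  have hI1 : Δ * (ps * N - C1) ≤ Δ * (P - R * ps) := mul_le_mul_of_nonneg_left hP3 hΔ
  have hI2 : δ * q / 4 * (ps * N) ≤ Δ * (ps * N) := mul_le_mul_of_nonneg_right hba (by positivity)
  have hI3 : N * ((α - δ * ps / 16) * q - L5 - K) - (q+g) * (α * q) ≤ R * (a - K) := by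
    have h6 : R * ((α - δ * ps / 16) * q - L5 - K) ≤ R * (a - K) := mul_le_mul_of_nonneg_left (by linarith) hR0
    refine le_trans ?_ h6
    have h7 : (α - δ * ps / 16) * q - L5 - K ≤ α * q := by
      have : 0 < δ * ps / 16 * q := by positivity
      linarith
    have h8 : (q+g) * ((α - δ * ps / 16) * q - L5 - K) ≤ (q+g) * (α * q) := mul_le_mul_of_nonneg_left h7 (by linarith)
    rw [hRr]; linarith
  have hT2 : q * (bTN + L5) ≤ q * (α * N + C + k * (2 * θ * N + L13) + L4 + L5) :=
    mul_le_mul_of_nonneg_left (by linarith) hq0.le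
  have e1 : q * (α * N + C + k * (2 * θ * N + L13) + L4 + L5) =
     q * α * N + q * (2 * N) * (k * θ) + q * (C + k * L13 + L4 + L5) := by ring
  rw [e1, hkθ] at hT2
  have hNq : N * (K + L5) ≤ N * (q * (δ * ps / 16)) := mul_le_mul_of_nonneg_left hq4 hN0
  linarith
include h0 h1 in
set_option maxHeartbeats 1000000 in
lemma hoch_core {α C c : ℝ} (hα0 : 0 ≤ α) (hC : 0 ≤ C) (hub : ∀ n, hh lm d n ≤ α * n + C)
    (hlim : Tendsto (fun n : ℕ => hh lm d n / n) atTop (nhds α)) (hc : 0 < c)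
    (hsep : ∃ᶠ n in atTop, ∀ u v : Fin n → Ω, u ≠ v → c ^ n ≤ |wS lm d n u - wS lm d n v|)
    (hlt : α < log (card Ω)) (hL : α < -log lm) : False := by
  classical
  obtain ⟨β', hβ', hst⟩ := hoch_step1 h0 h1 d hα0 hC hub hlim hc hsep hlt
  set L := -log lm with hLd
  set δ := L - α with hδ
  have hδ0 : 0 < δ := by linarith
  set l15 := log 3 + log 5 with hl15
  have hl3 : 0 ≤ log 3 := log_nonneg (by norm_num)
  have hl5 : 0 ≤ log 5 := log_nonneg (by norm_num)
  have hl13 : 0 ≤ log 13 := log_nonneg (by norm_num)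
  obtain ⟨g, hg⟩ := exists_nat_gt (l15 / β')
  rw [div_lt_iff₀ hβ'] at hg
  have hpg := pow_pos h0 g
  set G := log (2 * (lm ^ g)⁻¹ + 3) with hG
  have hG0 : 0 < G := Real.log_pos (by have : 0 < (lm^g)⁻¹ := by positivity
                                       linarith)
  set ps := (g * β' - l15) / (2 * G) with hps
  have hps0 : 0 < ps := div_pos (by linarith) (by linarith)
  have hD := wD_nonneg h1 d
  set K := log 5 + (1 + 2 * (wD lm d + 1)^2) + log 3 with hK
  set ε := δ * ps / 16 with hε
  have hε0 : 0 < ε := by positivity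
  have hev : ∀ η > 0, ∀ᶠ n : ℕ in atTop, (α - η) * n ≤ hh lm d n := by
    intro η hη
    filter_upwards [hlim.eventually (lt_mem_nhds (show α - η < α by linarith)), eventually_gt_atTop 0] with n hn hn0
    have hk0 : (0:ℝ) < n := by exact_mod_cast hn0
    rw [lt_div_iff₀ hk0] at hn
    exact hn.le
  have hq2 : ∀ᶠ q : ℕ in atTop, (lm^2)^q ≤ ps / 8 :=
    (tendsto_pow_atTop_nhds_zero_of_lt_one (by positivity) (by nlinarith)).eventually_le_const (by positivity)
  have hlarge : ∀ x y : ℝ, 0 < y → ∀ᶠ q : ℕ in atTop, x ≤ q * y := by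
    intro x y hy
    filter_upwards [(tendsto_natCast_atTop_atTop (R := ℝ)).eventually_ge_atTop (x / y)] with q hq
    rwa [div_le_iff₀ hy] at hq
  obtain ⟨q, hq1, hq2, hq3, hq4⟩ := ((hev ε hε0).and (hq2.and ((hlarge (G + C - log (ps/2) / 2) (δ/2) (by linarith)).and
    (hlarge (K + log 5) (δ * ps / 16) (by positivity))))).exists
  have hpq := pow_pos h0 q
  set k := ⌈((lm^2)^q)⁻¹⌉₊ with hk
  have hkl : ((lm^2)^q)⁻¹ ≤ k := Nat.le_ceil _
  have hku : (k:ℝ) < ((lm^2)^q)⁻¹ + 1 := Nat.ceil_lt_add_one (by positivity)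
  have hlq : (lm^q)^2 = (lm^2)^q := by rw [← pow_mul, ← pow_mul, mul_comm]
  have hlq0 : (0:ℝ) < (lm^2)^q := by positivity
  have hlq1 : (lm^2)^q ≤ 1 := pow_le_one₀ (by positivity) (by nlinarith)
  have hk2 : k * (lm ^ q)^2 ≤ 2 := by
    rw [hlq]
    have : (k:ℝ) * (lm^2)^q ≤ (((lm^2)^q)⁻¹ + 1) * (lm^2)^q := by gcongr
    rw [add_mul, inv_mul_cancel₀ hlq0.ne'] at this
    linarith
  have hk8 : 8 ≤ k * ps := by
    have : ((lm^2)^q)⁻¹ * ps ≤ k * ps := by gcongr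
    refine le_trans ?_ this
    rw [inv_mul_eq_div, le_div_iff₀ hlq0]; linarith
  have hk0 : (0:ℝ) < k := lt_of_lt_of_le (by positivity) hkl
  set a := hh lm d q - log 5 with ha
  set b := log (k * ps / 2) / 2 - G with hb
  have hbl : q * L + log (ps/2) / 2 - G ≤ b := by
    have e : log (((lm^2)^q)⁻¹ * (ps/2)) = 2 * (q * L) + log (ps/2) := by
      rw [log_mul (by positivity) (by positivity), log_inv, log_pow, log_pow]
      push_cast; ring
    have := log_le_log (by positivity) (show ((lm^2)^q)⁻¹ * (ps/2) ≤ k * ps / 2 by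
      rw [mul_div_assoc]; gcongr)
    linarith
  have hau : a ≤ α * q + C - log 5 := by have := hub q; linarith
  have hba : δ * q / 2 ≤ b - a := by
    have : q * L = α * q + δ * q := by rw [hδ]; ring
    linarith
  have hab : a ≤ b := by
    have : 0 ≤ δ * q / 2 := by positivity
    linarith
  set θ := δ * ps / (32 * k) with hθ
  have hθ0 : 0 < θ := by positivity
  set G' := log (2 * (lm ^ (q+g))⁻¹ + 3) with hG'
  set C1 := g * (G + G') / G with hC1
  set Cc := (q+g) * (α * q) + (b-a)/2 * C1 + q * (C + k * log 13 + log (4*k+9) + log 5) with hCc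
  obtain ⟨n1, hn1⟩ := eventually_atTop.1 (hev θ hθ0)
  have hq0 : (0:ℝ) < q := by
    rcases Nat.eq_zero_or_pos q with h | h
    · exfalso
      rw [h] at hq4
      have : 0 < K := by positivity
      norm_num at hq4; linarith
    · exact_mod_cast h
  obtain ⟨n2, hn2⟩ := eventually_atTop.1 (hlarge (Cc + 1) (δ * q * ps / 16) (by positivity))
  obtain ⟨N, hN, n, A, hA, Z, hZ, hZ1, hZ2⟩ := hst θ hθ0 (n1 + n2 + q + g + 1)
  have : Nonempty {x // x ∈ A} := ⟨⟨_, hA.choose_spec⟩⟩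
  rw [← eH_sub] at hZ1
  rw [← eH_sub_prod] at hZ2
  set Y : {x // x ∈ A} → ℝ := fun x => Z x.1 with hY
  have hYb : ∀ x y, |Y x - Y y| ≤ 1 := fun x y => hZ _ x.2 _ y.2
  set R := N - q - g with hR
  have hRN : R + q + g = N := by omega
  choose τ hτ using fun i => exists_goodInv h0 Y (i+q) g
  have hms := mvp_sum h0 h1 Y hYb q g R N hRN τ hτ _ hZ1
  have hst2 := hoch_step2 h0 d Y N k
  set bT : ℕ → ℝ := fun j => eH Finset.univ (fun p : (Fin k → {x // x ∈ A}) × (Fin N → Ω) =>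
    fl lm j (∑ j, Y (p.1 j) + wS lm d N p.2)) with hbT
  have hsum1 : ∑ i ∈ Finset.range R, (a + (b - a) / 2 * (mvp (τ i) - ps) - K) ≤ ∑ i ∈ Finset.range R, (bT (i+q) - bT i) := by
    apply sum_le_sum
    intro i hi
    have hi := Finset.mem_range.1 hi
    exact scale_step h0 h1 d Y i q g k N (by omega) (τ i) (hτ i) ps hps0 hk8 hk2 a b ha hb hab
  rw [tele_q] at hsum1
  have hsum2 : ∑ j ∈ Finset.range q, (bT (R+j) - bT j) ≤ ∑ _j ∈ Finset.range q, (bT N + log 5) := by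
    apply sum_le_sum
    intro j hj
    have hj := Finset.mem_range.1 hj
    have a1 : bT (R+j) ≤ bT N + log 5 :=
      fl_coarse' h0 h1 Finset.univ_nonempty (fun p : (Fin k → {x // x ∈ A}) × (Fin N → Ω) => ∑ j, Y (p.1 j) + wS lm d N p.2) (by omega)
    have a2 : 0 ≤ bT j := eH_nonneg
    linarith
  rw [sum_const, card_range, nsmul_eq_mul] at hsum2
  have hsum3 := sum_lin R (fun i => mvp (τ i)) a ((b-a)/2) ps K
  rw [hsum3] at hsum1
  set P := ∑ i ∈ Finset.range R, mvp (τ i) with hP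
  have hRr : (R:ℝ) = N - q - g := by
    have : (N:ℝ) = R + q + g := by exact_mod_cast hRN.symm
    linarith
  have hgr : (0:ℝ) ≤ g := cast_nonneg g
  have hRle : (R:ℝ) ≤ N := by rw [hRr]; linarith
  have hP2 : 2 * ps * N - C1 ≤ P := by
    have e : (2 * ps * N - C1) * G = g * (β' * N - G - G') - N * l15 := by
      rw [hps, hC1]; field_simp; ring
    have : (R:ℝ) * l15 ≤ N * l15 := by gcongr
    have : (2 * ps * N - C1) * G ≤ P * G := by rw [e]; linarith
    exact le_of_mul_le_mul_right this hG0
  have hP3 : ps * N - C1 ≤ P - R * ps := by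
    have : R * ps ≤ N * ps := by gcongr
    linarith
  have hhN := hn1 N (by omega)
  have hhN2 := hub N
  have hT : bT N ≤ α * N + C + k * (2 * θ * N + log 13) + log (4*k+9) := by
    have h5 : (k:ℝ) * (eH Finset.univ (fun p : {x // x ∈ A} × (Fin N → Ω) => fl lm N (Y p.1 + wS lm d N p.2)) + log 13 - hh lm d N)
      ≤ k * (2 * θ * N + log 13) := by
      apply mul_le_mul_of_nonneg_left _ hk0.le
      have h6 : eH Finset.univ (fun p : {x // x ∈ A} × (Fin N → Ω) => fl lm N (Y p.1 + wS lm d N p.2)) ≤ (α + θ) * N := hZ2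
      linarith
    have hst3 : bT N ≤ _ := hst2
    linarith
  have hkθ : (k:ℝ) * θ = δ * ps / 32 := by rw [hθ]; field_simp
  have hN2 := hn2 N (by omega)
  have hau2 : (α - ε) * q - log 5 ≤ a := by rw [ha]; linarith
  exact hoch_arith (R := R) (N := N) (q := q) (g := g) (k := k) (L13 := log 13) (L4 := log (4*k+9)) (a := a) (b := b) (C1 := C1) (P := P) (θ := θ) (Δ := (b-a)/2)
    hRr hgr (cast_nonneg R) (cast_nonneg N) hq0 hps0 hδ0 (by positivity) hl5 hP3
    (by linarith) hau2 hT hkθ hN2 hq4 (hsum1.trans hsum2)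
include h0 h1 in
theorem hoch_main {c : ℝ} (hc : 0 < c)
    (hsep : ∃ᶠ n in atTop, ∀ u v : Fin n → Ω, u ≠ v → c ^ n ≤ |wS lm d n u - wS lm d n v|)
    (ε : ℝ) (hε : 0 < ε) :
    ∀ᶠ n : ℕ in atTop, (min (-log lm) (log (card Ω)) - ε) * n ≤ hh lm d n := by
  obtain ⟨α, C, hC, hα, hub, hlim⟩ := hh_limit h0 h1 d
  have hle : min (-log lm) (log (card Ω)) ≤ α := by
    by_contra hcon
    push Not at hcon
    exact hoch_core h0 h1 d hα hC hub hlim hc hsep (lt_of_lt_of_le hcon (min_le_right _ _)) (lt_of_lt_of_le hcon (min_le_left _ _))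
  filter_upwards [hlim.eventually (lt_mem_nhds (show α - ε < α by linarith)), eventually_gt_atTop 0] with n hn hn0
  have hk0 : (0:ℝ) < n := by exact_mod_cast hn0
  rw [lt_div_iff₀ hk0] at hn
  nlinarith
end secHoch6
section cantor
variable {b : ℕ} {μ D s : ℝ} (a : Fin b → ℝ)
lemma cant_summ (h0 : 0 < μ) (h1 : μ < 1) (hD : ∀ i, |a i| ≤ D) (ω : ℕ → Fin b) :
    Summable (fun j => μ ^ j * a (ω j)) := by
  refine Summable.of_norm_bounded (g := fun j => μ ^ j * D)
    ((summable_geometric_of_lt_one h0.le h1).mul_right D) (fun j => ?_)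
  rw [norm_eq_abs, abs_mul, abs_of_pos (pow_pos h0 j)]
  exact mul_le_mul_of_nonneg_left (hD _) (pow_pos h0 j).le
lemma cant_sep (h0 : 0 < μ) (h1 : μ < 1) (hD : ∀ i, |a i| ≤ D)
    (hsep : ∀ i j, i ≠ j → (2 * D / (1 - μ) + 1) * μ ≤ |a i - a j|) (ω ω' : ℕ → Fin b) (k : ℕ)
    (hk : ∀ i < k, ω i = ω' i) (hne : ω k ≠ ω' k) :
    μ ^ (k + 1) ≤ |(∑' j, μ ^ j * a (ω j)) - ∑' j, μ ^ j * a (ω' j)| := by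
  have s1 := cant_summ a h0 h1 hD ω
  have s2 := cant_summ a h0 h1 hD ω'
  have s3 := s1.sub s2
  have s4 := (summable_nat_add_iff (k+1)).2 s3
  rw [← s1.tsum_sub s2, ← Summable.sum_add_tsum_nat_add (k + 1) s3, sum_range_succ]
  have z : ∑ i ∈ Finset.range k, (μ ^ i * a (ω i) - μ ^ i * a (ω' i)) = 0 :=
    Finset.sum_eq_zero (fun i hi => by rw [hk i (Finset.mem_range.1 hi)]; ring)
  rw [z, zero_add]
  have g : HasSum (fun i => μ ^ (k + 1) * (2 * D) * μ ^ i) (μ ^ (k + 1) * (2 * D) * (1 - μ)⁻¹) :=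
    (hasSum_geometric_of_lt_one h0.le h1).mul_left _
  have tl : |∑' i, (μ ^ (i + (k+1)) * a (ω (i + (k+1))) - μ ^ (i + (k+1)) * a (ω' (i + (k+1))))|
      ≤ μ ^ (k + 1) * (2 * D) * (1 - μ)⁻¹ := by
    rw [← norm_eq_abs]
    refine tsum_of_norm_bounded g (fun i => ?_)
    rw [norm_eq_abs, ← mul_sub, abs_mul, abs_of_pos (pow_pos h0 _), pow_add]
    have := abs_sub (a (ω (i + (k+1)))) (a (ω' (i + (k+1))))
    have h2 := hD (ω (i + (k+1))); have h3 := hD (ω' (i + (k+1)))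
    have := mul_le_mul_of_nonneg_left (show |a (ω (i + (k+1))) - a (ω' (i + (k+1)))| ≤ 2 * D by linarith)
      (mul_pos (pow_pos h0 i) (pow_pos h0 (k+1))).le
    linarith
  have hd : μ ^ k * ((2 * D / (1 - μ) + 1) * μ) ≤ |μ ^ k * a (ω k) - μ ^ k * a (ω' k)| := by
    rw [← mul_sub, abs_mul, abs_of_pos (pow_pos h0 k)]
    exact mul_le_mul_of_nonneg_left (hsep _ _ hne) (pow_pos h0 k).le
  set X := μ ^ k * a (ω k) - μ ^ k * a (ω' k)
  set Y := ∑' i, (μ ^ (i + (k+1)) * a (ω (i + (k+1))) - μ ^ (i + (k+1)) * a (ω' (i + (k+1))))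
  have tri : |X| - |Y| ≤ |X + Y| := by
    have := abs_sub_abs_le_abs_sub X (-Y); simpa using this
  have e : μ ^ k * ((2 * D / (1 - μ) + 1) * μ) = μ ^ (k + 1) * (2 * D) * (1 - μ)⁻¹ + μ ^ (k+1) := by
    rw [pow_succ]; ring
  linarith
lemma cant_dim (h0 : 0 < μ) (h1 : μ < 1) (hs : 0 < s) (hb : 2 ≤ b) (hD : ∀ i, |a i| ≤ D)
    (hsep : ∀ i j, i ≠ j → (2 * D / (1 - μ) + 1) * μ ≤ |a i - a j|) (hbs : 1 ≤ μ ^ s * b) :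
    ofReal s ≤ dimH (range (fun ω : ℕ → Fin b => ∑' j, μ ^ j * a (ω j))) := by
  set P := fun ω : ℕ → Fin b => ∑' j, μ ^ j * a (ω j) with hP
  have b0 : (0:ℝ) < b := by positivity
  have key : ∀ ω ω', ω ≠ ω' → ∃ k, |ofDigits ω - ofDigits ω'| ≤ ((b:ℝ) ^ k)⁻¹ ∧
      μ ^ (k + 1) ≤ |P ω - P ω'| := by
    classical
    intro ω ω' h
    have hex : ∃ k, ω k ≠ ω' k := by by_contra hc; push Not at hc; exact h (funext hc)
    refine ⟨Nat.find hex, Real.abs_ofDigits_sub_ofDigits_le fun i hi => ?_,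
      cant_sep a h0 h1 hD hsep ω ω' _ (fun i hi => ?_) (Nat.find_spec hex)⟩
    · have := Nat.find_min hex hi; tauto
    · have := Nat.find_min hex hi; tauto
  have inj : Function.Injective P := by
    intro ω ω' h
    by_contra hc
    obtain ⟨k, -, h2⟩ := key ω ω' hc
    rw [h, sub_self, abs_zero] at h2
    exact absurd h2 (not_le.2 (pow_pos h0 _))
  have : Nonempty (ℕ → Fin b) := ⟨fun _ => ⟨0, by omega⟩⟩
  set φ : ℝ → ℝ := fun x => ofDigits (Function.invFun P x) with hφ
  have hφP : ∀ ω, φ (P ω) = ofDigits ω := fun ω => by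
    simp only [hφ]; rw [Function.leftInverse_invFun inj ω]
  have hol : HolderOnWith (b : NNReal) (Real.toNNReal s) φ (range P) := by
    rintro _ ⟨ω, rfl⟩ _ ⟨ω', rfl⟩
    rw [hφP, hφP]
    by_cases h : ω = ω'
    · subst h; simp
    obtain ⟨k, e1, e2⟩ := key ω ω' h
    rw [edist_dist, edist_dist, dist_eq, dist_eq, Real.coe_toNNReal _ hs.le,
      ENNReal.ofReal_rpow_of_pos (lt_of_lt_of_le (pow_pos h0 _) e2)]
    have : ((b : NNReal) : ENNReal) = ofReal b := by simp
    rw [this, ← ENNReal.ofReal_mul b0.le]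
    refine ofReal_le_ofReal (e1.trans ?_)
    have e3 : (μ ^ (k+1)) ^ s ≤ |P ω - P ω'| ^ s := rpow_le_rpow (pow_pos h0 _).le e2 hs.le
    have e4 : (μ ^ (k+1)) ^ s = (μ ^ s) ^ (k+1) := by
      rw [← rpow_natCast, ← rpow_natCast, ← rpow_mul h0.le, ← rpow_mul h0.le, mul_comm]
    have e5 : 1 ≤ (μ ^ s * b) ^ (k+1) := one_le_pow₀ hbs
    rw [mul_pow] at e5
    have bk : (0:ℝ) < (b:ℝ)^k := by positivity
    rw [e4] at e3
    rw [inv_le_iff_one_le_mul₀ bk]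
    calc (1:ℝ) ≤ (μ ^ s) ^ (k+1) * (b:ℝ)^(k+1) := e5
      _ = b * (μ ^ s) ^ (k+1) * b^k := by ring
      _ ≤ b * |P ω - P ω'| ^ s * b ^ k := by gcongr
  have h2 := hol.dimH_image_le (Real.toNNReal_pos.2 hs)
  have h3 : (1 : ENNReal) ≤ dimH (φ '' range P) := by
    have : Icc (0:ℝ) 1 ⊆ φ '' range P := by
      intro y hy
      obtain ⟨ω, -, hω⟩ := Real.ofDigits_SurjOn (b := b) (by omega) hy
      exact ⟨P ω, ⟨ω, rfl⟩, by rw [hφP, hω]⟩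
    refine le_trans ?_ (dimH_mono this)
    rw [Real.dimH_of_nonempty_interior (by rw [interior_Icc]; exact nonempty_Ioo.2 zero_lt_one)]
    simp
  have h4 := h3.trans h2
  rw [ENNReal.le_div_iff_mul_le (by left; simpa using hs) (by left; simp)] at h4
  simpa [ofReal] using h4
end cantor
section dimlower
variable {Ω : Type*} [Fintype Ω] [Nonempty Ω] {lm : ℝ}
lemma sep_words (h0 : 0 < lm) (h1 : lm < 1) (d : Ω → ℝ) {c : ℝ} (hc : 0 < c)
    (hsep : ∃ᶠ n in atTop, ∀ u v : Fin n → Ω, u ≠ v → c ^ n ≤ |wS lm d n u - wS lm d n v|)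
    {t s : ℝ} (ht1 : t ≤ 1) (htΩ : t * (-log lm) ≤ log (card Ω)) (hs : 0 < s)
    (hst : s < t) (B : ℕ) :
    ∃ n : ℕ, 1 ≤ n ∧ ∃ T : Finset (Fin n → Ω), 2 ≤ T.card ∧ 1 ≤ (lm ^ n) ^ s * T.card ∧
      ∀ u ∈ T, ∀ v ∈ T, u ≠ v → B * lm ^ n ≤ |wS lm d n u - wS lm d n v| := by
  classical
  have hL : 0 < -log lm := by have := log_neg h0 h1; linarith
  set L := -log lm
  set ε := (t - s) * L / 2 with hε
  have hε0 : 0 < ε := by have := sub_pos.2 hst; positivity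
  have E1 := hoch_main h0 h1 d hc hsep ε hε0
  have E2 : ∀ᶠ n : ℕ in atTop, log (B + 1) ≤ ε * n :=
    (tendsto_natCast_atTop_atTop.const_mul_atTop hε0).eventually_ge_atTop _
  have E3 : ∀ᶠ n : ℕ in atTop, log 2 ≤ s * L * n :=
    (tendsto_natCast_atTop_atTop.const_mul_atTop (mul_pos hs hL)).eventually_ge_atTop _
  obtain ⟨n, e1, e2, e3, hn⟩ := (E1.and (E2.and (E3.and (eventually_ge_atTop 1)))).exists
  refine ⟨n, hn, ?_⟩
  set φ := fun w : Fin n → Ω => fl lm n (wS lm d n w) with hφ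
  set 𝒞 := Finset.univ.image φ
  have c1 : hh lm d n ≤ log 𝒞.card := by
    have := eH_cond_card (A := (Finset.univ : Finset (Fin n → Ω))) Finset.univ_nonempty φ (fun _ => ())
      (fun _ => (𝒞.card : ℝ)) (fun w _ => by
        refine Nat.cast_le.2 (Finset.card_le_card ?_)
        intro z hz
        obtain ⟨a, -, rfl⟩ := (@Finset.mem_image _ _ (fun a b => Classical.propDecidable (a = b)) _ _ _).1 hz
        exact Finset.mem_image_of_mem _ (Finset.mem_univ a))
    rw [avg_const Finset.univ_nonempty] at this
    have z : eH (Finset.univ : Finset (Fin n → Ω)) (fun _ => ()) = 0 := by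
      unfold eH eN; simp [card_univ]
    have m : hh lm d n ≤ eH Finset.univ (fun w => (φ w, ())) := eH_mono (fun a _ b _ h => by
      simpa using h)
    rw [z] at this
    linarith
  have c2 : log (B + 1) + s * L * n ≤ log 𝒞.card := by
    have : t * L ≤ min L (log (card Ω)) := le_min (by nlinarith) htΩ
    have n0 : (0:ℝ) ≤ n := cast_nonneg n
    have := mul_le_mul_of_nonneg_right (sub_le_sub_right this ε) n0
    have : (t * L - ε) * n = ε * n + s * L * n := by rw [hε]; ring
    linarith
  have C0 : (0:ℝ) < 𝒞.card := cast_pos.2 (Finset.card_pos.2 (Finset.univ_nonempty.image φ))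
  have c3 : (B + 1) * exp (s * L * n) ≤ 𝒞.card := by
    rw [← Real.log_le_log_iff (by positivity) C0, log_mul (by positivity) (by positivity), Real.log_exp]
    exact c2
  have c4 : ∃ r ∈ Finset.range (B + 1), exp (s * L * n) ≤
      ((𝒞.filter (fun z => (z % (B + 1 : ℤ)).toNat = r)).card : ℝ) := by
    by_contra hcon
    push Not at hcon
    have := Finset.card_eq_sum_card_fiberwise (s := 𝒞) (t := Finset.range (B + 1))
      (f := fun z => (z % (B + 1 : ℤ)).toNat) (fun z _ => by
        have := Int.emod_lt_of_pos z (show (0:ℤ) < B + 1 by positivity)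
        have := emod_nonneg z (show (B + 1 : ℤ) ≠ 0 by positivity)
        simp; omega)
    have h2 : (𝒞.card : ℝ) < ∑ r ∈ Finset.range (B + 1), exp (s * L * n) := by
      rw [this]; push_cast
      exact Finset.sum_lt_sum_of_nonempty ⟨0, by simp⟩ hcon
    simp at h2
    linarith
  obtain ⟨r, -, hr⟩ := c4
  set 𝒞' := 𝒞.filter (fun z => (z % (B + 1 : ℤ)).toNat = r)
  have hsec : ∀ z ∈ 𝒞', ∃ w, φ w = z := fun z hz => by
    have := (mem_filter.1 hz).1
    obtain ⟨w, -, h⟩ := Finset.mem_image.1 this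
    exact ⟨w, h⟩
  choose! g hg using hsec
  have hcard : (𝒞'.image g).card = 𝒞'.card := Finset.card_image_of_injOn (fun x hx y hy h => by
    rw [← hg x hx, ← hg y hy, h])
  refine ⟨𝒞'.image g, ?_, ?_, ?_⟩
  · rw [hcard]
    have : (2:ℝ) ≤ 𝒞'.card := le_trans (by
      rw [← Real.log_le_iff_le_exp (by norm_num)]; exact e3) hr
    exact_mod_cast this
  · rw [hcard]
    have : (lm ^ n) ^ s = exp (-(s * L * n)) := by
      rw [Real.rpow_def_of_pos (pow_pos h0 n), log_pow]; congr 1; simp only [L]; ring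
    rw [this]
    calc (1:ℝ) = exp (-(s * L * n)) * exp (s * L * n) := by rw [← exp_add]; simp
      _ ≤ _ := by gcongr
  · intro u hu v hv huv
    obtain ⟨x, hx, rfl⟩ := Finset.mem_image.1 hu
    obtain ⟨y, hy, rfl⟩ := Finset.mem_image.1 hv
    have hxy : x ≠ y := fun h => huv (by rw [h])
    have rx := (mem_filter.1 hx).2
    have ry := (mem_filter.1 hy).2
    have hd : ((B:ℤ) + 1) ≤ |x - y| := by
      have : ((B:ℤ) + 1) ∣ x - y := by
        apply Int.dvd_of_emod_eq_zero
        apply Int.emod_eq_emod_iff_emod_sub_eq_zero.1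
        have := emod_nonneg x (show (B + 1 : ℤ) ≠ 0 by positivity)
        have := emod_nonneg y (show (B + 1 : ℤ) ≠ 0 by positivity)
        omega
      exact Int.le_of_dvd (abs_pos.2 (sub_ne_zero.2 hxy)) ((dvd_abs _ _).2 this)
    have p := pow_pos h0 n
    have f1 := hg x hx; have f2 := hg y hy
    simp only [hφ, fl] at f1 f2
    generalize wS lm d n (g x) = X at *
    generalize wS lm d n (g y) = Y at *
    have a1 := floor_le (X / lm ^ n); have a2 := lt_floor_add_one (X / lm ^ n)
    have a3 := floor_le (Y / lm ^ n); have a4 := lt_floor_add_one (Y / lm ^ n)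
    rw [f1] at a1 a2; rw [f2] at a3 a4
    have hd' : ((B:ℝ) + 1) ≤ |(x:ℝ) - y| := by exact_mod_cast hd
    have : (B:ℝ) ≤ |X / lm ^ n - Y / lm ^ n| := by
      rcases le_abs.1 hd' with h | h
      · exact le_trans (by linarith) (le_abs_self _)
      · exact le_trans (by linarith) (neg_le_abs _)
    rw [← sub_div, abs_div, abs_of_pos p, le_div_iff₀ p] at this
    exact this
lemma wS_blocks (d : Ω → ℝ) (n : ℕ) (e : ℕ → Fin n → Ω) (k : ℕ) :
    ∃ w : Fin (n * k) → Ω, wS lm d (n * k) w = ∑ j ∈ Finset.range k, (lm ^ n) ^ j * wS lm d n (e j) := by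
  induction k with
  | zero => exact ⟨fun i => absurd i.2 (by simp), by simp [wS]⟩
  | succ k ih =>
    obtain ⟨w, hw⟩ := ih
    refine ⟨(Fin.append w (e k) : Fin (n * k + n) → Ω), ?_⟩
    have := wS_append (lm := lm) (d := d) (n * k) n w (e k)
    rw [sum_range_succ, ← hw, ← pow_mul]
    exact this
theorem dim_lower (h0 : 0 < lm) (h1 : lm < 1) (d : Ω → ℝ) {c : ℝ} (hc : 0 < c)
    (hsep : ∃ᶠ n in atTop, ∀ u v : Fin n → Ω, u ≠ v → c ^ n ≤ |wS lm d n u - wS lm d n v|)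
    {t : ℝ} (ht1 : t ≤ 1) (htΩ : t * (-log lm) ≤ log (card Ω))
    (Λ : Set ℝ) (hcl : IsClosed Λ) (C : ℝ)
    (hΛ : ∀ n (w : Fin n → Ω), ∃ x ∈ Λ, |x - wS lm d n w| ≤ C * lm ^ n) :
    ofReal t ≤ dimH Λ := by
  by_contra hcon
  push Not at hcon
  obtain ⟨s, hs1, hs2⟩ := ENNReal.lt_iff_exists_nnreal_btwn.1 hcon
  have hs0 : 0 < (s:ℝ) := by
    have : 0 < (s : ENNReal) := lt_of_le_of_lt bot_le hs1
    exact_mod_cast this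
  have hst : (s:ℝ) < t := by
    by_contra h
    push Not at h
    have := ofReal_le_ofReal h
    rw [ofReal_coe_nnreal] at this
    exact absurd hs2 (not_lt.2 this)
  set D := wD lm d
  have D0 : 0 ≤ D := wD_nonneg h1 d
  obtain ⟨B, hB⟩ := exists_nat_ge (2 * D / (1 - lm) + 1)
  obtain ⟨n, hn, T, hT2, hTs, hT⟩ := sep_words h0 h1 d hc hsep ht1 htΩ hs0 hst B
  set μ := lm ^ n
  have μ0 : 0 < μ := pow_pos h0 n
  have μ1 : μ ≤ lm := by
    calc lm ^ n ≤ lm ^ 1 := pow_le_pow_of_le_one h0.le h1.le hn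
      _ = lm := pow_one _
  set e := T.equivFin.symm
  set a : Fin T.card → ℝ := fun i => wS lm d n (e i).1 with ha
  have hD : ∀ i, |a i| ≤ D := fun i => wS_le h0 h1 d n _
  have key := cant_dim a μ0 (lt_of_le_of_lt μ1 h1) hs0 hT2 hD (fun i j hij => by
    refine le_trans ?_ (hT _ (e i).2 _ (e j).2 (fun h => hij (e.injective (Subtype.ext h))))
    refine mul_le_mul_of_nonneg_right (le_trans ?_ hB) μ0.le
    have : 0 < 1 - lm := by linarith
    gcongr) hTs
  rw [ofReal_coe_nnreal] at key
  have sub : range (fun ω : ℕ → Fin T.card => ∑' j, μ ^ j * a (ω j)) ⊆ Λ := by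
    rintro _ ⟨ω, rfl⟩
    have hs := (cant_summ a μ0 (lt_of_le_of_lt μ1 h1) hD ω).hasSum.tendsto_sum_nat
    choose w hw using fun k => wS_blocks (lm := lm) d n (fun j => (e (ω j)).1) k
    choose x hx1 hx2 using fun k => hΛ (n * k) (w k)
    have z : Tendsto (fun k => C * μ ^ k) atTop (nhds 0) := by
      have := (tendsto_pow_atTop_nhds_zero_of_lt_one μ0.le (lt_of_le_of_lt μ1 h1)).const_mul C
      simpa using this
    have lim : Tendsto x atTop (nhds (∑' j, μ ^ j * a (ω j))) := by
      have : Tendsto (fun k => x k - wS lm d (n * k) (w k)) atTop (nhds 0) :=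
        squeeze_zero_norm (fun k => by
          rw [norm_eq_abs]; refine (hx2 k).trans (le_of_eq ?_); rw [pow_mul]) z
      have h2 := this.add hs
      rw [zero_add] at h2
      refine h2.congr (fun k => ?_)
      rw [hw k]; simp only [ha]; exact sub_add_cancel _ _
    exact hcl.mem_of_tendsto lim (Eventually.of_forall hx1)
  exact absurd (key.trans (dimH_mono sub)) (not_le.2 hs1)
end dimlower
section homog
lemma cF_append {ι : Type*} (S : ι → ℝ → ℝ) (u v : List ι) (x : ℝ) :
    compFam S (u ++ v) x = compFam S u (compFam S v x) := by
  induction u with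
  | nil => rfl
  | cons k u ih => simp only [compFam, cons_append, List.foldr_cons, Function.comp] at ih ⊢; rw [ih]
lemma cF_cons {ι : Type*} (S : ι → ℝ → ℝ) (k : ι) (v : List ι) (x : ℝ) :
    compFam S (k :: v) x = S k (compFam S v x) := rfl
variable {ι : Type*} (r t : ι → ℝ)
abbrev gS : ι → ℝ → ℝ := fun p x => r p * x + t p
lemma cF_aff (w : List ι) (x : ℝ) :
    compFam (gS r t) w x = (w.map r).prod * x + compFam (gS r t) w 0 := by
  induction w generalizing x with
  | nil => simp [compFam]
  | cons k w ih => rw [cF_cons, cF_cons, ih, map_cons, prod_cons]; simp only [gS]; ring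
lemma ofFn_of_len (l : List ι) {n : ℕ} (h : l.length = n) : ∃ i : Fin n → ι, ofFn i = l := by
  subst h; exact ⟨l.get, List.ofFn_get l⟩
lemma esc_list (h : ESCfam r t) : ∃ c : ℝ, 0 < c ∧ c ≤ 1 ∧ ∀ N : ℕ, ∃ n, N ≤ n ∧
    ∀ u v : List ι, u.length = n → v.length = n → u ≠ v → (u.map r).prod = (v.map r).prod →
      c ^ n ≤ |compFam (gS r t) u 0 - compFam (gS r t) v 0| := by
  obtain ⟨c, hc, nl, hm, H⟩ := h
  refine ⟨min c 1, lt_min hc one_pos, min_le_right _ _, fun N => ⟨nl N, hm.le_apply, ?_⟩⟩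
  intro u v hu hv huv hp
  obtain ⟨i, rfl⟩ := ofFn_of_len u hu
  obtain ⟨j, rfl⟩ := ofFn_of_len v hv
  have := H N i j (fun h => huv (by rw [h]))
  rw [map_ofFn, map_ofFn, prod_ofFn, prod_ofFn] at hp
  rcases this with h | h
  · exact absurd hp h
  · exact le_trans (pow_le_pow_left₀ (lt_min hc one_pos).le (min_le_left _ _) _) h
/-- no exact overlaps -/
lemma esc_inj (h : ESCfam r t) (u v : List ι) (hl : u.length = v.length)
    (hp : (u.map r).prod = (v.map r).prod) (h0 : compFam (gS r t) u 0 = compFam (gS r t) v 0) : u = v := by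
  obtain ⟨c, hc, -, H⟩ := esc_list r t h
  by_contra hne
  obtain ⟨n, hn, H⟩ := H u.length
  have hp0 : ∃ p : ι, True := by
    rcases u with _ | ⟨p, u⟩
    · simp at hl; exact absurd (List.length_eq_zero_iff.1 hl.symm).symm hne
    · exact ⟨p, trivial⟩
  obtain ⟨p, -⟩ := hp0
  set w := replicate (n - u.length) p
  have := H (u ++ w) (v ++ w) (by simp [w]; omega) (by simp [w]; omega)
    (fun h => hne (List.append_cancel_right h)) (by simp only [map_append, prod_append]; rw [hp])
  rw [cF_append, cF_append, cF_aff r t u, cF_aff r t v, hp, h0, sub_self, abs_zero] at this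
  exact absurd this (not_le.2 (pow_pos hc n))
lemma flatMap_inj {Ω : Type*} (w : Ω → List ι) (hw : Function.Injective w) {ℓ : ℕ}
    (hl : ∀ ω, (w ω).length = ℓ) : ∀ u v : List Ω, u.length = v.length →
      u.flatMap w = v.flatMap w → u = v := by
  intro u
  induction u with
  | nil => intro v h _; exact (List.length_eq_zero_iff.1 h.symm).symm
  | cons a u ih =>
    intro v h h2
    rcases v with _ | ⟨b, v⟩
    · simp at h
    · rw [flatMap_cons, flatMap_cons] at h2
      obtain ⟨e1, e2⟩ := append_inj h2 (by rw [hl, hl])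
      rw [hw e1, ih v (by simpa using h) e2]
lemma flatMap_len {Ω : Type*} (w : Ω → List ι) {ℓ : ℕ}
    (hl : ∀ ω, (w ω).length = ℓ) (u : List Ω) : (u.flatMap w).length = u.length * ℓ := by
  induction u with
  | nil => simp
  | cons a u ih => rw [flatMap_cons, length_append, ih, hl, length_cons]; ring
lemma flat_wS {Ω : Type*} (w : Ω → List ι) {lm : ℝ} (hs : ∀ ω, ((w ω).map r).prod = lm) (k : ℕ)
    (u : Fin k → Ω) (x : ℝ) : compFam (gS r t) ((ofFn u).flatMap w) x =
      lm ^ k * x + wS lm (fun ω => compFam (gS r t) (w ω) 0) k u := by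
  induction k with
  | zero => simp [compFam, wS]
  | succ k ih =>
    rw [ofFn_succ, flatMap_cons, cF_append, ih, cF_aff, hs]
    unfold wS
    rw [Fin.sum_univ_succ]
    have : ∀ i : Fin k, lm ^ ((Fin.succ i : Fin (k+1)) : ℕ) * compFam (gS r t) (w (u i.succ)) 0
      = lm * (lm ^ (i:ℕ) * compFam (gS r t) (w (u i.succ)) 0) := fun i => by
        rw [Fin.val_succ, pow_succ]; ring
    rw [sum_congr rfl (fun i _ => this i), ← mul_sum]
    simp only [Fin.val_zero, pow_zero, one_mul, pow_succ]; ring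
lemma hom_sep (h : ESCfam r t) {Ω : Type*} (w : Ω → List ι) (hw : Function.Injective w) {ℓ : ℕ}
    (hℓ : 1 ≤ ℓ) (hl : ∀ ω, (w ω).length = ℓ) {lm : ℝ} (hs : ∀ ω, ((w ω).map r).prod = lm) :
    ∃ c : ℝ, 0 < c ∧ ∃ᶠ n in atTop, ∀ u v : Fin n → Ω, u ≠ v → c ^ n ≤
      |wS lm (fun ω => compFam (gS r t) (w ω) 0) n u - wS lm (fun ω => compFam (gS r t) (w ω) 0) n v| := by
  obtain ⟨c, hc, hc1, H⟩ := esc_list r t h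
  refine ⟨c ^ (2 * ℓ), pow_pos hc _, frequently_atTop.2 fun K => ?_⟩
  obtain ⟨n, hn, H⟩ := H (ℓ * (K + 1))
  have hk : K + 1 ≤ n / ℓ := (Nat.le_div_iff_mul_le (by omega)).2 (by rw [mul_comm]; exact hn)
  obtain ⟨k, hkd⟩ : ∃ k, k = n / ℓ := ⟨_, rfl⟩
  rw [← hkd] at hk
  refine ⟨k, by omega, fun u v huv => ?_⟩
  have hkn : k * ℓ ≤ n := hkd ▸ Nat.div_mul_le_self n ℓ
  have hkn2 : n ≤ 2 * ℓ * k := by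
    have := Nat.lt_div_mul_add (a := n) (b := ℓ) (by omega)
    rw [← hkd] at this
    nlinarith
  have hp0 : ∃ p : ι, True := by
    have h1 := hl (u ⟨0, by omega⟩)
    rcases hq : w (u ⟨0, by omega⟩) with _ | ⟨p, _⟩
    · rw [hq] at h1; simp at h1; omega
    · exact ⟨p, trivial⟩
  obtain ⟨p, -⟩ := hp0
  set z := replicate (n - k * ℓ) p
  have hsl : ∀ u : Fin k → Ω, (((ofFn u).flatMap w).map r).prod = lm ^ k := fun u => by
    have h1 := flat_wS r t w hs k u 1
    have h0 := flat_wS r t w hs k u 0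
    rw [cF_aff] at h1; rw [h0] at h1; linarith
  have := H ((ofFn u).flatMap w ++ z) ((ofFn v).flatMap w ++ z)
    (by rw [length_append, flatMap_len w hl]; simp [z]; omega)
    (by rw [length_append, flatMap_len w hl]; simp [z]; omega)
    (fun h => huv (ofFn_injective (flatMap_inj w hw hl (ofFn u) (ofFn v) (by simp) (List.append_cancel_right h))))
    (by simp only [map_append, prod_append, hsl])
  rw [cF_append, cF_append, flat_wS r t w hs, flat_wS r t w hs, add_sub_add_left_eq_sub] at this
  refine le_trans ?_ this
  rw [← pow_mul]
  exact pow_le_pow_of_le_one hc.le hc1 hkn2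
theorem hom_dim (h : ESCfam r t) (W : Finset (List ι)) {n0 : ℕ} (hn0 : 1 ≤ n0)
    (hlen : ∀ q ∈ W, q.length = n0) (hr0 : ∀ p, r p ≠ 0) (hr1 : ∀ p, |r p| < 1) {τ : ℝ}
    (ht1 : τ ≤ 1) (hsum : 1 < ∑ q ∈ W, |(q.map r).prod| ^ τ)
    (Λ : Set ℝ) (hcl : IsClosed Λ) (x0 : ℝ)
    (hΛ : ∀ qs : List W, compFam (gS r t) (qs.flatMap Subtype.val) x0 ∈ Λ) :
    ofReal τ ≤ dimH Λ := by
  classical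
  set Θ := ∑ q ∈ W, |(q.map r).prod| ^ τ
  have e1 : ∃ L : ℕ, 1 ≤ L ∧ ((L:ℝ) + 1) ^ W.card < Θ ^ L := by
    have h1 := tendsto_pow_const_div_const_pow_of_one_lt W.card hsum
    have h2 := (h1.comp (tendsto_add_atTop_nat 1)).eventually_lt_const (show (0:ℝ) < 1 / Θ by positivity)
    obtain ⟨L, hL, h3⟩ := ((eventually_ge_atTop 1).and h2).exists
    refine ⟨L, hL, ?_⟩
    simp only [Function.comp] at h3
    rw [div_lt_div_iff₀ (by positivity) (by positivity), pow_succ, ← mul_assoc] at h3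
    push_cast at h3
    have := lt_of_mul_lt_mul_right h3 (by positivity)
    linarith
  obtain ⟨L, hL, hLΘ⟩ := e1
  set sl : W → ℝ := fun q => (q.1.map r).prod
  set cv : (Fin L → W) → (W → Fin (L+1)) := fun u q =>
    ⟨(Finset.univ.filter (fun i => u i = q)).card, by
      have := card_le_univ (Finset.univ.filter (fun i => u i = q)); simp at this; omega⟩
  have hcv : ∀ u, ∏ i, sl (u i) = ∏ q, sl q ^ (cv u q : ℕ) := fun u => by
    rw [Finset.prod_comp sl u]
    refine Finset.prod_subset (Finset.subset_univ _) (fun q _ hq => ?_)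
    have : (Finset.univ.filter (fun i => u i = q)).card = 0 := by
      rw [Finset.card_eq_zero, Finset.filter_eq_empty_iff]
      intro i _ h; exact hq (by rw [← h]; exact Finset.mem_image_of_mem _ (Finset.mem_univ i))
    rw [this, pow_zero]
  have tot : ∑ u : Fin L → W, |∏ i, sl (u i)| ^ τ = Θ ^ L := by
    have : Θ = ∑ q : W, |sl q| ^ τ := (Finset.sum_coe_sort W (fun q => |(q.map r).prod| ^ τ)).symm
    rw [this, Fintype.sum_pow]
    refine sum_congr rfl (fun u _ => ?_)
    rw [Finset.abs_prod, ← Real.finsetProd_rpow _ _ (fun _ _ => abs_nonneg _)]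
  have pig : ∃ c0, 1 < ∑ u with cv u = c0, |∏ i, sl (u i)| ^ τ := by
    by_contra hcon
    push Not at hcon
    rw [← Finset.sum_fiberwise Finset.univ cv] at tot
    have := sum_le_sum (s := Finset.univ) (fun c0 _ => hcon c0)
    rw [tot] at this
    simp at this
    linarith
  obtain ⟨c0, hc0⟩ := pig
  set σ := ∏ q, sl q ^ (c0 q : ℕ)
  set T := Finset.univ.filter (fun u => cv u = c0)
  have hT : ∀ u ∈ T, ∏ i, sl (u i) = σ := fun u hu => by
    rw [hcv]; simp only [T, mem_filter, Finset.mem_univ, true_and] at hu; rw [hu]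
  rw [sum_congr rfl (fun u hu => by rw [hT u hu])] at hc0
  rw [sum_const, nsmul_eq_mul] at hc0
  have Tne : T.Nonempty := by
    rw [Finset.nonempty_iff_ne_empty]; intro h; rw [h] at hc0; simp at hc0; linarith
  have pr : ∀ q : List ι, (q.map r).prod ≠ 0 ∧ |(q.map r).prod| ≤ 1 ∧ (1 ≤ q.length → |(q.map r).prod| < 1) := by
    intro q
    induction q with
    | nil => simp
    | cons a q ih =>
      rw [map_cons, prod_cons, abs_mul]
      have a1 := hr1 a
      have : |r a| * |(q.map r).prod| < 1 := by
        calc _ ≤ |r a| * 1 := mul_le_mul_of_nonneg_left ih.2.1 (abs_nonneg _)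
          _ < 1 := by linarith
      exact ⟨mul_ne_zero (hr0 a) ih.1, this.le, fun _ => this⟩
  set w1 : (Fin L → W) → List ι := fun u => (ofFn u).flatMap Subtype.val
  have w1s : ∀ u, ((w1 u).map r).prod = ∏ i, sl (u i) := fun u => by
    have : ∀ l : List W, ((l.flatMap Subtype.val).map r).prod = (l.map sl).prod := by
      intro l
      induction l with
      | nil => simp
      | cons a l ih => rw [flatMap_cons, map_append, prod_append, ih, map_cons, prod_cons]
    rw [this, map_ofFn, prod_ofFn]; rfl
  have w1l : ∀ u, (w1 u).length = L * n0 := fun u => by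
    simp only [w1]; rw [flatMap_len _ (fun q : W => hlen q.1 q.2)]; simp
  have w1i : Function.Injective w1 := fun u v huv => ofFn_injective
    (flatMap_inj _ Subtype.val_injective (fun q : W => hlen q.1 q.2) _ _ (by simp) huv)
  have hLn : 1 ≤ L * n0 := Nat.mul_pos hL hn0
  have σ0 : σ ≠ 0 ∧ |σ| < 1 := by
    obtain ⟨u, hu⟩ := Tne
    rw [← hT u hu, ← w1s]
    exact ⟨(pr _).1, (pr _).2.2 (by rw [w1l]; exact hLn)⟩
  have σp := abs_pos.2 σ0.1
  set w : T × T → List ι := fun p => w1 p.1.1 ++ w1 p.2.1 with hw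
  have hwi : Function.Injective w := fun p p' h => by
    obtain ⟨a, b⟩ := append_inj h (by rw [w1l, w1l])
    exact Prod.ext (Subtype.ext (w1i a)) (Subtype.ext (w1i b))
  have hws : ∀ p, ((w p).map r).prod = σ ^ 2 := fun p => by
    simp only [hw, map_append, prod_append]; rw [w1s, w1s, hT _ p.1.2, hT _ p.2.2]; ring
  have hTn : Nonempty (T × T) := ⟨(⟨_, Tne.choose_spec⟩, ⟨_, Tne.choose_spec⟩)⟩
  obtain ⟨c, hc, hsep⟩ := hom_sep r t h w hwi (ℓ := L * n0 + L * n0) (by omega)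
    (fun p => by simp only [hw, length_append]; rw [w1l, w1l]) hws
  have lm0 : 0 < σ ^ 2 := by have := σ0.1; positivity
  have lm1 : σ ^ 2 < 1 := by rw [← sq_abs]; nlinarith [σ0.2]
  refine dim_lower lm0 lm1 _ hc hsep ht1 ?_ Λ hcl |x0| ?_
  · rw [Fintype.card_prod, Fintype.card_coe]
    push_cast
    have Tc : (0:ℝ) < T.card := cast_pos.2 (Finset.card_pos.2 Tne)
    rw [log_mul Tc.ne' Tc.ne', ← sq_abs, log_pow]
    have := Real.log_pos hc0
    rw [log_mul Tc.ne' (rpow_pos_of_pos σp _).ne', log_rpow σp] at this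
    push_cast; linarith
  · intro n u
    refine ⟨_, hΛ ((ofFn u).flatMap (fun p => ofFn p.1.1 ++ ofFn p.2.1)), ?_⟩
    have : ((ofFn u).flatMap (fun p => ofFn p.1.1 ++ ofFn p.2.1)).flatMap Subtype.val
        = (ofFn u).flatMap w := by
      rw [List.flatMap_assoc]; simp only [hw, w1, List.flatMap_append]
    rw [this, flat_wS r t w hws, add_sub_cancel_right, abs_mul, abs_of_pos (pow_pos lm0 n), mul_comm]
end homog
section cpl1
def ap {ι : Type*} (S : ι → ℝ → ℝ) : List ι → ℝ → ℝ
  | [], x => x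
  | k :: v, x => ap S v (S k x)
lemma ap_append {ι : Type*} (S : ι → ℝ → ℝ) (u v : List ι) (x : ℝ) :
    ap S (u ++ v) x = ap S v (ap S u x) := by
  induction u generalizing x with
  | nil => rfl
  | cons k u ih => exact ih _
lemma ap_rev {ι : Type*} (S : ι → ℝ → ℝ) (u : List ι) (x : ℝ) : ap S u x = compFam S u.reverse x := by
  induction u generalizing x with
  | nil => rfl
  | cons k u ih => rw [List.reverse_cons, cF_append, ← ih]; rfl
lemma ap_aff {ι : Type*} (r t : ι → ℝ) (q : List ι) (x y : ℝ) :
    ap (gS r t) q x - ap (gS r t) q y = (q.map r).prod * (x - y) := by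
  rw [ap_rev, ap_rev, cF_aff r t, cF_aff r t _ y, map_reverse, prod_reverse]; ring
variable {m : ℕ} {l : Fin m → ℕ} (F : CPLIFS m l)
abbrev rr : CPLIFS.Idx m l → ℝ := fun p => F.ρ p.1 p.2
abbrev tt : CPLIFS.Idx m l → ℝ := fun p => F.t p.1 p.2
abbrev aS := ap (gS (rr F) (tt F))
abbrev af := ap F.f
lemma piece_oc {k : Fin m} {Y : Set ℝ} (hY : Y.OrdConnected) (hb : ∀ j, F.b k j ∉ Y) :
    ∃ i, ∀ x ∈ Y, F.f k x = F.ρ k i * x + F.t k i := by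
  classical
  rcases Y.eq_empty_or_nonempty with h | ⟨a, ha⟩
  · exact ⟨0, fun x hx => by rw [h] at hx; exact hx.elim⟩
  have : ∃ i : ℕ, i ≤ l k ∧ ∀ j : Fin (l k), (j:ℕ) < i ↔ F.b k j ≤ a := by
    by_cases h : ∃ i, ∃ j : Fin (l k), (j:ℕ) = i ∧ a < F.b k j
    · obtain ⟨j0, hj0, hj1⟩ := Nat.find_spec h
      refine ⟨Nat.find h, by rw [← hj0]; exact j0.2.le, fun j => ⟨fun hj => ?_, fun hj => ?_⟩⟩
      · by_contra hc
        exact Nat.find_min h hj ⟨j, rfl, not_le.1 hc⟩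
      · by_contra hc
        have : j0 ≤ j := by rw [Fin.le_def, hj0]; omega
        exact absurd ((F.hb k).monotone this) (not_le.2 (lt_of_le_of_lt hj hj1))
    · push Not at h
      exact ⟨l k, le_rfl, fun j => ⟨fun _ => h _ j rfl, fun _ => j.2⟩⟩
  obtain ⟨i, hi, H⟩ := this
  refine ⟨⟨i, by omega⟩, fun x hx => F.haff k _ x (fun j hj => ?_) (fun j hj => ?_)⟩
  · by_contra h
    exact hb j (hY.out hx ha ⟨not_lt.1 h, (H j).1 hj⟩)
  · have h1 : a < F.b k j := by
      by_contra h; have := (H j).2 (not_lt.1 h); simp at hj; omega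
    by_contra h2
    exact hb j (hY.out ha hx ⟨h1.le, not_lt.1 h2⟩)
lemma piece {k : Fin m} {a c : ℝ} (hac : a < c) (hb : ∀ j, F.b k j ∉ Ioo a c) :
    ∃ i, ∀ x ∈ Icc a c, F.f k x = F.ρ k i * x + F.t k i := by
  obtain ⟨i, e⟩ := piece_oc F ordConnected_Ioo hb
  refine ⟨i, ?_⟩
  have := EqOn.closure (g := fun x => F.ρ k i * x + F.t k i) e (F.hcont k) (by fun_prop)
  rw [closure_Ioo hac.ne] at this
  exact this
lemma gapr (E : Set ℝ) (hE : E.Finite) (x : ℝ) : ∃ r > 0, ∀ e ∈ E, e ≠ x → r ≤ |e - x| := by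
  have : (E \ {x})ᶜ ∈ nhds x := (hE.subset sdiff_subset).isClosed.isOpen_compl.mem_nhds (by simp)
  obtain ⟨r, hr, h⟩ := Metric.mem_nhds_iff.1 this
  refine ⟨r, hr, fun e he hne => ?_⟩
  by_contra hc
  have : e ∈ Metric.ball x r := by rw [Metric.mem_ball, dist_eq]; exact not_le.1 hc
  exact h this ⟨he, hne⟩
def brk : Set ℝ := ⋃ k, range (F.b k)
lemma brk_fin : (brk F).Finite := finite_iUnion (fun k => finite_range _)
lemma side_piece (k : Fin m) (x : ℝ) {τ : ℝ} (hτ : τ = 1 ∨ τ = -1) :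
    ∃ r > 0, ∃ i, ∀ h ∈ Icc 0 r, F.f k (x + τ * h) = F.ρ k i * (x + τ * h) + F.t k i := by
  obtain ⟨r, hr, H⟩ := gapr (brk F) (brk_fin F) x
  have nb : ∀ j, F.b k j = x ∨ r ≤ |F.b k j - x| := fun j => by
    by_cases h : F.b k j = x
    · exact Or.inl h
    · exact Or.inr (H _ (mem_iUnion.2 ⟨k, mem_range_self j⟩) h)
  refine ⟨r, hr, ?_⟩
  rcases hτ with rfl | rfl
  · obtain ⟨i, hi⟩ := piece F (k := k) (a := x) (c := x + r) (by linarith) (fun j hj => by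
      rcases nb j with h | h
      · rw [h] at hj; exact lt_irrefl _ hj.1
      · rw [abs_of_pos (by linarith [hj.1])] at h; linarith [hj.2])
    exact ⟨i, fun h hh => hi _ ⟨by linarith [hh.1], by linarith [hh.2]⟩⟩
  · obtain ⟨i, hi⟩ := piece F (k := k) (a := x - r) (c := x) (by linarith) (fun j hj => by
      rcases nb j with h | h
      · rw [h] at hj; exact lt_irrefl _ hj.2
      · rw [abs_of_neg (by linarith [hj.2])] at h; linarith [hj.1])
    exact ⟨i, fun h hh => hi _ ⟨by linarith [hh.2], by linarith [hh.1]⟩⟩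
lemma slope_bds : ∃ ρm ρM : ℝ, 0 < ρm ∧ ρm ≤ ρM ∧ ρM < 1 ∧ ∀ k i, ρm ≤ |F.ρ k i| ∧ |F.ρ k i| ≤ ρM := by
  have : Nonempty (CPLIFS.Idx m l) := ⟨⟨⟨0, by have := F.hm; omega⟩, 0⟩⟩
  obtain ⟨p, hp⟩ := Finite.exists_max (fun p => |rr F p|)
  obtain ⟨q, hq⟩ := Finite.exists_min (fun p => |rr F p|)
  exact ⟨|rr F q|, |rr F p|, abs_pos.2 (F.hρ0 _ _), hp q, F.hρ1 _ _, fun k i => ⟨hq ⟨k, i⟩, hp ⟨k, i⟩⟩⟩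
lemma f_lip {ρM : ℝ} (hM : ∀ k i, |F.ρ k i| ≤ ρM) (k : Fin m) (x y : ℝ) :
    |F.f k x - F.f k y| ≤ ρM * |x - y| := by
  classical
  have key : ∀ n : ℕ, ∀ x y : ℝ, x < y → (Finset.univ.filter (fun j => F.b k j ∈ Ioo x y)).card ≤ n →
      |F.f k x - F.f k y| ≤ ρM * |x - y| := by
    intro n
    induction n with
    | zero =>
      intro x y hxy hc
      obtain ⟨i, hi⟩ := piece F (k := k) hxy (fun j hj => by
        have : j ∈ Finset.univ.filter (fun j => F.b k j ∈ Ioo x y) := by simpa using hj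
        have := Finset.card_pos.2 ⟨j, this⟩; omega)
      rw [hi x ⟨le_rfl, hxy.le⟩, hi y ⟨hxy.le, le_rfl⟩, add_sub_add_right_eq_sub, ← mul_sub, abs_mul]
      exact mul_le_mul_of_nonneg_right (hM k i) (abs_nonneg _)
    | succ n ih =>
      intro x y hxy hc
      by_cases h : ∃ j, F.b k j ∈ Ioo x y
      · obtain ⟨j, hj⟩ := h
        have sub : ∀ a c, x ≤ a → c ≤ y → F.b k j ∉ Ioo a c →
            (Finset.univ.filter (fun j => F.b k j ∈ Ioo a c)).card ≤ n := by
          intro a c ha hc' hn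
          have : (Finset.univ.filter (fun j => F.b k j ∈ Ioo a c)) ⊂
              (Finset.univ.filter (fun j => F.b k j ∈ Ioo x y)) := by
            refine Finset.ssubset_iff_of_subset (fun i hi => ?_) |>.2 ⟨j, by simpa using hj, by simpa using hn⟩
            simp only [mem_filter, Finset.mem_univ, true_and] at hi ⊢
            exact ⟨lt_of_le_of_lt ha hi.1, lt_of_lt_of_le hi.2 hc'⟩
          have := Finset.card_lt_card this
          omega
        have h1 := ih x _ hj.1 (sub _ _ le_rfl hj.2.le (by simp))
        have h2 := ih _ y hj.2 (sub _ _ hj.1.le le_rfl (by simp))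
        have h3 := abs_sub_le (F.f k x) (F.f k (F.b k j)) (F.f k y)
        rw [abs_of_neg (sub_neg.2 hj.1)] at h1
        rw [abs_of_neg (sub_neg.2 hj.2)] at h2
        rw [abs_of_neg (by linarith : x - y < 0)]
        linarith
      · push Not at h
        refine ih x y hxy ?_
        rw [Finset.filter_false_of_mem (fun j _ => h j)]; simp
  rcases lt_trichotomy x y with h | h | h
  · exact key _ x y h le_rfl
  · rw [h]; simp
  · rw [abs_sub_comm, abs_sub_comm x]; exact key _ y x h le_rfl
lemma ap_lip {ρM : ℝ} (h0 : 0 ≤ ρM) (hM : ∀ k i, |F.ρ k i| ≤ ρM) (w : List (Fin m)) (x y : ℝ) :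
    |af F w x - af F w y| ≤ ρM ^ w.length * |x - y| := by
  induction w generalizing x y with
  | nil => simp [af, ap]
  | cons k w ih =>
    refine (ih _ _).trans ?_
    rw [length_cons, pow_succ, mul_assoc]
    exact mul_le_mul_of_nonneg_left (f_lip F hM k x y) (pow_nonneg h0 _)
lemma side_word (w : List (Fin m)) (x : ℝ) {τ : ℝ} (hτ : τ = 1 ∨ τ = -1) :
    ∃ r > 0, ∃ q : List (CPLIFS.Idx m l), q.map Sigma.fst = w ∧
      ∀ h ∈ Icc 0 r, af F w (x + τ * h) = aS F q (x + τ * h) := by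
  induction w generalizing x τ with
  | nil => exact ⟨1, one_pos, [], rfl, fun h _ => rfl⟩
  | cons k w ih =>
    obtain ⟨r, hr, i, hi⟩ := side_piece F k x hτ
    have hρ := F.hρ0 k i
    have hx := hi 0 ⟨le_rfl, hr.le⟩
    rw [mul_zero, add_zero] at hx
    have τ' : ∃ τ' : ℝ, (τ' = 1 ∨ τ' = -1) ∧ F.ρ k i * τ = τ' * |F.ρ k i| := by
      rcases hτ with rfl | rfl <;> rcases lt_or_gt_of_ne hρ with h | h
      · exact ⟨-1, Or.inr rfl, by rw [abs_of_neg h]; ring⟩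
      · exact ⟨1, Or.inl rfl, by rw [abs_of_pos h]; ring⟩
      · exact ⟨1, Or.inl rfl, by rw [abs_of_neg h]; ring⟩
      · exact ⟨-1, Or.inr rfl, by rw [abs_of_pos h]; ring⟩
    obtain ⟨τ', hτ', he⟩ := τ'
    obtain ⟨r2, hr2, q, hq, H⟩ := ih (F.f k x) hτ'
    have rp := abs_pos.2 hρ
    refine ⟨min r (r2 / |F.ρ k i|), lt_min hr (by positivity), ⟨k, i⟩ :: q, by simp [hq], fun h hh => ?_⟩
    have e1 := hi h ⟨hh.1, hh.2.trans (min_le_left _ _)⟩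
    have e2 : F.f k (x + τ * h) = F.f k x + τ' * (|F.ρ k i| * h) := by
      rw [e1, hx, ← mul_assoc τ', ← he]; ring
    have e3 : |F.ρ k i| * h ≤ r2 := by
      have := hh.2.trans (min_le_right _ _)
      rw [le_div_iff₀ rp] at this; linarith
    have := H (|F.ρ k i| * h) ⟨mul_nonneg rp.le hh.1, e3⟩
    rw [← e2] at this
    change af F w (F.f k (x + τ * h)) = aS F q (F.ρ k i * (x + τ * h) + F.t k i)
    rw [← e1]; exact this
lemma itin (w : List (Fin m)) (x : ℝ) : ∃ q : List (CPLIFS.Idx m l), q.map Sigma.fst = w ∧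
    af F w x = aS F q x := by
  obtain ⟨r, hr, q, hq, H⟩ := side_word F w x (τ := 1) (Or.inl rfl)
  have := H 0 ⟨le_rfl, hr.le⟩
  simp only [mul_zero, add_zero] at this
  exact ⟨q, hq, this⟩
variable {F}
lemma aS_inj (hesc : ESCfam (rr F) (tt F)) (p q : List (CPLIFS.Idx m l)) (hl : p.length = q.length)
    (hp : (p.map (rr F)).prod = (q.map (rr F)).prod) (y : ℝ) (h : aS F p y = aS F q y) : p = q := by
  refine List.reverse_injective (esc_inj (rr F) (tt F) hesc _ _ (by simpa using hl)
    (by simpa [map_reverse, prod_reverse] using hp) ?_)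
  rw [← ap_rev, ← ap_rev]
  have h1 := ap_aff (rr F) (tt F) p y 0
  have h2 := ap_aff (rr F) (tt F) q y 0
  rw [hp] at h1
  simp only [aS] at h
  linarith
lemma uniq (hesc : ESCfam (rr F) (tt F)) (y : ℝ) (u v : List (Fin m)) (hl : u.length = v.length)
    (hu : af F u y = y) (hv : af F v y = y) : u = v := by
  obtain ⟨p, hp, ep⟩ := itin F u y
  obtain ⟨q, hq, eq⟩ := itin F v y
  have lp : p.length = u.length := by rw [← hp]; simp
  have lq : q.length = v.length := by rw [← hq]; simp
  have : p ++ q = q ++ p := aS_inj hesc _ _ (by simp; omega) (by simp [mul_comm]) y (by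
    rw [aS, ap_append, ap_append]
    rw [hu] at ep; rw [hv] at eq
    simp only [aS] at ep eq
    rw [← ep, ← eq, ← ep])
  have := (append_inj this (by omega)).1
  rw [← hp, ← hq, this]
end cpl1
section cpl2
variable {m : ℕ} {l : Fin m → ℕ} (F : CPLIFS m l) (ρM : ℝ)
open Classical in
def sw (k : Fin m) (Y : Set ℝ) : ℝ :=
  Finset.univ.inf' ⟨(0 : Fin (l k + 1)), Finset.mem_univ _⟩
    (fun i => if ∀ x ∈ Y, F.f k x = F.ρ k i * x + F.t k i then |F.ρ k i| else ρM)
def Lw : List (Fin m) → Set ℝ → ℝ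
  | [], _ => 1
  | k :: v, Y => sw F ρM k Y * Lw v (F.f k '' Y)
open Classical in
def hb (b : ℝ) : List (Fin m) → Set ℝ → ℕ
  | [], _ => 0
  | k :: v, Y => (if b ∈ Y then 1 else 0) + hb b v (F.f k '' Y)
def SW (m n : ℕ) (φ : List (Fin m) → ℝ) : ℝ := ∑ w : Fin n → Fin m, φ (ofFn w)
lemma SW_zero (φ : List (Fin m) → ℝ) : SW m 0 φ = φ [] := by simp [SW]
lemma SW_succ (n : ℕ) (φ : List (Fin m) → ℝ) : SW m (n+1) φ = ∑ k, SW m n (fun v => φ (k :: v)) := by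
  unfold SW
  rw [← Fintype.sum_prod_type', ← (Fin.consEquiv (fun _ => Fin m)).sum_comp]
  refine sum_congr rfl (fun p _ => ?_)
  simp [Fin.consEquiv, ofFn_succ]
lemma SW_mono {n : ℕ} {φ ψ : List (Fin m) → ℝ} (h : ∀ w, w.length = n → φ w ≤ ψ w) : SW m n φ ≤ SW m n ψ :=
  sum_le_sum (fun w _ => h _ (by simp))
lemma SW_mul (n : ℕ) (c : ℝ) (φ : List (Fin m) → ℝ) : SW m n (fun v => c * φ v) = c * SW m n φ := by
  simp [SW, mul_sum]
variable {ρM}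
lemma sw_le {k : Fin m} {Y : Set ℝ} (hM : ∀ k i, |F.ρ k i| ≤ ρM) : sw F ρM k Y ≤ ρM :=
  (inf'_le _ (Finset.mem_univ 0)).trans (by split_ifs; exacts [hM _ _, le_rfl])
lemma le_sw {k : Fin m} {Y : Set ℝ} {ρm : ℝ} (h : ρm ≤ ρM) (hm : ∀ k i, ρm ≤ |F.ρ k i|) :
    ρm ≤ sw F ρM k Y :=
  Finset.le_inf' _ _ (fun i _ => by split_ifs; exacts [hm _ _, h])
lemma sw_mono {k : Fin m} {Y Y' : Set ℝ} (hM : ∀ k i, |F.ρ k i| ≤ ρM) (h : Y' ⊆ Y) :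
    sw F ρM k Y' ≤ sw F ρM k Y := by
  refine Finset.le_inf' _ _ (fun i _ => (inf'_le _ (Finset.mem_univ i)).trans ?_)
  by_cases h1 : ∀ x ∈ Y, F.f k x = F.ρ k i * x + F.t k i
  · rw [if_pos h1, if_pos (fun x hx => h1 x (h hx))]
  · rw [if_neg h1]; split_ifs; exacts [hM _ _, le_rfl]
lemma sw_le_piece {k : Fin m} {Y : Set ℝ} {i} (h : ∀ x ∈ Y, F.f k x = F.ρ k i * x + F.t k i) :
    sw F ρM k Y ≤ |F.ρ k i| :=
  (inf'_le _ (Finset.mem_univ i)).trans (by rw [if_pos h])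
lemma sw_lip {k : Fin m} {Y : Set ℝ} (hM : ∀ k i, |F.ρ k i| ≤ ρM) {x y : ℝ} (hx : x ∈ Y) (hy : y ∈ Y) :
    |F.f k x - F.f k y| ≤ sw F ρM k Y * |x - y| := by
  classical
  obtain ⟨i, -, hi⟩ := Finset.exists_mem_eq_inf' ⟨(0 : Fin (l k + 1)), Finset.mem_univ _⟩
    (fun i => if ∀ x ∈ Y, F.f k x = F.ρ k i * x + F.t k i then |F.ρ k i| else ρM)
  have : sw F ρM k Y = if ∀ x ∈ Y, F.f k x = F.ρ k i * x + F.t k i then |F.ρ k i| else ρM := by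
    rw [← hi]; unfold sw; congr!
  rw [this]
  split_ifs with h
  · rw [h x hx, h y hy, add_sub_add_right_eq_sub, ← mul_sub, abs_mul]
  · exact f_lip F hM k x y
variable {ρm : ℝ} (h0 : 0 < ρm) (hmM : ρm ≤ ρM) (hM1 : ρM < 1) (hm : ∀ k i, ρm ≤ |F.ρ k i|)
  (hM : ∀ k i, |F.ρ k i| ≤ ρM)
include h0 hmM hm in
lemma sw_pos {k : Fin m} {Y : Set ℝ} : 0 < sw F ρM k Y := h0.trans_le (le_sw F hmM hm)
include h0 hmM hm in
lemma Lw_ge (w : List (Fin m)) (Y : Set ℝ) : ρm ^ w.length ≤ Lw F ρM w Y := by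
  induction w generalizing Y with
  | nil => simp [Lw]
  | cons k w ih =>
    rw [length_cons, pow_succ', Lw]
    exact mul_le_mul (le_sw F hmM hm) (ih _) (pow_pos h0 _).le (sw_pos F h0 hmM hm).le
include h0 hmM hm in
lemma Lw_pos (w : List (Fin m)) (Y : Set ℝ) : 0 < Lw F ρM w Y :=
  (pow_pos h0 _).trans_le (Lw_ge F h0 hmM hm w Y)
include h0 hmM hm hM in
lemma Lw_mono (w : List (Fin m)) {Y Y' : Set ℝ} (h : Y' ⊆ Y) : Lw F ρM w Y' ≤ Lw F ρM w Y := by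
  induction w generalizing Y Y' with
  | nil => simp [Lw]
  | cons k w ih =>
    exact mul_le_mul (sw_mono F hM h) (ih (image_mono h)) (Lw_pos F h0 hmM hm _ _).le (sw_pos F h0 hmM hm).le
include h0 hmM hm hM in
lemma Lw_lip (w : List (Fin m)) (Y : Set ℝ) {x y : ℝ} (hx : x ∈ Y) (hy : y ∈ Y) :
    |af F w x - af F w y| ≤ Lw F ρM w Y * |x - y| := by
  induction w generalizing Y x y with
  | nil => simp [Lw, af, ap]
  | cons k w ih =>
    refine (ih _ (mem_image_of_mem _ hx) (mem_image_of_mem _ hy)).trans ?_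
    rw [Lw, mul_comm (sw F ρM k Y), mul_assoc]
    exact mul_le_mul_of_nonneg_left (sw_lip F hM hx hy) (Lw_pos F h0 hmM hm _ _).le
variable (ρM) (t : ℝ)
def Aw (n : ℕ) (Y : Set ℝ) : ℝ := SW m n (fun v => Lw F ρM v Y ^ t)
variable {ρM} {t} (ht : 0 < t)
lemma Aw_zero (Y : Set ℝ) : Aw F ρM t 0 Y = 1 := by simp [Aw, SW_zero, Lw]
include h0 hmM hm in
lemma Aw_succ (n : ℕ) (Y : Set ℝ) : Aw F ρM t (n+1) Y = ∑ k, sw F ρM k Y ^ t * Aw F ρM t n (F.f k '' Y) := by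
  unfold Aw
  rw [SW_succ]
  refine sum_congr rfl (fun k _ => ?_)
  rw [← SW_mul]; congr 1; funext v
  rw [Lw, mul_rpow (sw_pos F h0 hmM hm).le (Lw_pos F h0 hmM hm _ _).le]
include h0 hmM hm in
lemma Aw_pos (n : ℕ) (Y : Set ℝ) : 0 < Aw F ρM t n Y := by
  have : Nonempty (Fin m) := ⟨⟨0, by have := F.hm; omega⟩⟩
  exact Finset.sum_pos (fun w _ => rpow_pos_of_pos (Lw_pos F h0 hmM hm _ _) _) Finset.univ_nonempty
include h0 hmM hm hM ht in
lemma Aw_mono (n : ℕ) {Y Y' : Set ℝ} (h : Y' ⊆ Y) : Aw F ρM t n Y' ≤ Aw F ρM t n Y :=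
  SW_mono (fun w _ => rpow_le_rpow (Lw_pos F h0 hmM hm _ _).le (Lw_mono F h0 hmM hm hM w h) ht.le)
include h0 hmM hm hM ht in
lemma Aw_sub {J : Set ℝ} (hJ : ∀ k, F.f k '' J ⊆ J) (n j : ℕ) {Y : Set ℝ} (h : Y ⊆ J) :
    Aw F ρM t (n + j) Y ≤ Aw F ρM t n Y * Aw F ρM t j J := by
  induction n generalizing Y with
  | zero => rw [Aw_zero, one_mul, zero_add]; exact Aw_mono F h0 hmM hm hM ht j h
  | succ n ih =>
    rw [show n + 1 + j = (n + j) + 1 by ring, Aw_succ F h0 hmM hm, Aw_succ F h0 hmM hm, sum_mul]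
    refine sum_le_sum (fun k _ => ?_)
    rw [mul_assoc]
    exact mul_le_mul_of_nonneg_left (ih ((image_mono h).trans (hJ k)))
      (rpow_pos_of_pos (sw_pos F h0 hmM hm) _).le
include h0 hmM hm hM ht in
lemma Aw_growth {J : Set ℝ} (hJ : ∀ k, F.f k '' J ⊆ J) {c τ : ℝ} (hc : 0 < c) (hτ : 0 < τ)
    (hf : ∃ᶠ n : ℕ in atTop, c * exp (τ * n) ≤ Aw F ρM t n J) :
    ∃ a > 0, (∀ n : ℕ, exp (a * n) ≤ Aw F ρM t n J) ∧
      ∀ ε > 0, ∃ C > 0, ∀ n : ℕ, Aw F ρM t n J ≤ C * exp ((a + ε) * n) := by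
  set A := fun n => Aw F ρM t n J with hA
  have A0 : ∀ n, 0 < A n := fun n => Aw_pos F h0 hmM hm n J
  have sub : Subadditive (fun n => log (A n)) := fun n j => by
    rw [← log_mul (A0 n).ne' (A0 j).ne']
    exact log_le_log (A0 _) (Aw_sub F h0 hmM hm hM ht hJ n j subset_rfl)
  have m1 : 1 ≤ m := by have := F.hm; omega
  have Age : ∀ n, (ρm ^ t) ^ n ≤ A n := fun n => by
    have h1 : ∀ w : Fin n → Fin m, (ρm ^ t) ^ n ≤ Lw F ρM (ofFn w) J ^ t := fun w => by
      have := rpow_le_rpow (pow_pos h0 _).le (Lw_ge F h0 hmM hm (ofFn w) J) ht.le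
      rw [length_ofFn, ← rpow_natCast, ← rpow_mul h0.le, mul_comm, rpow_mul h0.le,
        rpow_natCast] at this
      exact this
    calc (ρm ^ t) ^ n ≤ Lw F ρM (ofFn (fun _ : Fin n => (⟨0, m1⟩ : Fin m))) J ^ t := h1 _
      _ ≤ A n := single_le_sum (f := fun w : Fin n → Fin m => Lw F ρM (ofFn w) J ^ t)
        (fun w _ => (rpow_pos_of_pos (Lw_pos F h0 hmM hm _ _) _).le) (Finset.mem_univ _)
  have rt : 0 < ρm ^ t := rpow_pos_of_pos h0 t
  have bdd : BddBelow (range fun n : ℕ => log (A n) / n) := by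
    refine ⟨min (log (ρm ^ t)) 0, ?_⟩
    rintro _ ⟨n, rfl⟩
    dsimp only
    rcases Nat.eq_zero_or_pos n with h | h
    · subst h; simp
    · refine (min_le_left _ _).trans ?_
      have hn : (0:ℝ) < n := cast_pos.2 h
      rw [le_div_iff₀ hn, mul_comm, ← log_pow]
      exact log_le_log (pow_pos rt n) (Age n)
  have lim := sub.tendsto_lim bdd
  set a := sub.lim
  have apos : 0 < a := by
    by_contra hcon
    have e1 := lim.eventually_lt_const (show a < τ / 2 by linarith [not_lt.1 hcon])
    have e2 : ∀ᶠ n : ℕ in atTop, -log c ≤ τ / 2 * n :=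
      (tendsto_natCast_atTop_atTop.const_mul_atTop (by positivity)).eventually_ge_atTop _
    obtain ⟨n, h1, h2, h3, h4⟩ := (hf.and_eventually (e1.and (e2.and (eventually_gt_atTop 0)))).exists
    have hn : (0:ℝ) < n := cast_pos.2 h4
    rw [div_lt_iff₀ hn] at h2
    have := log_le_log (by positivity) h1
    rw [log_mul hc.ne' (exp_pos _).ne', Real.log_exp] at this
    have h5 : log (A n) = log (Aw F ρM t n J) := rfl
    linarith
  refine ⟨a, apos, fun n => ?_, fun ε hε => ?_⟩
  · rcases Nat.eq_zero_or_pos n with h | h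
    · subst h; rw [Aw_zero]; simp
    · have := sub.lim_le_div bdd h.ne'
      rw [le_div_iff₀ (cast_pos.2 h)] at this
      rw [← Real.le_log_iff_exp_le (A0 n)]; exact this
  · obtain ⟨N, hN⟩ := eventually_atTop.1 (lim.eventually_lt_const (show a < a + ε by linarith))
    refine ⟨1 + ∑ n ∈ Finset.range (N + 1), A n, add_pos_of_pos_of_nonneg one_pos
      (sum_nonneg (fun n _ => (A0 n).le)), fun n => ?_⟩
    have hs : 0 ≤ ∑ n ∈ Finset.range (N + 1), A n := sum_nonneg (fun n _ => (A0 n).le)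
    have e1 : 1 ≤ exp ((a + ε) * n) := Real.one_le_exp (by positivity)
    rcases lt_or_ge n (N+1) with h | h
    · have := single_le_sum (f := A) (fun n _ => (A0 n).le) (Finset.mem_range.2 h)
      change A n ≤ _
      nlinarith
    · have := hN n (by omega)
      rw [div_lt_iff₀ (cast_pos.2 (by omega)), Real.log_lt_iff_lt_exp (A0 n)] at this
      change A n ≤ _
      nlinarith
end cpl2
section cpl3
variable {m : ℕ} (f : Fin m → ℝ → ℝ) (g : Fin m → Set ℝ → ℝ) (κ b : ℝ)
open Classical in
def Tt : ℕ → Set ℝ → ℝ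
  | 0, _ => 1
  | n+1, Y => (if b ∈ Y then κ else 1) * ∑ k, g k Y * Tt n (f k '' Y)
open Classical in
def Rt : ℕ → Set ℝ → ℝ → ℝ
  | 0, _, _ => 1
  | n+1, Y, y => (if b ∈ Y then κ else 1) * ∑ k, g k Y * (if f k y = b then 0 else Rt n (f k '' Y) (f k y))
open Classical in
def Nt (j : ℕ) (y : ℝ) : ℝ := SW m j (fun u => if ap f u y = b then 1 else 0)
lemma Nt_succ (j : ℕ) (y : ℝ) : Nt f b (j+1) y = ∑ k, Nt f b j (f k y) := by
  unfold Nt; rw [SW_succ]; rfl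
lemma Nt_zero (y : ℝ) [Decidable (y = b)] : Nt f b 0 y = if y = b then 1 else 0 := by
  unfold Nt; rw [SW_zero]; simp only [ap]; congr
lemma Nt_nn (j : ℕ) (y : ℝ) : 0 ≤ Nt f b j y :=
  sum_nonneg (fun w _ => by beta_reduce; split_ifs <;> norm_num)
lemma Nt_le (hu : ∀ u v : List (Fin m), u.length = v.length → ap f u b = b → ap f v b = b → u = v) (j : ℕ) :
    Nt f b j b ≤ 1 := by
  classical
  unfold Nt SW
  rw [Finset.sum_ite, Finset.sum_const_zero, add_zero, sum_const, nsmul_eq_mul, mul_one]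
  have : (Finset.univ.filter (fun w : Fin j → Fin m => ap f (ofFn w) b = b)).card ≤ 1 := by
    refine Finset.card_le_one.2 (fun u hu1 v hv => ?_)
    exact ofFn_injective (hu _ _ (by simp) (mem_filter.1 hu1).2 (mem_filter.1 hv).2)
  exact_mod_cast this
variable {f g κ b} (hg0 : ∀ k Y, 0 < g k Y) (hκ1 : 1 ≤ κ) (hκ : ∀ k Y, κ * g k Y ≤ 1)
include hg0 hκ1 in
lemma Tt_nn (n : ℕ) (Y : Set ℝ) : 0 ≤ Tt f g κ b n Y := by
  induction n generalizing Y with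
  | zero => simp [Tt]
  | succ n ih =>
    refine mul_nonneg (by split_ifs <;> linarith) (sum_nonneg (fun k _ => mul_nonneg (hg0 _ _).le (ih _)))
include hg0 hκ1 in
lemma Rt_le (n : ℕ) (Y : Set ℝ) (y : ℝ) : Rt f g κ b n Y y ≤ Tt f g κ b n Y := by
  induction n generalizing Y y with
  | zero => simp [Rt, Tt]
  | succ n ih =>
    refine mul_le_mul_of_nonneg_left (sum_le_sum (fun k _ => mul_le_mul_of_nonneg_left ?_ (hg0 _ _).le))
      (by split_ifs <;> linarith)
    split_ifs; exacts [Tt_nn hg0 hκ1 _ _, ih _ _]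
include hg0 hκ1 hκ in
lemma fac_le (k : Fin m) (Y : Set ℝ) (p : Prop) [Decidable p] : (if p then κ else 1) * g k Y ≤ 1 := by
  split_ifs
  · exact hκ _ _
  · rw [one_mul]; nlinarith [hκ k Y, hg0 k Y]
include hg0 hκ1 hκ in
lemma Tt_step (n : ℕ) (Y : Set ℝ) : Tt f g κ b (n+1) Y ≤ ∑ k, Tt f g κ b n (f k '' Y) := by
  classical
  rw [Tt, mul_sum]
  refine sum_le_sum (fun k _ => ?_)
  rw [← mul_assoc]
  exact mul_le_of_le_one_left (Tt_nn hg0 hκ1 _ _) (fac_le hg0 hκ1 hκ _ _ _)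
include hg0 hκ1 hκ in
lemma Tt_pow (n : ℕ) (Y : Set ℝ) : Tt f g κ b n Y ≤ (m:ℝ) ^ n := by
  induction n generalizing Y with
  | zero => simp [Tt]
  | succ n ih =>
    refine (Tt_step hg0 hκ1 hκ n Y).trans ((sum_le_sum (fun k _ => ih _)).trans ?_)
    simp [pow_succ']
variable (f) in
def Tn (J : Set ℝ) (η : ℝ) (Y : Set ℝ) : Prop := Y ⊆ J ∧ ∀ x ∈ Y, ∀ y ∈ Y, |x - y| ≤ η
variable {J : Set ℝ} {ρ : ℝ} (hρ : ρ ≤ 1) (hl : ∀ k x y, |f k x - f k y| ≤ ρ * |x - y|) (hJ : ∀ k, f k '' J ⊆ J)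
include hρ hl hJ in
lemma Tn_im {η : ℝ} {Y : Set ℝ} (h : Tn J η Y) (k : Fin m) : Tn J η (f k '' Y) := by
  refine ⟨(image_mono h.1).trans (hJ k), ?_⟩
  rintro _ ⟨x, hx, rfl⟩ _ ⟨y, hy, rfl⟩
  refine (hl k x y).trans ((mul_le_of_le_one_left (abs_nonneg _) hρ).trans (h.2 x hx y hy))
include hg0 hκ1 hκ hρ hl hJ in
lemma LR {η G E : ℝ} (hG : 0 ≤ G) (n : ℕ)
    (H : ∀ n' ≤ n, ∀ Y, Tn J η Y → b ∈ Y → Rt f g κ b n' Y b ≤ G * exp (E * n'))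
    (Y : Set ℝ) (hY : Tn J η Y) (y : ℝ) (hy : y ∈ Y) :
    Tt f g κ b n Y ≤ Rt f g κ b n Y y +
      G * ∑ j ∈ Finset.range n, exp (E * ((n:ℝ) - (j + 1))) * Nt f b (j+1) y := by
  classical
  induction n generalizing Y y with
  | zero => simp [Tt, Rt]
  | succ n ih =>
    have key : ∀ k, Tt f g κ b n (f k '' Y) ≤ (if f k y = b then 0 else Rt f g κ b n (f k '' Y) (f k y)) +
        G * ∑ j ∈ Finset.range (n+1), exp (E * ((n:ℝ) - j)) * Nt f b j (f k y) := fun k => by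
      have := ih (fun n' hn' => H n' (by omega)) (f k '' Y) (Tn_im hρ hl hJ hY k) (f k y) (mem_image_of_mem _ hy)
      rw [Finset.sum_range_succ', Nt_zero]
      push_cast
      split_ifs with hb
      · have h2 := H n (by omega) (f k '' Y) (Tn_im hρ hl hJ hY k) (hb ▸ mem_image_of_mem _ hy)
        rw [hb] at this ⊢
        rw [mul_add, sub_zero, mul_one]; linarith
      · rw [mul_zero, add_zero]; exact this
    have key2 : ∑ j ∈ Finset.range (n+1), exp (E * (((n+1:ℕ):ℝ) - (j + 1))) * Nt f b (j+1) y =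
        ∑ k, ∑ j ∈ Finset.range (n+1), exp (E * ((n:ℝ) - j)) * Nt f b j (f k y) := by
      rw [sum_comm]
      refine sum_congr rfl (fun j _ => ?_)
      rw [Nt_succ, mul_sum]; push_cast
      refine sum_congr rfl (fun k _ => ?_)
      congr 3; ring
    rw [key2, Tt, Rt, mul_sum, mul_sum, mul_sum, ← sum_add_distrib]
    refine sum_le_sum (fun k _ => ?_)
    have hn : 0 ≤ G * ∑ j ∈ Finset.range (n+1), exp (E * ((n:ℝ) - j)) * Nt f b j (f k y) :=
      mul_nonneg hG (sum_nonneg (fun j _ => mul_nonneg (exp_pos _).le (Nt_nn _ _ _ _)))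
    have h1 := fac_le hg0 hκ1 hκ k Y (b ∈ Y)
    have h2 : 0 ≤ (if b ∈ Y then κ else 1) * g k Y := mul_nonneg (by split_ifs <;> linarith) (hg0 _ _).le
    rw [← mul_assoc, ← mul_assoc]
    calc _ ≤ _ := mul_le_mul_of_nonneg_left (key k) h2
      _ ≤ _ := by rw [mul_add]; exact add_le_add le_rfl (mul_le_of_le_one_left hn h1)
variable {A : ℕ → Set ℝ → ℝ} (A0 : ∀ Y, A 0 Y = 1) (As : ∀ n Y, A (n+1) Y = ∑ k, g k Y * A n (f k '' Y))
include hg0 A0 As in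
lemma A_nn (n : ℕ) (Y : Set ℝ) : 0 ≤ A n Y := by
  induction n generalizing Y with
  | zero => simp [A0]
  | succ n ih => rw [As]; exact sum_nonneg (fun k _ => mul_nonneg (hg0 _ _).le (ih _))
variable (A) in
def Bt (M E : ℝ) (n q : ℕ) (Y : Set ℝ) : ℝ :=
  A n Y + ∑ j ∈ Finset.Ico q n, A j Y * (M * exp (E * ((n:ℝ) - j)))
include As in
lemma Bt_succ (M E : ℝ) (n q : ℕ) (Y : Set ℝ) :
    Bt A M E (n+1) (q+1) Y = ∑ k, g k Y * Bt A M E n q (f k '' Y) := by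
  unfold Bt
  simp only [mul_add, sum_add_distrib, ← As, mul_sum]
  rw [sum_comm, ← Finset.sum_Ico_add' _ q n 1]
  congr 1
  refine sum_congr rfl (fun j _ => ?_)
  rw [As, sum_mul]
  refine sum_congr rfl (fun k _ => ?_)
  push_cast
  rw [show (n:ℝ) + 1 - (j + 1) = n - j by ring]; ring
include hg0 A0 As in
lemma Bt_nn {M : ℝ} (hM : 0 ≤ M) (E : ℝ) (n q : ℕ) (Y : Set ℝ) : 0 ≤ Bt A M E n q Y :=
  add_nonneg (A_nn hg0 A0 As _ _) (sum_nonneg (fun j _ => mul_nonneg (A_nn hg0 A0 As _ _)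
    (mul_nonneg hM (exp_pos _).le)))
include hg0 A0 As in
lemma Bt_anti {M : ℝ} (hM : 0 ≤ M) (E : ℝ) (n q : ℕ) (Y : Set ℝ) : Bt A M E n (q+1) Y ≤ Bt A M E n q Y := by
  unfold Bt
  gcongr
  · intro j _ _
    exact mul_nonneg (A_nn hg0 A0 As _ _) (mul_nonneg hM (exp_pos _).le)
  · exact Nat.le_succ q
include hg0 A0 As hρ hl hJ in
lemma FH {η M E : ℝ} (hM : 0 ≤ M) (n : ℕ)
    (H : ∀ n' ≤ n, ∀ Y, Tn J η Y → b ∈ Y → Tt f g κ b n' Y ≤ M * exp (E * n'))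
    (Y : Set ℝ) (hY : Tn J η Y) : Tt f g κ b n Y ≤ Bt A M E n 0 Y := by
  induction n generalizing Y with
  | zero => simp [Tt, Bt, A0]
  | succ n ih =>
    by_cases hb : b ∈ Y
    · refine (H _ le_rfl Y hY hb).trans ?_
      unfold Bt
      have := single_le_sum (f := fun j => A j Y * (M * exp (E * (((n+1:ℕ):ℝ) - j)))) (s := Finset.Ico 0 (n+1))
        (fun j _ => mul_nonneg (A_nn hg0 A0 As j Y) (mul_nonneg hM (exp_pos _).le)) (show 0 ∈ _ by simp)
      simp only [A0, one_mul, Nat.cast_zero, sub_zero] at this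
      linarith [A_nn hg0 A0 As (n+1) Y]
    · refine le_trans ?_ (Bt_anti hg0 A0 As hM E (n+1) 0 Y)
      rw [Bt_succ As, Tt, if_neg hb, one_mul]
      exact sum_le_sum (fun k _ => mul_le_mul_of_nonneg_left
        (ih (fun n' hn' => H n' (by omega)) _ (Tn_im hρ hl hJ hY k)) (hg0 _ _).le)
include hg0 hκ1 A0 As hρ hl hJ in
lemma FHR {η M E : ℝ} (hM : 0 ≤ M) (n q : ℕ)
    (H : ∀ n' ≤ n, ∀ Y, Tn J η Y → b ∈ Y → Tt f g κ b n' Y ≤ M * exp (E * n'))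
    (Y : Set ℝ) (hY : Tn J η Y) (y : ℝ) (hy : y ∈ Y) (hyb : y ≠ b)
    (hq : ∀ u : List (Fin m), u.length < q → ap f u y = b ∨ η < |ap f u y - b|) :
    Rt f g κ b n Y y ≤ Bt A M E n q Y := by
  induction q generalizing n Y y with
  | zero => exact (Rt_le hg0 hκ1 _ _ _).trans (FH hg0 hρ hl hJ A0 As hM n H Y hY)
  | succ q ih =>
    cases n with
    | zero => simp [Rt, Bt, A0]
    | succ n =>
      have hb : b ∉ Y := fun hb => by
        rcases hq [] (by simp) with h | h
        · exact hyb h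
        · exact absurd (hY.2 y hy b hb) (not_le.2 h)
      rw [Bt_succ As, Rt, if_neg hb, one_mul]
      refine sum_le_sum (fun k _ => mul_le_mul_of_nonneg_left ?_ (hg0 _ _).le)
      split_ifs with h
      · exact Bt_nn hg0 A0 As hM _ _ _ _
      · exact ih n (fun n' hn' => H n' (by omega)) _ (Tn_im hρ hl hJ hY k) _ (mem_image_of_mem _ hy) h
          (fun u hu => hq (k :: u) (by simpa using hu))
include hg0 hκ1 A0 As hρ hl hJ in
lemma FHb {η M E : ℝ} (hM : 0 ≤ M) (n p : ℕ)
    (H : ∀ n' ≤ n, ∀ Y, Tn J η Y → b ∈ Y → Tt f g κ b n' Y ≤ M * exp (E * n'))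
    (Y : Set ℝ) (hY : Tn J η Y) (hb : b ∈ Y)
    (hq : ∀ u : List (Fin m), u.length < p + 1 → ap f u b = b ∨ η < |ap f u b - b|) :
    Rt f g κ b (n+1) Y b ≤ κ * Bt A M E (n+1) (p+1) Y := by
  rw [Bt_succ As, Rt, if_pos hb]
  refine mul_le_mul_of_nonneg_left (sum_le_sum (fun k _ => mul_le_mul_of_nonneg_left ?_ (hg0 _ _).le)) (by linarith)
  split_ifs with h
  · exact Bt_nn hg0 A0 As hM _ _ _ _
  · exact FHR hg0 hκ1 hρ hl hJ A0 As hM n p H _ (Tn_im hρ hl hJ hY k) _ (mem_image_of_mem _ hb) h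
      (fun u hu => hq (k :: u) (by simpa using hu))
include hg0 A0 As in
lemma Bt_bd {C a ε M : ℝ} (hC : 0 < C) (hε : 0 < ε) (hM : 0 ≤ M)
    (hA : ∀ n Y, Y ⊆ J → A n Y ≤ C * exp ((a + ε) * n)) (n q : ℕ) (Y : Set ℝ) (hY : Y ⊆ J) :
    Bt A M (a + 2 * ε) n q Y ≤
      (C + C * M * (exp (-ε) ^ q / (1 - exp (-ε)))) * exp ((a + 2 * ε) * n) := by
  have e1 : exp (-ε) < 1 := by rw [exp_lt_one_iff]; linarith
  unfold Bt
  rw [add_mul]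
  refine add_le_add ((hA n Y hY).trans ?_) ?_
  · gcongr; linarith
  · calc _ ≤ ∑ j ∈ Finset.Ico q n, (C * M * exp ((a + 2 * ε) * n)) * exp (-ε) ^ j := by
          refine sum_le_sum (fun j _ => ?_)
          refine (mul_le_mul_of_nonneg_right (hA j Y hY) (mul_nonneg hM (exp_pos _).le)).trans (le_of_eq ?_)
          have : exp ((a + ε) * j) * exp ((a + 2 * ε) * (n - j)) =
              exp ((a + 2 * ε) * n) * exp (-ε) ^ j := by
            rw [← exp_nat_mul, ← exp_add, ← exp_add]; congr 1; ring
          linear_combination (C * M) * this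
      _ ≤ _ := by
          rw [← mul_sum]
          refine (mul_le_mul_of_nonneg_left (geom_sum_Ico_le_of_lt_one (exp_pos _).le e1) (by positivity)).trans
            (le_of_eq (by ring))
include hg0 hκ1 hκ hl hJ A0 As in
theorem hit_abs (hρ0 : 0 ≤ ρ) (hρ1 : ρ < 1)
    (hu : ∀ u v : List (Fin m), u.length = v.length → ap f u b = b → ap f v b = b → u = v)
    {a ε C D0 : ℝ} (ha : 0 < a) (hε : 0 < ε) (hC : 0 < C)
    (hA : ∀ n Y, Y ⊆ J → A n Y ≤ C * exp ((a + ε) * n)) (hD : ∀ x ∈ J, ∀ y ∈ J, |x - y| ≤ D0) :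
    ∃ D > 0, ∀ n : ℕ, Tt f g κ b n J ≤ D * exp ((a + 2 * ε) * n) := by
  set E := a + 2 * ε with hE
  have hE0 : 0 < E := by positivity
  set xE := exp (-E) with hxE
  have xE1 : xE < 1 := by rw [hxE, exp_lt_one_iff]; linarith
  have xE0 : 0 < xE := exp_pos _
  set xe := exp (-ε) with hxe
  have xe1 : xe < 1 := by rw [hxe, exp_lt_one_iff]; linarith
  have xe0 : 0 < xe := exp_pos _
  have hC1 : 1 ≤ C := by have := hA 0 ∅ (empty_subset _); simpa [A0] using this
  obtain ⟨p, hp⟩ : ∃ p : ℕ, κ * C * (xe ^ p / (1 - xe)) ≤ (1 - xE) / 2 := by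
    have : Tendsto (fun p : ℕ => κ * C * (xe ^ p / (1 - xe))) atTop (nhds (κ * C * (0 / (1 - xe)))) :=
      ((tendsto_pow_atTop_nhds_zero_of_lt_one xe0.le xe1).div_const _).const_mul _
    rw [zero_div, mul_zero] at this
    exact (this.eventually_le_const (by linarith)).exists
  have hp1 : κ * C * (xe ^ (p+1) / (1 - xe)) ≤ (1 - xE) / 2 := by
    refine le_trans ?_ hp
    have : xe ^ (p+1) ≤ xe ^ p := pow_le_pow_of_le_one xe0.le xe1.le (Nat.le_succ p)
    have h1 : 0 < 1 - xe := by linarith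
    gcongr
  obtain ⟨M, hMd⟩ : ∃ M, M = 2 * κ * C / (1 - xE) := ⟨_, rfl⟩
  have hM : 0 ≤ M := by rw [hMd]; exact div_nonneg (by positivity) (by linarith)
  obtain ⟨G, hGd⟩ : ∃ G, G = κ * (C + C * M * (xe ^ (p+1) / (1 - xe))) := ⟨_, rfl⟩
  have hMM : M * (1 - xE) = 2 * κ * C := by rw [hMd]; exact div_mul_cancel₀ _ (by linarith)
  have hq0 : 0 ≤ xe ^ (p+1) / (1 - xe) := div_nonneg (by positivity) (by linarith)
  have hG1 : 1 ≤ G := by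
    rw [hGd]
    have : 0 ≤ C * M * (xe ^ (p+1) / (1 - xe)) := by positivity
    nlinarith
  have hGM : G ≤ M * (1 - xE) := by
    have := mul_le_mul_of_nonneg_left hp1 hM
    rw [hGd]; nlinarith
  obtain ⟨η, hη, Hη⟩ : ∃ η > 0, ∀ u : List (Fin m), u.length < p + 1 → ap f u b = b ∨ η < |ap f u b - b| := by
    obtain ⟨r, hr, H⟩ := gapr ((fun u => ap f u b) '' {u : List (Fin m) | u.length < p + 1})
      ((List.finite_length_lt _ _).image _) b
    refine ⟨r / 2, by positivity, fun u hu => ?_⟩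
    by_cases h : ap f u b = b
    · exact Or.inl h
    · right; have := H _ (mem_image_of_mem _ hu) h; linarith
  have main : ∀ n : ℕ, ∀ Y, Tn J η Y → b ∈ Y → Tt f g κ b n Y ≤ M * exp (E * n) := by
    intro n
    induction n using Nat.strong_induction_on with
    | _ n IH =>
    intro Y hY hb
    have HR : ∀ n' ≤ n, ∀ Y, Tn J η Y → b ∈ Y → Rt f g κ b n' Y b ≤ G * exp (E * n') := by
      intro n' hn' Y hY hb
      cases n' with
      | zero => simpa [Rt] using hG1
      | succ n' =>
        refine (FHb hg0 hκ1 hρ1.le hl hJ A0 As hM n' p (fun i hi => IH i (by omega)) Y hY hb Hη).trans ?_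
        rw [hGd, mul_assoc]
        exact mul_le_mul_of_nonneg_left (Bt_bd hg0 A0 As hC hε hM hA _ _ _ hY.1) (by linarith)
    have h1 := LR hg0 hκ1 hκ hρ1.le hl hJ (by linarith) n HR Y hY b hb
    have h2 : ∑ j ∈ Finset.range n, exp (E * ((n:ℝ) - (j + 1))) * Nt f b (j+1) b ≤
        exp (E * n) * (xE ^ 1 / (1 - xE)) := by
      refine le_trans ?_ (mul_le_mul_of_nonneg_left (geom_sum_Ico_le_of_lt_one (m := 1) (n := n + 1) xE0.le xE1) (exp_pos _).le)
      rw [mul_sum, Finset.range_eq_Ico, ← Finset.sum_Ico_add' _ 0 n 1]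
      refine sum_le_sum (fun j _ => ?_)
      refine (mul_le_of_le_one_right (exp_pos _).le (Nt_le f b hu _)).trans (le_of_eq ?_)
      rw [hxE, ← exp_nat_mul, ← exp_add]; congr 1; push_cast; ring
    have h3 := HR n le_rfl Y hY hb
    calc Tt f g κ b n Y ≤ G * exp (E * n) + G * (exp (E * n) * (xE ^ 1 / (1 - xE))) := by
          refine h1.trans (add_le_add h3 (mul_le_mul_of_nonneg_left h2 (by linarith)))
      _ = G / (1 - xE) * exp (E * n) := by
          have : 1 - xE ≠ 0 := by linarith
          field_simp; ring
      _ ≤ _ := by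
          gcongr
          rw [div_le_iff₀ (by linarith)]; exact hGM
  obtain ⟨D1, hD1⟩ : ∃ D1, D1 = C + C * M * (xe ^ 0 / (1 - xe)) := ⟨_, rfl⟩
  have D1p : 1 ≤ D1 := by
    have : 0 ≤ xe ^ 0 / (1 - xe) := div_nonneg (by positivity) (by linarith)
    rw [hD1]; have : 0 ≤ C * M * (xe ^ 0 / (1 - xe)) := by positivity
    linarith
  have tiny : ∀ n : ℕ, ∀ Y, Tn J η Y → Tt f g κ b n Y ≤ D1 * exp (E * n) := fun n Y hY => by
    rw [hD1]
    exact (FH hg0 hρ1.le hl hJ A0 As hM n (fun n' _ => main n') Y hY).trans (Bt_bd hg0 A0 As hC hε hM hA _ _ _ hY.1)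
  have D00 : 0 ≤ D0 ∨ J = ∅ := by
    rcases J.eq_empty_or_nonempty with h | ⟨x, hx⟩
    · exact Or.inr h
    · left; simpa using hD x hx x hx
  have red : ∀ r : ℕ, ∀ δ : ℝ, ρ ^ r * δ ≤ η → ∀ n : ℕ, ∀ Y, Tn J δ Y → Tt f g κ b (n + r) Y ≤ m ^ r * (D1 * exp (E * n)) := by
    intro r
    induction r with
    | zero =>
      intro δ hδ n Y hY
      rw [pow_zero, one_mul] at *
      exact tiny n Y ⟨hY.1, fun x hx y hy => (hY.2 x hx y hy).trans hδ⟩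
    | succ r ih =>
      intro δ hδ n Y hY
      refine (Tt_step hg0 hκ1 hκ (n + r) Y).trans ((sum_le_sum (fun k _ => ih (ρ * δ) ?_ n _ ⟨(image_mono hY.1).trans (hJ k), ?_⟩)).trans ?_)
      · rwa [← mul_assoc, ← pow_succ]
      · rintro _ ⟨x, hx, rfl⟩ _ ⟨y, hy, rfl⟩
        exact (hl k x y).trans (mul_le_mul_of_nonneg_left (hY.2 x hx y hy) hρ0)
      · simp [pow_succ', mul_assoc]
  obtain ⟨r, hr⟩ : ∃ r : ℕ, ρ ^ r * D0 ≤ η := by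
    have : Tendsto (fun r : ℕ => ρ ^ r * D0) atTop (nhds (0 * D0)) :=
      (tendsto_pow_atTop_nhds_zero_of_lt_one hρ0 hρ1).mul_const _
    rw [zero_mul] at this
    exact (this.eventually_le_const hη).exists
  refine ⟨m ^ r * D1 + m ^ r + 1, by positivity, fun n => ?_⟩
  have hm0 : (0:ℝ) ≤ (m:ℝ) ^ r := by positivity
  rcases le_or_gt r n with h | h
  · obtain ⟨n, rfl⟩ := Nat.exists_eq_add_of_le' h
    refine (red r D0 hr n J ⟨subset_rfl, hD⟩).trans ?_
    have : exp (E * n) ≤ exp (E * (n + r : ℕ)) := by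
      gcongr; simp
    have h5 := exp_pos (E * (n + r : ℕ))
    calc _ ≤ (m:ℝ) ^ r * (D1 * exp (E * (n + r : ℕ))) := by gcongr
      _ ≤ _ := by nlinarith
  · refine (Tt_pow hg0 hκ1 hκ n J).trans ?_
    have e1 : 1 ≤ exp (E * n) := Real.one_le_exp (by positivity)
    rcases Nat.eq_zero_or_pos m with h0 | h0
    · have : (m:ℝ) ^ n ≤ 1 := pow_le_one₀ (by positivity) (by rw [h0]; simp)
      nlinarith [mul_nonneg hm0 (by linarith : 0 ≤ D1)]
    · have : (m:ℝ) ^ n ≤ m ^ r := pow_le_pow_right₀ (by exact_mod_cast h0) h.le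
      nlinarith [mul_nonneg hm0 (by linarith : 0 ≤ D1)]
end cpl3
section cpl4
variable {m : ℕ} {l : Fin m → ℕ} (F : CPLIFS m l) {ρM ρm t : ℝ} (h0 : 0 < ρm) (hmM : ρm ≤ ρM) (hM1 : ρM < 1)
  (hm : ∀ k i, ρm ≤ |F.ρ k i|) (hM : ∀ k i, |F.ρ k i| ≤ ρM) (ht : 0 < t)
def hB (w : List (Fin m)) (Y : Set ℝ) : ℕ := ∑ b ∈ (brk_fin F).toFinset, hb F b w Y
include h0 hmM hm in
lemma Tt_eq (κ b : ℝ) (n : ℕ) (Y : Set ℝ) : Tt F.f (fun k Y => sw F ρM k Y ^ t) κ b n Y =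
    SW m n (fun v => Lw F ρM v Y ^ t * κ ^ hb F b v Y) := by
  induction n generalizing Y with
  | zero => simp [Tt, SW_zero, Lw, hb]
  | succ n ih =>
    rw [Tt, SW_succ, mul_sum]
    refine sum_congr rfl (fun k _ => ?_)
    rw [ih, ← SW_mul, ← SW_mul]; congr 1; funext v
    rw [Lw, hb, mul_rpow (sw_pos F h0 hmM hm).le (Lw_pos F h0 hmM hm _ _).le]
    split_ifs
    · rw [pow_add, pow_one]; ring
    · rw [zero_add]; ring
open Classical in
include h0 hmM hm hM hM1 ht in
lemma rare (hesc : ESCfam (rr F) (tt F)) {J : Set ℝ} (hJ : ∀ k, F.f k '' J ⊆ J) {D0 : ℝ}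
    (hD : ∀ x ∈ J, ∀ y ∈ J, |x - y| ≤ D0) {a : ℝ} (ha : 0 < a)
    (hA : ∀ ε > 0, ∃ C > 0, ∀ n : ℕ, Aw F ρM t n J ≤ C * exp ((a + ε) * n)) {δ : ℝ} (hδ : 0 < δ) :
    ∀ᶠ N : ℕ in atTop, SW m N (fun w => if δ * N < hB F w J then Lw F ρM w J ^ t else 0) ≤ 1 / 2 * exp (a * N) := by
  have hρ0 : 0 < ρM := h0.trans_le hmM
  obtain ⟨κ, hκd⟩ : ∃ κ, κ = ρM ^ (-t) := ⟨_, rfl⟩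
  have κ1 : 1 < κ := by rw [hκd]; exact Real.one_lt_rpow_of_pos_of_lt_one_of_neg hρ0 hM1 (by linarith)
  have κs : ∀ k Y, κ * sw F ρM k Y ^ t ≤ 1 := fun k Y => by
    have : sw F ρM k Y ^ t ≤ ρM ^ t := rpow_le_rpow (sw_pos F h0 hmM hm).le (sw_le F hM) ht.le
    calc _ ≤ κ * ρM ^ t := by gcongr
      _ = 1 := by rw [hκd, ← Real.rpow_add hρ0]; simp
  set B := (brk_fin F).toFinset with hBd
  obtain ⟨δ', hδd⟩ : ∃ δ' : ℝ, δ' = δ / (B.card + 1) := ⟨_, rfl⟩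
  have hδ' : 0 < δ' := by rw [hδd]; positivity
  obtain ⟨θ, hθd⟩ : ∃ θ, θ = log κ := ⟨_, rfl⟩
  have hθ : 0 < θ := by rw [hθd]; exact Real.log_pos κ1
  have κe : κ = exp θ := by rw [hθd, Real.exp_log (by linarith)]
  have hε : 0 < θ * δ' / 4 := by positivity
  obtain ⟨C, hC, HC⟩ := hA _ hε
  have HT : ∀ b, ∃ D > 0, ∀ n : ℕ, Tt F.f (fun k Y => sw F ρM k Y ^ t) κ b n J ≤
      D * exp ((a + 2 * (θ * δ' / 4)) * n) := fun b =>
    hit_abs (A := Aw F ρM t) (fun k Y => rpow_pos_of_pos (sw_pos F h0 hmM hm) _) κ1.le κs (f_lip F hM) hJ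
      (Aw_zero F) (Aw_succ F h0 hmM hm) hρ0.le hM1 (uniq hesc b) ha hε hC
      (fun n Y hY => (Aw_mono F h0 hmM hm hM ht n hY).trans (HC n)) hD
  choose D hD0 HD using HT
  have tend : Tendsto (fun N : ℕ => (∑ b ∈ B, D b) * exp (-(θ * δ' / 2 * N))) atTop (nhds ((∑ b ∈ B, D b) * 0)) :=
    (Real.tendsto_exp_neg_atTop_nhds_zero.comp
      (tendsto_natCast_atTop_atTop.const_mul_atTop (by positivity))).const_mul _
  rw [mul_zero] at tend
  filter_upwards [tend.eventually_le_const (show (0:ℝ) < 1/2 by norm_num)] with N hN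
  have Lp : ∀ w, 0 ≤ Lw F ρM w J ^ t := fun w => (rpow_pos_of_pos (Lw_pos F h0 hmM hm _ _) _).le
  have pt : ∀ w : List (Fin m), (if δ * N < hB F w J then Lw F ρM w J ^ t else 0) ≤
      ∑ b ∈ B, exp (-(θ * δ' * N)) * (Lw F ρM w J ^ t * κ ^ hb F b w J) := by
    intro w
    have nn : ∀ b ∈ B, 0 ≤ exp (-(θ * δ' * N)) * (Lw F ρM w J ^ t * κ ^ hb F b w J) := fun b _ =>
      mul_nonneg (exp_pos _).le (mul_nonneg (Lp w) (pow_nonneg (by linarith) _))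
    split_ifs with h
    · obtain ⟨b, hb1, hb2⟩ : ∃ b ∈ B, δ' * N ≤ hb F b w J := by
        by_contra hcon
        push Not at hcon
        have : (hB F w J : ℝ) ≤ B.card • (δ' * N) := by
          unfold hB; push_cast
          exact Finset.sum_le_card_nsmul _ _ _ (fun b hb => (hcon b hb).le)
        rw [nsmul_eq_mul] at this
        have h3 : (B.card : ℝ) * (δ' * N) ≤ δ * N := by
          have : (B.card + 1 : ℝ) * δ' = δ := by rw [hδd, mul_comm]; exact div_mul_cancel₀ _ (Nat.cast_add_one_ne_zero _)
          rw [← this]; nlinarith [mul_nonneg hδ'.le (cast_nonneg (α := ℝ) N)]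
        linarith
      refine le_trans ?_ (single_le_sum nn hb1)
      have : exp (θ * δ' * N) ≤ κ ^ hb F b w J := by
        rw [κe, ← exp_nat_mul, Real.exp_le_exp]; nlinarith
      rw [Real.exp_neg, mul_left_comm]
      refine le_mul_of_one_le_right (Lp w) ?_
      rw [← div_eq_inv_mul, one_le_div (exp_pos _)]; exact this
    · exact sum_nonneg nn
  calc _ ≤ SW m N (fun w => ∑ b ∈ B, exp (-(θ * δ' * N)) * (Lw F ρM w J ^ t * κ ^ hb F b w J)) :=
        SW_mono (fun w _ => pt w)
    _ = ∑ b ∈ B, exp (-(θ * δ' * N)) * Tt F.f (fun k Y => sw F ρM k Y ^ t) κ b N J := by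
        simp only [Tt_eq F h0 hmM hm, SW, mul_sum]
        rw [sum_comm]
    _ ≤ ∑ b ∈ B, D b * (exp (-(θ * δ' / 2 * N)) * exp (a * N)) := by
        refine sum_le_sum (fun b _ => (mul_le_mul_of_nonneg_left (HD b N) (exp_pos _).le).trans (le_of_eq ?_))
        rw [mul_left_comm, ← exp_add, ← exp_add]; congr 2; ring
    _ ≤ _ := by
        rw [← sum_mul, ← mul_assoc]
        exact mul_le_mul_of_nonneg_right hN (exp_pos _).le
def cE : ℕ := 1 + (brk_fin F).toFinset.card + ∑ k, (l k + 1)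
open Classical in
include h0 hmM hm hM hM1 in
lemma brkE (w : List (Fin m)) (Y : Set ℝ) (hY : Y.OrdConnected) : ∃ E : Finset ℝ, E.card + 1 ≤ cE F ^ hB F w Y ∧
    ∀ K : Set ℝ, K.OrdConnected → K ⊆ Y → (∀ e ∈ E, e ∉ K) → ∃ q : List (CPLIFS.Idx m l), q.map Sigma.fst = w ∧
      (∀ x ∈ K, af F w x = aS F q x) ∧ Lw F ρM w Y * ρm ^ hB F w Y ≤ |(q.map (rr F)).prod| := by
  induction w generalizing Y with
  | nil => exact ⟨∅, by simp [hB, hb], fun K _ _ _ => ⟨[], rfl, fun x _ => rfl, by simp [Lw, hB, hb]⟩⟩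
  | cons k v ih =>
    have oc : ∀ K : Set ℝ, K.OrdConnected → (F.f k '' K).OrdConnected := fun K hK =>
      (hK.isPreconnected.image _ (F.hcont k).continuousOn).ordConnected
    obtain ⟨E, hE1, hE2⟩ := ih (F.f k '' Y) (oc Y hY)
    have ρ1 : ρm ≤ 1 := by linarith
    obtain ⟨s, hs⟩ : ∃ s, s = ∑ b ∈ (brk_fin F).toFinset, (if b ∈ Y then 1 else 0) := ⟨_, rfl⟩
    have hBe : hB F (k :: v) Y = s + hB F v (F.f k '' Y) := by
      rw [hs]; unfold hB; rw [← sum_add_distrib]; rfl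
    have c1 : 1 ≤ cE F := by unfold cE; omega
    have fin : ∀ K : Set ℝ, K.OrdConnected → K ⊆ Y → ∀ i, (∀ x ∈ K, F.f k x = F.ρ k i * x + F.t k i) →
        (∀ y ∈ E, (y - F.t k i) / F.ρ k i ∉ K) → sw F ρM k Y * ρm ^ s ≤ |F.ρ k i| →
        ∃ q : List (CPLIFS.Idx m l), q.map Sigma.fst = k :: v ∧
      (∀ x ∈ K, af F (k :: v) x = aS F q x) ∧ Lw F ρM (k :: v) Y * ρm ^ hB F (k :: v) Y ≤ |(q.map (rr F)).prod| := by
      intro K hK hKY i hi hd hsl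
      obtain ⟨q, hq1, hq2, hq3⟩ := hE2 (F.f k '' K) (oc K hK) (image_mono hKY) (by
        rintro e he ⟨x, hx, rfl⟩
        refine hd _ he ?_
        rw [hi x hx, add_sub_cancel_right, mul_div_cancel_left₀ _ (F.hρ0 k i)]; exact hx)
      refine ⟨⟨k, i⟩ :: q, by simp [hq1], fun x hx => ?_, ?_⟩
      · have := hq2 _ (mem_image_of_mem _ hx)
        change af F v (F.f k x) = aS F q (F.ρ k i * x + F.t k i)
        rw [this, hi x hx]
      · rw [hBe, pow_add, Lw, map_cons, prod_cons, abs_mul]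
        calc _ = (sw F ρM k Y * ρm ^ s) * (Lw F ρM v (F.f k '' Y) * ρm ^ hB F v (F.f k '' Y)) := by ring
          _ ≤ _ := mul_le_mul hsl hq3 (mul_nonneg (Lw_pos F h0 hmM hm _ _).le (pow_pos h0 _).le) (abs_nonneg _)
    by_cases hbr : ∃ b ∈ (brk_fin F).toFinset, b ∈ Y
    · obtain ⟨b, hb1, hb2⟩ := hbr
      have s1 : 1 ≤ s := by
        rw [hs]
        refine le_trans ?_ (single_le_sum (fun _ _ => Nat.zero_le _) hb1)
        simp [hb2]
      refine ⟨(brk_fin F).toFinset ∪ (Finset.univ ×ˢ E).image (fun p : Fin (l k + 1) × ℝ => (p.2 - F.t k p.1) / F.ρ k p.1),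
        ?_, fun K hK hKY hd => ?_⟩
      · have h1 := Finset.card_union_le (brk_fin F).toFinset
          ((Finset.univ ×ˢ E).image (fun p : Fin (l k + 1) × ℝ => (p.2 - F.t k p.1) / F.ρ k p.1))
        have h2 := card_image_le (s := Finset.univ ×ˢ E)
          (f := fun p : Fin (l k + 1) × ℝ => (p.2 - F.t k p.1) / F.ρ k p.1)
        rw [card_product, card_univ, card_fin] at h2
        have h3 : l k + 1 ≤ ∑ k, (l k + 1) := single_le_sum (f := fun k => l k + 1) (fun _ _ => Nat.zero_le _) (Finset.mem_univ k)
        calc _ ≤ (brk_fin F).toFinset.card + (l k + 1) * E.card + 1 := by omega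
          _ ≤ cE F * (E.card + 1) := by unfold cE; nlinarith
          _ ≤ cE F ^ s * cE F ^ hB F v (F.f k '' Y) := Nat.mul_le_mul (Nat.le_self_pow (by omega) _) hE1
          _ = _ := by rw [hBe, pow_add]
      · obtain ⟨i, hi⟩ := piece_oc F (k := k) hK (fun j hj => hd (F.b k j)
          (Finset.mem_union_left _ (by rw [Set.Finite.mem_toFinset]; exact mem_iUnion.2 ⟨k, j, rfl⟩)) hj)
        refine fin K hK hKY i hi (fun y hy => hd _ (Finset.mem_union_right _ (Finset.mem_image.2 ⟨(i, y), by simp [hy], rfl⟩))) ?_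
        have h1 : sw F ρM k Y ≤ 1 := (sw_le F hM).trans hM1.le
        have h2 : ρm ^ s ≤ ρm := pow_le_of_le_one h0.le ρ1 (by omega)
        calc _ ≤ ρm ^ s := mul_le_of_le_one_left (pow_pos h0 _).le h1
          _ ≤ _ := h2.trans (hm _ _)
    · push Not at hbr
      have s0 : s = 0 := by rw [hs]; exact Finset.sum_eq_zero (fun b hb => if_neg (hbr b hb))
      obtain ⟨i, hi⟩ := piece_oc F (k := k) hY (fun j hj => hbr (F.b k j)
          (by rw [Set.Finite.mem_toFinset]; exact mem_iUnion.2 ⟨k, j, rfl⟩) hj)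
      refine ⟨E.image (fun y => (y - F.t k i) / F.ρ k i), ?_, fun K hK hKY hd => ?_⟩
      · rw [hBe, s0, zero_add]
        exact (Nat.add_le_add_right card_image_le 1).trans hE1
      · refine fin K hK hKY i (fun x hx => hi x (hKY hx)) (fun y hy => hd _ (Finset.mem_image_of_mem _ hy)) ?_
        rw [s0, pow_zero, mul_one]; exact sw_le_piece F hi
end cpl4
section cpl5
variable {m : ℕ} {l : Fin m → ℕ} (F : CPLIFS m l)
def gdS (k : Fin m) (x r0 τ σ : ℝ) (qu : List (CPLIFS.Idx m l)) : Prop :=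
  (τ = 1 ∨ τ = -1) ∧ 0 < σ ∧ σ < 1 ∧ qu.map Sigma.fst = [k, k] ∧
    ∀ h ∈ Icc 0 r0, af F [k, k] (x + τ * h) = x + τ * (σ * h) ∧ aS F qu (x + τ * h) = x + τ * (σ * h)
lemma side1 (k : Fin m) (x r0 τ : ℝ) (hτ : τ = 1 ∨ τ = -1) (i i' : Fin (l k + 1))
    (h1 : ∀ h ∈ Icc 0 r0, F.f k (x + τ * h) = F.ρ k i * (x + τ * h) + F.t k i ∧ F.f k (x + τ * h) = x + τ * (F.ρ k i * h))
    (h2 : ∀ h ∈ Icc 0 r0, F.f k (x + -τ * h) = F.ρ k i' * (x + -τ * h) + F.t k i' ∧ F.f k (x + -τ * h) = x + -τ * (F.ρ k i' * h))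
    (hh : ℝ) (hh0 : 0 < hh) (hh1 : hh ≤ r0) :
    ∃ τ' σ qu, gdS F k x r0 τ' σ qu ∧ ∃ h3, 0 < h3 ∧ h3 ≤ hh ∧ af F [k, k] (x + τ * hh) = x + τ' * h3 := by
  have hτ' : -τ = 1 ∨ -τ = -1 := by rcases hτ with h | h <;> simp [h]
  have a1 := abs_lt.1 (F.hρ1 k i)
  have a2 := abs_lt.1 (F.hρ1 k i')
  obtain ⟨p, hp⟩ : ∃ p, p = F.ρ k i := ⟨_, rfl⟩
  obtain ⟨q, hq⟩ : ∃ q, q = F.ρ k i' := ⟨_, rfl⟩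
  rw [← hp] at a1 h1; rw [← hq] at a2 h2
  have p0 : p ≠ 0 := hp ▸ F.hρ0 k i
  have q0 : q ≠ 0 := hq ▸ F.hρ0 k i'
  have aSe : ∀ (j j' : Fin (l k + 1)) (y : ℝ), aS F [⟨k, j⟩, ⟨k, j'⟩] y = F.ρ k j' * (F.ρ k j * y + F.t k j) + F.t k j' :=
    fun _ _ _ => rfl
  have afe : ∀ y, af F [k, k] y = F.f k (F.f k y) := fun _ => rfl
  have sgl : ∀ (σ0 : ℝ) (i0 : Fin (l k + 1)) (p : ℝ), p = F.ρ k i0 → 0 < p → p < 1 → (σ0 = 1 ∨ σ0 = -1) →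
      (∀ h ∈ Icc 0 r0, F.f k (x + σ0 * h) = p * (x + σ0 * h) + F.t k i0 ∧ F.f k (x + σ0 * h) = x + σ0 * (p * h)) →
      gdS F k x r0 σ0 (p * p) [⟨k, i0⟩, ⟨k, i0⟩] := by
    intro σ0 i0 p hp hpos p1 hσ H
    refine ⟨hσ, by positivity, by nlinarith, rfl, fun h hr => ?_⟩
    have e1 := H h hr
    have e2 := H (p * h) ⟨mul_nonneg hpos.le hr.1, by nlinarith [hr.1, hr.2]⟩
    rw [aSe, afe, ← hp, ← e1.1, e1.2, ← e2.1, e2.2]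
    constructor <;> ring
  rcases lt_or_gt_of_ne p0 with pn | pp
  · rcases lt_or_gt_of_ne q0 with qn | qp
    · refine ⟨τ, p * q, [⟨k, i⟩, ⟨k, i'⟩], ⟨hτ, mul_pos_of_neg_of_neg pn qn, by nlinarith [mul_pos (neg_pos.2 pn) (by linarith : 0 < 1 + q)], rfl, fun h hr => ?_⟩, p * q * hh,
        mul_pos (mul_pos_of_neg_of_neg pn qn) hh0,
        mul_le_of_le_one_left hh0.le (by nlinarith [mul_pos (neg_pos.2 pn) (by linarith : 0 < 1 + q)]), ?_⟩
      · have e1 := h1 h hr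
        have e2 := h2 (-p * h) ⟨mul_nonneg (by linarith) hr.1, by nlinarith [hr.1, hr.2]⟩
        rw [show x + -τ * (-p * h) = x + τ * (p * h) by ring] at e2
        rw [aSe, afe, ← hp, ← hq, ← e1.1, e1.2, ← e2.1, e2.2]
        constructor <;> ring
      · have e1 := h1 hh ⟨hh0.le, hh1⟩
        have e2 := h2 (-p * hh) ⟨mul_nonneg (by linarith) hh0.le, by nlinarith⟩
        rw [show x + -τ * (-p * hh) = x + τ * (p * hh) by ring] at e2
        rw [afe, e1.2, e2.2]; ring
    · refine ⟨-τ, q * q, _, sgl (-τ) i' q hq qp a2.2 hτ' h2, q * (-p * hh), mul_pos qp (mul_pos (by linarith) hh0), ?_, ?_⟩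
      · have : -p * hh ≤ hh := by nlinarith
        have h5 : 0 < -p * hh := mul_pos (by linarith) hh0
        nlinarith
      · have e1 := h1 hh ⟨hh0.le, hh1⟩
        have e2 := h2 (-p * hh) ⟨mul_nonneg (by linarith) hh0.le, by nlinarith⟩
        rw [show x + -τ * (-p * hh) = x + τ * (p * hh) by ring] at e2
        rw [afe, e1.2, e2.2]
  · refine ⟨τ, p * p, _, sgl τ i p hp pp a1.2 hτ h1, p * (p * hh), by positivity, ?_, ?_⟩
    · have : p * hh ≤ hh := by nlinarith
      have h5 : 0 < p * hh := mul_pos (by linarith) hh0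
      nlinarith
    · have e1 := h1 hh ⟨hh0.le, hh1⟩
      have e2 := h1 (p * hh) ⟨mul_nonneg (by linarith) hh0.le, by nlinarith⟩
      rw [afe, e1.2, e2.2]
lemma sideA (k : Fin m) (x : ℝ) (hx : F.f k x = x) : ∃ r0 > 0, ∀ y, y ≠ x → |y - x| ≤ r0 →
    ∃ τ' σ qu, gdS F k x r0 τ' σ qu ∧ ∃ h3, 0 < h3 ∧ h3 ≤ |y - x| ∧ af F [k, k] y = x + τ' * h3 := by
  obtain ⟨r1, hr1, i, H1⟩ := side_piece F k x (τ := 1) (Or.inl rfl)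
  obtain ⟨r2, hr2, i', H2⟩ := side_piece F k x (τ := -1) (Or.inr rfl)
  have e1 := H1 0 ⟨le_rfl, hr1.le⟩
  have e2 := H2 0 ⟨le_rfl, hr2.le⟩
  simp only [mul_zero, add_zero, hx] at e1 e2
  refine ⟨min r1 r2, lt_min hr1 hr2, fun y hy hyr => ?_⟩
  have A : ∀ h ∈ Icc 0 (min r1 r2), F.f k (x + 1 * h) = F.ρ k i * (x + 1 * h) + F.t k i ∧
      F.f k (x + 1 * h) = x + 1 * (F.ρ k i * h) := fun h hh => by
    have := H1 h ⟨hh.1, hh.2.trans (min_le_left _ _)⟩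
    exact ⟨this, by rw [this]; linarith⟩
  have B : ∀ h ∈ Icc 0 (min r1 r2), F.f k (x + -1 * h) = F.ρ k i' * (x + -1 * h) + F.t k i' ∧
      F.f k (x + -1 * h) = x + -1 * (F.ρ k i' * h) := fun h hh => by
    have := H2 h ⟨hh.1, hh.2.trans (min_le_right _ _)⟩
    exact ⟨this, by rw [this]; linarith⟩
  rcases lt_or_gt_of_ne hy with h | h
  · rw [abs_of_neg (sub_neg.2 h)] at hyr ⊢
    have := side1 F k x _ (-1) (Or.inr rfl) i' i B (by rw [neg_neg]; exact A) (-(y - x)) (by linarith) hyr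
    rwa [show x + -1 * -(y - x) = y by ring] at this
  · rw [abs_of_pos (sub_pos.2 h)] at hyr ⊢
    have := side1 F k x _ 1 (Or.inl rfl) i i' A B (y - x) (by linarith) hyr
    rwa [show x + 1 * (y - x) = y by ring] at this
variable {F} in
lemma gd_iter {k : Fin m} {x r0 τ σ : ℝ} {qu : List (CPLIFS.Idx m l)} (H : gdS F k x r0 τ σ qu) (j : ℕ) :
    ∃ q : List (CPLIFS.Idx m l), q.map Sigma.fst = replicate (2 * j) k ∧ ∀ h ∈ Icc 0 r0,
      af F (replicate (2 * j) k) (x + τ * h) = x + τ * (σ ^ j * h) ∧ aS F q (x + τ * h) = x + τ * (σ ^ j * h) := by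
  obtain ⟨hτ, s0, s1, hq, H⟩ := H
  induction j with
  | zero => exact ⟨[], rfl, fun h _ => by simp [af, aS, ap]⟩
  | succ j ih =>
    obtain ⟨q, hq1, hq2⟩ := ih
    have rep : replicate (2 * (j + 1)) k = [k, k] ++ replicate (2 * j) k := rfl
    refine ⟨qu ++ q, by rw [map_append, hq, hq1, rep], fun h hh => ?_⟩
    have h1 := H h hh
    have h2 := hq2 (σ * h) ⟨mul_nonneg s0.le hh.1, by nlinarith [hh.1, hh.2]⟩
    rw [rep, af, aS, ap_append, ap_append]
    change af F _ (af F _ _) = _ ∧ aS F q (aS F qu _) = _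
    rw [h1.1, h1.2, h2.1, h2.2, pow_succ]
    constructor <;> ring
variable {F}
theorem base (hesc : ESCfam (rr F) (tt F)) {k0 k1 : Fin m} (hk : k0 ≠ k1) {x : ℝ} (hx : F.f k0 x = x) :
    ∃ Q : Set ℝ, Q.OrdConnected ∧ x ∈ Q ∧ Q ⊆ Icc (x - 1) (x + 1) ∧ ∃ (n1 : ℕ) (U : Bool → List (Fin m))
      (q : Bool → List (CPLIFS.Idx m l)), (∀ i, (q i).map Sigma.fst = U i ∧ (U i).length = n1 ∧
        ∀ y ∈ Q, af F (U i) y = aS F (q i) y ∧ af F (U i) y ∈ Q) ∧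
      (∀ y ∈ Q, ∀ y' ∈ Q, af F (U true) y ≠ af F (U false) y') ∧
      ∀ D : ℝ, ∃ Y0 : List (Fin m), ∀ y, |y - x| ≤ D → af F Y0 y ∈ Q := by
  obtain ⟨ρm, ρM, h0, hmM, hM1, hb⟩ := slope_bds F
  have hM := fun k i => (hb k i).2
  have hρ0 : 0 < ρM := h0.trans_le hmM
  have tz : ∀ c : ℝ, Tendsto (fun n : ℕ => ρM ^ n * c) atTop (nhds 0) := fun c => by
    simpa using (tendsto_pow_atTop_nhds_zero_of_lt_one hρ0.le hM1).mul_const c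
  obtain ⟨r0, hr0, HA⟩ := sideA F k0 x hx
  have fix : ∀ n, af F (replicate n k0) x = x := fun n => by
    induction n with
    | zero => rfl
    | succ n ih => change af F (replicate n k0) (F.f k0 x) = x; rw [hx, ih]
  obtain ⟨y, hyd⟩ : ∃ y : ℕ → ℝ, ∀ n, y n = af F ([k1, k1] ++ replicate (2 * n) k0) x := ⟨_, fun _ => rfl⟩
  have yne : ∀ n, y n ≠ x := fun n h => by
    rw [hyd] at h
    have := uniq hesc x _ (replicate (2 * n + 2) k0) (by simp) h (fix _)
    rw [replicate_succ, cons_append] at this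
    exact hk (List.cons.inj this).1.symm
  have ysucc : ∀ n, y (n+1) = af F [k0, k0] (y n) := fun n => by
    rw [hyd, hyd, af, ← ap_append, List.append_assoc]
    congr 2
    rw [show 2 * (n + 1) = 2 * n + 2 by ring, List.replicate_add]; rfl
  obtain ⟨K0, hK0⟩ : ∃ K0, |y K0 - x| ≤ r0 / 2 := by
    obtain ⟨n, hn⟩ := ((tz |af F [k1, k1] x - x|).eventually_le_const (show 0 < r0 / 2 by positivity)).exists
    refine ⟨n, ?_⟩
    have := ap_lip F hρ0.le hM (replicate (2 * n) k0) (af F [k1, k1] x) x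
    rw [fix, af, ← ap_append, length_replicate] at this
    rw [hyd]
    refine this.trans (le_trans ?_ hn)
    exact mul_le_mul_of_nonneg_right (pow_le_pow_of_le_one hρ0.le hM1.le (by omega)) (abs_nonneg _)
  obtain ⟨τ, σ, qu, hgd, hh, hh0, hh1, hhe⟩ := HA (y K0) (yne K0) (by linarith)
  have hτ := hgd.1
  have s0 := hgd.2.1
  have s1 := hgd.2.2.1
  have hττ : τ * τ = 1 := by rcases hτ with h | h <;> rw [h] <;> norm_num
  obtain ⟨V, hV⟩ : ∃ V, V = [k1, k1] ++ replicate (2 * (K0 + 1)) k0 := ⟨_, rfl⟩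
  have Vx : af F V x = x + τ * hh := by rw [hV, ← hyd, ysucc, hhe]
  obtain ⟨r1, hr1, qV, hqV, HV⟩ := side_word F V x hτ
  obtain ⟨s, hs⟩ : ∃ s, s = (qV.map (rr F)).prod := ⟨_, rfl⟩
  have HVe : ∀ h ∈ Icc 0 r1, af F V (x + τ * h) = x + τ * (hh + s * h) := fun h hr => by
    have e0 := HV 0 ⟨le_rfl, hr1.le⟩
    rw [mul_zero, add_zero, Vx] at e0
    have := ap_aff (rr F) (tt F) qV (x + τ * h) x
    rw [HV h hr, hs]
    change _ = aS F qV _ at e0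
    change aS F qV _ - aS F qV _ = _ at this
    linear_combination this - e0
  have sl : ∀ h ∈ Icc 0 r1, |s * h| ≤ h := fun h hr => by
    have := ap_lip F hρ0.le hM V (x + τ * h) x
    change |af F V _ - af F V _| ≤ _ at this
    rw [HVe h hr, Vx, show x + τ * (hh + s * h) - (x + τ * hh) = τ * (s * h) by ring, add_sub_cancel_left,
      abs_mul, abs_mul τ h, abs_of_nonneg hr.1] at this
    have t1 : |τ| = 1 := by rcases hτ with h | h <;> simp [h]
    rw [t1, one_mul, one_mul] at this
    exact this.trans (mul_le_of_le_one_left hr.1 (pow_le_one₀ hρ0.le hM1.le))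
  obtain ⟨r, hr, rr1, rh, r11⟩ : ∃ r > 0, r ≤ r1 ∧ r ≤ hh / 2 ∧ r ≤ 1 :=
    ⟨min r1 (min (hh / 2) 1), by positivity, min_le_left _ _, (min_le_right _ _).trans (min_le_left _ _),
      (min_le_right _ _).trans (min_le_right _ _)⟩
  have slr : ∀ h ∈ Icc 0 r, hh + s * h ∈ Icc (hh / 2) (3 * hh / 2) := fun h hr' => by
    have := abs_le.1 (sl h ⟨hr'.1, hr'.2.trans rr1⟩)
    have := hr'.2
    constructor <;> linarith
  obtain ⟨j, hj⟩ : ∃ j : ℕ, σ ^ j * (3 * hh / 2) < r := by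
    have : Tendsto (fun j : ℕ => σ ^ j * (3 * hh / 2)) atTop (nhds (0 * (3 * hh / 2))) :=
      (tendsto_pow_atTop_nhds_zero_of_lt_one s0.le s1).mul_const _
    rw [zero_mul] at this
    exact (this.eventually_lt_const hr).exists
  have sj : 0 < σ ^ j := pow_pos s0 j
  obtain ⟨qj, hqj, Hj⟩ := gd_iter hgd j
  obtain ⟨q0, hq0, H0⟩ := gd_iter hgd (K0 + 2 + j)
  set Q : Set ℝ := {y | ∃ h ∈ Icc 0 r, y = x + τ * h} with hQ
  have QI : Q.OrdConnected := by
    rcases hτ with h | h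
    · have : Q = Icc x (x + r) := by
        ext y; constructor
        · rintro ⟨h', ⟨h1, h2⟩, rfl⟩; rw [h]; constructor <;> linarith
        · rintro ⟨h1, h2⟩; exact ⟨y - x, ⟨by linarith, by linarith⟩, by rw [h]; ring⟩
      rw [this]; exact ordConnected_Icc
    · have : Q = Icc (x - r) x := by
        ext y; constructor
        · rintro ⟨h', ⟨h1, h2⟩, rfl⟩; rw [h]; constructor <;> linarith
        · rintro ⟨h1, h2⟩; exact ⟨x - y, ⟨by linarith, by linarith⟩, by rw [h]; ring⟩
      rw [this]; exact ordConnected_Icc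
  have E1 : ∀ h ∈ Icc 0 r, af F (V ++ replicate (2 * j) k0) (x + τ * h) = x + τ * (σ ^ j * (hh + s * h)) ∧
      aS F (qV ++ qj) (x + τ * h) = x + τ * (σ ^ j * (hh + s * h)) := fun h hr' => by
    have h1 : h ∈ Icc 0 r1 := ⟨hr'.1, hr'.2.trans rr1⟩
    have h2 := slr h hr'
    have h3 := Hj (hh + s * h) ⟨by linarith [h2.1], by linarith [h2.2]⟩
    have h4 := HV h h1
    have h5 := HVe h h1
    rw [af, aS, ap_append, ap_append]
    change af F _ (af F V _) = _ ∧ aS F qj (aS F qV _) = _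
    rw [← h4, h5]; exact h3
  have E0 : ∀ h ∈ Icc 0 r, af F (replicate (2 * (K0 + 2 + j)) k0) (x + τ * h) = x + τ * (σ ^ (K0 + 2 + j) * h) ∧
      aS F q0 (x + τ * h) = x + τ * (σ ^ (K0 + 2 + j) * h) := fun h hr' =>
    H0 h ⟨hr'.1, by linarith [hr'.2]⟩
  have slj : ∀ h ∈ Icc 0 r, σ ^ j * (hh + s * h) ∈ Icc (σ ^ j * (hh / 2)) (σ ^ j * (3 * hh / 2)) := fun h hr' =>
    ⟨mul_le_mul_of_nonneg_left (slr h hr').1 sj.le, mul_le_mul_of_nonneg_left (slr h hr').2 sj.le⟩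
  have sj0 : 0 < σ ^ j * (hh / 2) := by positivity
  have M1 : ∀ y ∈ Q, af F (V ++ replicate (2 * j) k0) y ∈ Q := by
    rintro _ ⟨h, hr', rfl⟩
    rw [(E1 h hr').1]
    exact ⟨_, ⟨sj0.le.trans (slj h hr').1, (slj h hr').2.trans hj.le⟩, rfl⟩
  have p1 : σ ^ (K0 + 2 + j) < σ ^ j := pow_lt_pow_right_of_lt_one₀ s0 s1 (by omega)
  refine ⟨Q, QI, ⟨0, ⟨le_rfl, hr.le⟩, by simp⟩, ?_, 2 * (K0 + 2 + j),
    fun i => if i then V ++ replicate (2 * j) k0 else replicate (2 * (K0 + 2 + j)) k0,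
    fun i => if i then qV ++ qj else q0, ?_, ?_, ?_⟩
  · rintro _ ⟨h, ⟨h1, h2⟩, rfl⟩
    rcases hτ with h | h <;> rw [h] <;> constructor <;> linarith
  · intro i
    cases i
    · refine ⟨by simpa using hq0, by simp, ?_⟩
      rintro _ ⟨h, hr', rfl⟩
      simp only [Bool.false_eq_true, if_false]
      rw [(E0 h hr').1, (E0 h hr').2]
      exact ⟨rfl, _, ⟨mul_nonneg (pow_pos s0 _).le hr'.1,
        (mul_le_of_le_one_left hr'.1 (pow_le_one₀ s0.le s1.le)).trans hr'.2⟩, rfl⟩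
    · refine ⟨by simp [hqV, hqj], by simp [hV]; omega, fun y hy => ⟨?_, by simpa using M1 y hy⟩⟩
      obtain ⟨h, hr', rfl⟩ := hy
      simp only [if_true]
      rw [(E1 h hr').1, (E1 h hr').2]
  · rintro _ ⟨h, hr', rfl⟩ _ ⟨h', hr'', rfl⟩ heq
    simp only [Bool.false_eq_true, if_false, if_true] at heq
    rw [(E1 h hr').1, (E0 h' hr'').1] at heq
    have e2 : σ ^ j * (hh + s * h) = σ ^ (K0 + 2 + j) * h' := by
      have e3 : τ * (σ ^ j * (hh + s * h)) = τ * (σ ^ (K0 + 2 + j) * h') := by linarith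
      have := congrArg (fun z => τ * z) e3
      simp only [← mul_assoc, hττ, one_mul] at this
      simpa [mul_assoc] using this
    have e3 := (slj h hr').1
    rw [e2] at e3
    have e4 : σ ^ (K0 + 2 + j) * h' ≤ σ ^ (K0 + 2 + j) * (hh / 2) :=
      mul_le_mul_of_nonneg_left (hr''.2.trans rh) (pow_pos s0 _).le
    nlinarith
  · intro D
    obtain ⟨e, he, ea, eb⟩ : ∃ e > 0, e ≤ σ ^ j * (hh / 2) ∧ e ≤ r - σ ^ j * (3 * hh / 2) :=
      ⟨min (σ ^ j * (hh / 2)) (r - σ ^ j * (3 * hh / 2)), lt_min sj0 (by linarith), min_le_left _ _, min_le_right _ _⟩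
    obtain ⟨n, hn⟩ := ((tz D).eventually_le_const he).exists
    obtain ⟨U, hU⟩ : ∃ U, U = V ++ replicate (2 * j) k0 := ⟨_, rfl⟩
    rw [← hU] at E1 M1
    have itQ : ∀ n : ℕ, af F (replicate n U).flatten x ∈ Q := fun n => by
      suffices ∀ y ∈ Q, af F (replicate n U).flatten y ∈ Q from this x ⟨0, ⟨le_rfl, hr.le⟩, by simp⟩
      induction n with
      | zero => intro y hy; exact hy
      | succ n ih => intro y hy; rw [replicate_succ, List.flatten_cons, af, ap_append]; exact ih _ (M1 y hy)
    refine ⟨(replicate n U).flatten ++ U, fun z hz => ?_⟩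
    obtain ⟨h, hr', hhe'⟩ := itQ n
    have e1 := ap_lip F hρ0.le hM ((replicate n U).flatten ++ U) z x
    change |af F _ _ - af F _ _| ≤ _ at e1
    have e2 : af F ((replicate n U).flatten ++ U) x = x + τ * (σ ^ j * (hh + s * h)) := by
      rw [af, ap_append]; change af F U (af F _ x) = _; rw [hhe', (E1 h hr').1]
    have len : n ≤ ((replicate n U).flatten ++ U).length := by
      have : 1 ≤ U.length := by rw [hU, hV]; simp
      simp; nlinarith
    have e3 : |af F ((replicate n U).flatten ++ U) z - af F ((replicate n U).flatten ++ U) x| ≤ e := by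
      refine e1.trans (le_trans ?_ hn)
      exact mul_le_mul (pow_le_pow_of_le_one hρ0.le hM1.le len) hz (abs_nonneg _) (pow_pos hρ0 _).le
    rw [e2] at e3
    obtain ⟨Z, hZ⟩ : ∃ Z, Z = af F ((replicate n U).flatten ++ U) z := ⟨_, rfl⟩
    rw [← hZ] at e3 ⊢
    have e4 := slj h hr'
    have e5 := abs_le.1 e3
    refine ⟨τ * (Z - x), ?_, by rw [← mul_assoc, hττ]; ring⟩
    rcases hτ with h | h <;> rw [h] at e5 ⊢ <;> constructor <;> linarith [e4.1, e4.2]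
end cpl5
section cpl6
variable {m : ℕ} {l : Fin m → ℕ} {F : CPLIFS m l}
lemma aS_ne {q : List (CPLIFS.Idx m l)} {y y' : ℝ} (h : aS F q y = aS F q y') : y = y' := by
  have := ap_aff (rr F) (tt F) q y y'
  change aS F q y - aS F q y' = _ at this
  rw [h, sub_self] at this
  rcases mul_eq_zero.1 this.symm with h1 | h1
  · exfalso
    rw [List.prod_eq_zero_iff, List.mem_map] at h1
    obtain ⟨p, -, hp⟩ := h1
    exact F.hρ0 p.1 p.2 hp
  · linarith
open Classical in
lemma pig {Q : Set ℝ} {n1 : ℕ} {U : Bool → List (Fin m)} {q : Bool → List (CPLIFS.Idx m l)}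
    (H : ∀ i, (q i).map Sigma.fst = U i ∧ (U i).length = n1 ∧ ∀ y ∈ Q, af F (U i) y = aS F (q i) y ∧ af F (U i) y ∈ Q)
    (Hd : ∀ y ∈ Q, ∀ y' ∈ Q, af F (U true) y ≠ af F (U false) y') (j : ℕ) (E : Finset ℝ) (hE : E.card < 2 ^ j) :
    ∃ (z : List (Fin m)) (qz : List (CPLIFS.Idx m l)), qz.map Sigma.fst = z ∧ z.length = j * n1 ∧
      (∀ y ∈ Q, af F z y = aS F qz y ∧ af F z y ∈ Q) ∧ ∀ y ∈ Q, af F z y ∉ E := by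
  induction j generalizing E with
  | zero =>
    refine ⟨[], [], rfl, by simp, fun y hy => ⟨rfl, hy⟩, fun y _ => ?_⟩
    have : E = ∅ := by simpa using hE
    simp [this]
  | succ j ih =>
    obtain ⟨i, hi⟩ : ∃ i : Bool, (E.filter (fun e => e ∈ af F (U i) '' Q)).card < 2 ^ j := by
      by_contra hcon
      push Not at hcon
      have h1 := hcon true
      have h2 := hcon false
      have h3 : Disjoint (E.filter (fun e => e ∈ af F (U true) '' Q)) (E.filter (fun e => e ∈ af F (U false) '' Q)) := by
        rw [Finset.disjoint_left]
        intro e he he'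
        obtain ⟨y, hy, rfl⟩ := (mem_filter.1 he).2
        obtain ⟨y', hy', h⟩ := (mem_filter.1 he').2
        exact Hd y hy y' hy' h.symm
      have h4 := Finset.card_le_card (Finset.union_subset (Finset.filter_subset (fun e => e ∈ af F (U true) '' Q) E)
        (Finset.filter_subset (fun e => e ∈ af F (U false) '' Q) E))
      rw [Finset.card_union_of_disjoint h3] at h4
      rw [pow_succ] at hE
      omega
    obtain ⟨z, qz, hz1, hz2, hz3, hz4⟩ := ih ((E.filter (fun e => e ∈ af F (U i) '' Q)).image (Function.invFunOn (af F (U i)) Q))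
      (card_image_le.trans_lt hi)
    obtain ⟨hi1, hi2, hi3⟩ := H i
    have afe : ∀ y, af F (z ++ U i) y = af F (U i) (af F z y) := fun y => ap_append _ _ _ _
    refine ⟨z ++ U i, qz ++ q i, by rw [map_append, hz1, hi1], by rw [length_append, hz2, hi2]; ring,
      fun y hy => ?_, fun y hy hmem => ?_⟩
    · rw [afe, aS, ap_append]
      refine ⟨?_, (hi3 _ (hz3 y hy).2).2⟩
      rw [(hi3 _ (hz3 y hy).2).1, (hz3 y hy).1]
    · rw [afe] at hmem
      have him : af F (U i) (af F z y) ∈ af F (U i) '' Q := mem_image_of_mem _ (hz3 y hy).2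
      have e1 := Function.invFunOn_eq him
      have e2 := Function.invFunOn_mem him
      rw [(hi3 _ e2).1, (hi3 _ (hz3 y hy).2).1] at e1
      refine hz4 y hy (Finset.mem_image.2 ⟨_, mem_filter.2 ⟨hmem, him⟩, ?_⟩)
      have := aS_ne e1
      rw [(hi3 _ (hz3 y hy).2).1]
      exact this
variable {ρM ρm t : ℝ} (h0 : 0 < ρm) (hmM : ρm ≤ ρM) (hM1 : ρM < 1)
  (hm : ∀ k i, ρm ≤ |F.ρ k i|) (hM : ∀ k i, |F.ρ k i| ≤ ρM) (ht : 0 < t)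
lemma hb_le (b : ℝ) (v : List (Fin m)) (Y : Set ℝ) : hb F b v Y ≤ v.length := by
  induction v generalizing Y with
  | nil => simp [hb]
  | cons k v ih => rw [hb, length_cons]; have := ih (F.f k '' Y); split_ifs <;> omega
lemma hb_app (b : ℝ) (w v : List (Fin m)) (Y : Set ℝ) : hb F b (w ++ v) Y ≤ hb F b w Y + v.length := by
  induction w generalizing Y with
  | nil => simpa [hb] using hb_le b v Y
  | cons k w ih => rw [cons_append, hb, hb, add_assoc]; exact Nat.add_le_add_left (ih _) _
lemma hB_app (w v : List (Fin m)) (Y : Set ℝ) :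
    hB F (w ++ v) Y ≤ hB F w Y + (brk_fin F).toFinset.card * v.length := by
  unfold hB
  calc _ ≤ ∑ b ∈ (brk_fin F).toFinset, (hb F b w Y + v.length) := sum_le_sum (fun b _ => hb_app b w v Y)
    _ = _ := by rw [sum_add_distrib, sum_const, smul_eq_mul]
include h0 hmM hm in
lemma Lw_app (w v : List (Fin m)) (Y : Set ℝ) : Lw F ρM w Y * ρm ^ v.length ≤ Lw F ρM (w ++ v) Y := by
  induction w generalizing Y with
  | nil => simpa [Lw] using Lw_ge F h0 hmM hm v Y
  | cons k w ih =>
    rw [cons_append, Lw, Lw, mul_assoc]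
    exact mul_le_mul_of_nonneg_left (ih _) (sw_pos F h0 hmM hm).le
include h0 hm in
lemma prod_ge (q : List (CPLIFS.Idx m l)) : ρm ^ q.length ≤ |(q.map (rr F)).prod| := by
  induction q with
  | nil => simp
  | cons p q ih =>
    rw [map_cons, prod_cons, abs_mul, length_cons, pow_succ']
    exact mul_le_mul (hm _ _) ih (pow_pos h0 _).le (abs_nonneg _)
open Classical in
include h0 hmM hm hM hM1 ht in
theorem lower (hesc : ESCfam (rr F) (tt F)) (ht1 : t ≤ 1) {J : Set ℝ} (hJ : ∀ k, F.f k '' J ⊆ J) (hJo : J.OrdConnected)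
    {D0 : ℝ} (hD : ∀ x ∈ J, ∀ y ∈ J, |x - y| ≤ D0) {a : ℝ} (ha : 0 < a)
    (hlow : ∀ n : ℕ, exp (a * n) ≤ Aw F ρM t n J)
    (hA : ∀ ε > 0, ∃ C > 0, ∀ n : ℕ, Aw F ρM t n J ≤ C * exp ((a + ε) * n))
    {k0 k1 : Fin m} (hk : k0 ≠ k1) {x : ℝ} (hx : F.f k0 x = x) (hxJ : Icc (x - 1) (x + 1) ⊆ J)
    {Λ : Set ℝ} (hΛ : IsClosed Λ) (hxΛ : x ∈ Λ) (hinv : ∀ k, ∀ y ∈ Λ, F.f k y ∈ Λ) :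
    ofReal t ≤ dimH Λ := by
  obtain ⟨Q, QI, xQ, QJ1, n1, U, qU, HU, Hd, HY⟩ := base hesc hk hx
  have QJ := QJ1.trans hxJ
  obtain ⟨Y0, hY0⟩ := HY D0
  have hY0J : ∀ y ∈ J, af F Y0 y ∈ Q := fun y hy => hY0 y (hD y hy x (QJ xQ))
  have afJ : ∀ (w : List (Fin m)), ∀ y ∈ J, af F w y ∈ J := fun w => by
    induction w with
    | nil => exact fun y hy => hy
    | cons k w ih => exact fun y hy => ih _ (hJ k (mem_image_of_mem _ hy))
  have afΛ : ∀ (w : List (Fin m)), ∀ y ∈ Λ, af F w y ∈ Λ := fun w => by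
    induction w with
    | nil => exact fun y hy => hy
    | cons k w ih => exact fun y hy => ih _ (hinv k y hy)
  obtain ⟨d, hd⟩ : ∃ d, cE F ≤ 2 ^ d := ⟨cE F, Nat.lt_two_pow_self.le⟩
  obtain ⟨B0, hB0⟩ : ∃ B0, B0 = (brk_fin F).toFinset.card * Y0.length := ⟨_, rfl⟩
  have ρ1 : ρm < 1 := by linarith
  obtain ⟨lam, hlam⟩ : ∃ lam, lam = -log ρm := ⟨_, rfl⟩
  have lam0 : 0 < lam := by rw [hlam]; have := log_neg h0 ρ1; linarith
  have ρe : ρm = exp (-lam) := by rw [hlam, neg_neg, Real.exp_log h0]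
  obtain ⟨c1, hc1⟩ : ∃ c1 : ℝ, c1 = d * n1 + 1 := ⟨_, rfl⟩
  have c10 : 0 < c1 := by rw [hc1]; positivity
  obtain ⟨δ, hδd⟩ : ∃ δ, δ = a / (2 * (lam * t * c1)) := ⟨_, rfl⟩
  have hδ : 0 < δ := by rw [hδd]; positivity
  have hδ2 : lam * t * c1 * δ = a / 2 := by rw [hδd]; field_simp
  obtain ⟨cst, hcst⟩ : ∃ cst : ℝ, cst = lam * t * (B0 * c1 + Y0.length) := ⟨_, rfl⟩
  have ev : ∀ᶠ N : ℕ in atTop, cst + 1 ≤ a / 2 * N :=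
    (tendsto_natCast_atTop_atTop.const_mul_atTop (by positivity)).eventually_ge_atTop _
  obtain ⟨N, hN1, hN2, hN3⟩ := ((rare F h0 hmM hM1 hm hM ht hesc hJ hD ha hA hδ).and (ev.and (eventually_ge_atTop 1))).exists
  obtain ⟨h, hh⟩ : ∃ h, h = ⌊δ * N⌋₊ := ⟨_, rfl⟩
  obtain ⟨j, hj⟩ : ∃ j, j = d * (h + B0) := ⟨_, rfl⟩
  obtain ⟨P, hP⟩ : ∃ P, P = j * n1 + (Y0.length + (h + B0)) := ⟨_, rfl⟩
  have loop : ∀ w : List (Fin m), w.length = N → (hB F w J : ℝ) ≤ δ * N → ∃ (q : List (CPLIFS.Idx m l)) (z : List (Fin m)),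
      z.length = j * n1 ∧ q.map Sigma.fst = z ++ (w ++ Y0) ∧ (∀ y ∈ Q, af F (z ++ (w ++ Y0)) y = aS F q y ∧ af F (z ++ (w ++ Y0)) y ∈ Q) ∧
      Lw F ρM w J * ρm ^ P ≤ |(q.map (rr F)).prod| := by
    intro w hw hwB
    have hb1 : hB F (w ++ Y0) J ≤ h + B0 := by
      have := Nat.le_floor hwB
      rw [← hh] at this
      have h2 := hB_app (F := F) w Y0 J
      omega
    obtain ⟨E, hE1, hE2⟩ := brkE F h0 hmM hM1 hm hM (w ++ Y0) J hJo
    have hc : 1 ≤ cE F := by unfold cE; omega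
    have hE3 : E.card < 2 ^ j := by
      refine lt_of_lt_of_le (Nat.lt_of_succ_le hE1) ?_
      rw [hj, pow_mul]
      exact (Nat.pow_le_pow_right hc hb1).trans (Nat.pow_le_pow_left hd _)
    obtain ⟨z, qz, hz1, hz2, hz3, hz4⟩ := pig HU Hd j E hE3
    have zc : Continuous (af F z) := by
      have : ∀ z : List (Fin m), Continuous (af F z) := fun z => by
        induction z with
        | nil => exact continuous_id
        | cons k z ih => exact ih.comp (F.hcont k)
      exact this z
    obtain ⟨q, hq1, hq2, hq3⟩ := hE2 (af F z '' Q) (QI.isPreconnected.image _ zc.continuousOn).ordConnected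
      (by rintro _ ⟨y, hy, rfl⟩; exact QJ (hz3 y hy).2) (by rintro e he ⟨y, hy, rfl⟩; exact hz4 y hy he)
    refine ⟨qz ++ q, z, hz2, by rw [map_append, hz1, hq1], fun y hy => ?_, ?_⟩
    · have e1 : af F (z ++ (w ++ Y0)) y = af F (w ++ Y0) (af F z y) := ap_append _ _ _ _
      have e2 : af F (w ++ Y0) (af F z y) = af F Y0 (af F w (af F z y)) := ap_append _ _ _ _
      have e3 : aS F (qz ++ q) y = aS F q (aS F qz y) := ap_append _ _ _ _
      refine ⟨?_, ?_⟩
      · rw [e1, e3, hq2 _ (mem_image_of_mem _ hy), (hz3 y hy).1]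
      · rw [e1, e2]; exact hY0J _ (afJ w _ (QJ (hz3 y hy).2))
    · rw [map_append, prod_append, abs_mul]
      have s1 := prod_ge h0 hm qz
      rw [show qz.length = j * n1 by rw [← hz2, ← hz1, List.length_map]] at s1
      calc _ = ρm ^ (j * n1) * ((Lw F ρM w J * ρm ^ Y0.length) * ρm ^ (h + B0)) := by rw [hP, pow_add, pow_add]; ring
        _ ≤ _ := mul_le_mul s1 (le_trans (mul_le_mul (Lw_app h0 hmM hm w Y0 J)
          (pow_le_pow_of_le_one h0.le ρ1.le hb1) (pow_pos h0 _).le (Lw_pos F h0 hmM hm _ _).le) hq3)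
          (mul_nonneg (mul_nonneg (Lw_pos F h0 hmM hm _ _).le (pow_pos h0 _).le) (pow_pos h0 _).le) (abs_nonneg _)
  choose! qf zf hz hq hQ hsl using loop
  obtain ⟨Gd, hGd⟩ : ∃ Gd : Finset (Fin N → Fin m), Gd = Finset.univ.filter (fun w => (hB F (ofFn w) J : ℝ) ≤ δ * N) := ⟨_, rfl⟩
  have gm : ∀ w ∈ Gd, (hB F (ofFn w) J : ℝ) ≤ δ * N := fun w hw => by rw [hGd] at hw; exact (mem_filter.1 hw).2
  have len : ∀ w : Fin N → Fin m, (ofFn w).length = N := fun w => by simp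
  have inj : Set.InjOn (fun w : Fin N → Fin m => (qf (ofFn w)).reverse) Gd := by
    intro w hw w' hw' heq
    have e1 := List.reverse_injective heq
    have e2 := hq _ (len w) (gm w hw)
    rw [e1, hq _ (len w') (gm w' hw')] at e2
    have e3 := (append_inj e2 (by rw [hz _ (len w) (gm w hw), hz _ (len w') (gm w' hw')])).2
    exact ofFn_injective (append_inj e3 (by simp)).1.symm
  have ρP : ∀ w : List (Fin m), Lw F ρM w J ^ t * exp (-(lam * t * P)) = (Lw F ρM w J * ρm ^ P) ^ t := fun w => by
    rw [mul_rpow (Lw_pos F h0 hmM hm _ _).le (pow_pos h0 _).le]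
    congr 1
    rw [ρe, ← exp_nat_mul, ← Real.exp_mul]; congr 1; ring
  have good : 1 / 2 * exp (a * N) ≤ ∑ w ∈ Gd, Lw F ρM (ofFn w) J ^ t := by
    have e1 := hlow N
    have e2 : Aw F ρM t N J = SW m N (fun w => if δ * N < hB F w J then Lw F ρM w J ^ t else 0) +
        ∑ w ∈ Gd, Lw F ρM (ofFn w) J ^ t := by
      rw [hGd, sum_filter]
      unfold Aw SW
      rw [← sum_add_distrib]
      refine sum_congr rfl (fun w _ => ?_)
      beta_reduce
      by_cases hc : δ * N < hB F (ofFn w) J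
      · rw [if_pos hc, if_neg (not_le.2 hc), add_zero]
      · rw [if_neg hc, if_pos (not_lt.1 hc), zero_add]
    linarith
  refine hom_dim (rr F) (tt F) hesc (Gd.image (fun w => (qf (ofFn w)).reverse)) (n0 := j * n1 + (N + Y0.length))
    (by omega) ?_ (fun p => F.hρ0 _ _) (fun p => F.hρ1 _ _) ht1 ?_ Λ hΛ x ?_
  · intro q hq'
    obtain ⟨w, hw, rfl⟩ := Finset.mem_image.1 hq'
    rw [List.length_reverse, ← List.length_map (f := Sigma.fst), hq _ (len w) (gm w hw)]
    simp [hz _ (len w) (gm w hw)]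
  · rw [Finset.sum_image inj]
    have Pb : lam * t * P ≤ a / 2 * N + cst := by
      have f1 : (h : ℝ) ≤ δ * N := by rw [hh]; exact Nat.floor_le (by positivity)
      have f2 : (P : ℝ) = (h + B0) * c1 + Y0.length := by rw [hP, hj, hc1]; push_cast; ring
      have f3 : (P : ℝ) ≤ (δ * N + B0) * c1 + Y0.length := by rw [f2]; gcongr
      calc lam * t * P ≤ lam * t * ((δ * N + B0) * c1 + Y0.length) := by gcongr
        _ = (lam * t * c1 * δ) * N + cst := by rw [hcst]; ring
        _ = _ := by rw [hδ2]
    calc (1:ℝ) < 1 / 2 * exp 1 := by have := Real.exp_one_gt_d9; linarith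
      _ ≤ 1 / 2 * exp (a * N - lam * t * P) := by gcongr; linarith
      _ = 1 / 2 * exp (a * N) * exp (-(lam * t * P)) := by
        rw [mul_assoc (1/2:ℝ) (exp _) (exp _), ← exp_add, ← sub_eq_add_neg]
      _ ≤ (∑ w ∈ Gd, Lw F ρM (ofFn w) J ^ t) * exp (-(lam * t * P)) := by gcongr
      _ ≤ _ := by
        rw [sum_mul]
        refine sum_le_sum (fun w hw => ?_)
        rw [ρP, map_reverse, prod_reverse]
        exact rpow_le_rpow (mul_nonneg (Lw_pos F h0 hmM hm _ _).le (pow_pos h0 _).le)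
          (hsl _ (len w) (gm w hw)) ht.le
  · intro qs
    suffices compFam (gS (rr F) (tt F)) (qs.flatMap Subtype.val) x ∈ Q ∩ Λ from this.2
    induction qs with
    | nil => exact ⟨xQ, hxΛ⟩
    | cons q qs ih =>
      rw [flatMap_cons, cF_append]
      obtain ⟨q, hq'⟩ := q
      obtain ⟨w, hw, rfl⟩ := Finset.mem_image.1 hq'
      have e1 := hQ _ (len w) (gm w hw) _ ih.1
      rw [← ap_rev]
      change aS F _ _ ∈ _
      rw [← e1.1]
      exact ⟨e1.2, afΛ _ _ ih.2⟩
end cpl6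
section cpl7
variable {m : ℕ} {l : Fin m → ℕ} (F : CPLIFS m l)
lemma af_rev (u : List (Fin m)) (x : ℝ) : af F u x = compFam F.f u.reverse x := ap_rev _ _ _
def Zn (I : Set ℝ) (s : ℝ) (n : ℕ) : ℝ := ∑ w : Fin n → Fin m, diam (compFam F.f (ofFn w) '' I) ^ s
lemma cfl {ρM : ℝ} (h0 : 0 ≤ ρM) (hM : ∀ k i, |F.ρ k i| ≤ ρM) (w : List (Fin m)) (x y : ℝ) :
    |compFam F.f w x - compFam F.f w y| ≤ ρM ^ w.length * |x - y| := by
  have := ap_lip F h0 hM w.reverse x y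
  rwa [List.length_reverse, af_rev, af_rev, List.reverse_reverse] at this
lemma cf_diam {ρM D : ℝ} (h0 : 0 ≤ ρM) (hM : ∀ k i, |F.ρ k i| ≤ ρM) (hD0 : 0 ≤ D) {I : Set ℝ}
    (hD : ∀ x ∈ I, ∀ y ∈ I, |x - y| ≤ D) (w : List (Fin m)) :
    diam (compFam F.f w '' I) ≤ ρM ^ w.length * D ∧ Metric.ediam (compFam F.f w '' I) =
      ofReal (diam (compFam F.f w '' I)) := by
  have key : ∀ x ∈ compFam F.f w '' I, ∀ y ∈ compFam F.f w '' I, dist x y ≤ ρM ^ w.length * D := by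
    rintro _ ⟨x, hx, rfl⟩ _ ⟨y, hy, rfl⟩
    rw [dist_eq]
    exact (cfl F h0 hM w x y).trans (mul_le_mul_of_nonneg_left (hD x hx y hy) (pow_nonneg h0 _))
  refine ⟨Metric.diam_le_of_forall_dist_le (by positivity) key, ?_⟩
  have hb : Bornology.IsBounded (compFam F.f w '' I) := Metric.isBounded_iff.2 ⟨_, fun x hx y hy => key x hx y hy⟩
  rw [diam, ENNReal.ofReal_toReal hb.ediam_ne_top]
lemma Zn_bound {ρM D : ℝ} (h0 : 0 ≤ ρM) (hM : ∀ k i, |F.ρ k i| ≤ ρM) (hD0 : 0 ≤ D) {I : Set ℝ}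
    (hD : ∀ x ∈ I, ∀ y ∈ I, |x - y| ≤ D) {s s' : ℝ} (hs : 0 ≤ s) (hss : s ≤ s') (n : ℕ) :
    Zn F I s' n ≤ (ρM ^ n * D) ^ (s' - s) * Zn F I s n := by
  unfold Zn
  rw [mul_sum]
  refine sum_le_sum (fun w _ => ?_)
  have h1 := (cf_diam F h0 hM hD0 hD (ofFn w)).1
  rw [length_ofFn] at h1
  have e : s' = (s' - s) + s := by ring
  conv_lhs => rw [e]
  rw [Real.rpow_add_of_nonneg diam_nonneg (by linarith) hs]
  exact mul_le_mul_of_nonneg_right (rpow_le_rpow diam_nonneg h1 (by linarith))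
    (rpow_nonneg diam_nonneg _)
lemma Zn_Aw {ρM ρm D t : ℝ} (h0 : 0 < ρm) (hmM : ρm ≤ ρM) (hm : ∀ k i, ρm ≤ |F.ρ k i|)
    (hM : ∀ k i, |F.ρ k i| ≤ ρM) (hD0 : 0 ≤ D) {I J : Set ℝ} (hIJ : I ⊆ J)
    (hD : ∀ x ∈ I, ∀ y ∈ I, |x - y| ≤ D) (ht : 0 ≤ t) (n : ℕ) :
    Zn F I t n ≤ D ^ t * Aw F ρM t n J := by
  have e : Zn F I t n = SW m n (fun w => diam (af F w '' I) ^ t) := by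
    unfold Zn SW
    rw [← (Equiv.arrowCongr (Fin.revPerm (n := n)) (Equiv.refl (Fin m))).sum_comp]
    refine sum_congr rfl (fun w _ => ?_)
    have : compFam F.f (ofFn ((Equiv.arrowCongr (Fin.revPerm (n := n)) (Equiv.refl (Fin m))) w)) = af F (ofFn w) := by
      funext x
      rw [af_rev]
      congr 1
      refine List.ext_getElem (by simp) (fun i h1 h2 => ?_)
      simp only [List.getElem_ofFn, List.getElem_reverse, length_ofFn, Equiv.arrowCongr_apply, Function.comp,
        Equiv.coe_refl, id, Fin.revPerm_symm, Fin.revPerm_apply]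
      congr 1
      simp only [Fin.ext_iff, Fin.val_rev]
      omega
    rw [this]
  rw [e]
  unfold Aw
  rw [← SW_mul]
  refine SW_mono (fun w _ => ?_)
  have hL := Lw_pos F h0 hmM hm w J
  rw [← mul_rpow hD0 hL.le, mul_comm]
  refine rpow_le_rpow diam_nonneg (Metric.diam_le_of_forall_dist_le (by positivity) ?_) ht
  rintro _ ⟨x, hx, rfl⟩ _ ⟨y, hy, rfl⟩
  rw [dist_eq]
  exact (Lw_lip F h0 hmM hm hM w J (hIJ hx) (hIJ hy)).trans (mul_le_mul_of_nonneg_left (hD x hx y hy) hL.le)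
lemma Λ_cover {Λ : Set ℝ} (hinv : Λ = ⋃ k, F.f k '' Λ) (n : ℕ) : ∀ y ∈ Λ, ∃ w : Fin n → Fin m,
    y ∈ compFam F.f (ofFn w) '' Λ := by
  induction n with
  | zero => exact fun y hy => ⟨Fin.elim0, y, hy, by simp [compFam]⟩
  | succ n ih =>
    intro y hy
    rw [hinv] at hy
    obtain ⟨k, z, hz, rfl⟩ := mem_iUnion.1 hy
    obtain ⟨w, z', hz', rfl⟩ := ih z hz
    refine ⟨Fin.cons k w, z', hz', ?_⟩
    rw [ofFn_succ]
    simp [compFam]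
lemma Λ_sub {ρM : ℝ} (h1 : ρM < 1) (h0 : 0 ≤ ρM) (hM : ∀ k i, |F.ρ k i| ≤ ρM) {Λ K : Set ℝ} (hΛ : IsCompact Λ)
    (hinv : Λ = ⋃ k, F.f k '' Λ) (hK : IsCompact K) (hne : K.Nonempty) (hKi : ∀ k, F.f k '' K ⊆ K) : Λ ⊆ K := by
  intro y hy
  obtain ⟨z, hz, hmax⟩ := hΛ.exists_isMaxOn ⟨y, hy⟩ (Metric.continuous_infDist_pt K).continuousOn
  have hz2 := hz
  rw [hinv] at hz2
  obtain ⟨k, v, hv, hvz⟩ := mem_iUnion.1 hz2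
  obtain ⟨p, hp, hpe⟩ := hK.exists_infDist_eq_dist hne v
  have a1 : infDist z K ≤ ρM * infDist v K := by
    rw [← hvz, hpe]
    refine (Metric.infDist_le_dist_of_mem (hKi k ⟨p, hp, rfl⟩)).trans ?_
    rw [dist_eq, dist_eq]
    exact f_lip F hM k v p
  have a2 : infDist v K ≤ infDist z K := hmax hv
  have a3 : infDist y K ≤ infDist z K := hmax hy
  have a4 : 0 ≤ infDist v K := Metric.infDist_nonneg
  have a5 : infDist y K = 0 := by
    have := Metric.infDist_nonneg (x := y) (s := K)
    nlinarith
  exact (hK.isClosed.mem_iff_infDist_zero hne).2 a5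
lemma upperd {ρM D : ℝ} (h0 : 0 < ρM) (h1 : ρM < 1) (hM : ∀ k i, |F.ρ k i| ≤ ρM) (hD0 : 0 ≤ D) {I Λ : Set ℝ}
    (hD : ∀ x ∈ I, ∀ y ∈ I, |x - y| ≤ D) (hΛI : Λ ⊆ I) (hinv : Λ = ⋃ k, F.f k '' Λ) {t C : ℝ} (ht : 0 ≤ t)
    (hZ : ∀ᶠ n in atTop, Zn F I t n ≤ C) : dimH Λ ≤ ofReal t := by
  have hm := Measure.hausdorffMeasure_le_liminf_sum (ι := fun n : ℕ => Fin n → Fin m) t Λ (l := atTop)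
    (fun n => ofReal (ρM ^ n * D)) (by
      rw [← ENNReal.ofReal_zero]
      refine ENNReal.tendsto_ofReal ?_
      simpa using (tendsto_pow_atTop_nhds_zero_of_lt_one h0.le h1).mul_const D)
    (fun n w => compFam F.f (ofFn w) '' I) (Eventually.of_forall (fun n w => by
      obtain ⟨a, b⟩ := cf_diam F h0.le hM hD0 hD (ofFn w)
      rw [b]; rw [length_ofFn] at a
      exact ofReal_le_ofReal a))
    (Eventually.of_forall (fun n y hy => by
      obtain ⟨w, hw⟩ := Λ_cover F hinv n y hy
      exact mem_iUnion.2 ⟨w, image_mono hΛI hw⟩))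
  have e : ∀ n : ℕ, ∑ w : Fin n → Fin m, Metric.ediam (compFam F.f (ofFn w) '' I) ^ t = ofReal (Zn F I t n) := by
    intro n
    unfold Zn
    rw [ENNReal.ofReal_sum_of_nonneg (fun _ _ => rpow_nonneg diam_nonneg _)]
    refine sum_congr rfl (fun w _ => ?_)
    rw [(cf_diam F h0.le hM hD0 hD (ofFn w)).2, ENNReal.ofReal_rpow_of_nonneg diam_nonneg ht]
  have hfin : μH[t] Λ ≤ ofReal C := by
    refine hm.trans (liminf_le_of_frequently_le ?_)
    refine Eventually.frequently (hZ.mono (fun n hn => ?_))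
    rw [e]
    exact ofReal_le_ofReal hn
  have := dimH_le_of_hausdorffMeasure_ne_top (s := Λ) (d := t.toNNReal) (by
    rw [Real.coe_toNNReal _ ht]
    exact ne_top_of_le_ne_top ENNReal.ofReal_ne_top hfin)
  exact this
lemma diam_lb (hesc : ESCfam (rr F) (tt F)) {ρM ρm : ℝ} (h0 : 0 < ρm) (hmM : ρm ≤ ρM) (h1 : ρM < 1) (hm : ∀ k i, ρm ≤ |F.ρ k i|)
    (hM : ∀ k i, |F.ρ k i| ≤ ρM) {k0 k1 : Fin m} (hk : k0 ≠ k1) {x : ℝ} (hx : F.f k0 x = x) {I : Set ℝ}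
    (hxI : x ∈ I) (hyI : F.f k1 x ∈ I) (hIb : Bornology.IsBounded I) :
    ∃ c > 0, ∀ᶠ n in atTop, c * ρm ^ n ≤ diam (compFam F.f (replicate n k0) '' I) := by
  have hρ : 0 < ρM := h0.trans_le hmM
  set g : ℕ → ℝ := fun n => compFam F.f (replicate n k0) (F.f k1 x) with hg
  have gs : ∀ n, g (n+1) = F.f k0 (g n) := fun n => by simp [hg, replicate_succ, compFam]
  have fx : ∀ n, compFam F.f (replicate n k0) x = x := fun n => by
    induction n with
    | zero => rfl
    | succ n ih => rw [replicate_succ, cF_cons, ih, hx]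
  have ne : ∀ n, g n ≠ x := fun n hn => by
    have := uniq hesc x (k1 :: replicate n k0) (k0 :: replicate n k0) (by simp)
      (by
        change af F (replicate n k0) (F.f k1 x) = x
        rw [af_rev, List.reverse_replicate]; exact hn)
      (by
        change af F (replicate n k0) (F.f k0 x) = x
        rw [af_rev, List.reverse_replicate, hx]; exact fx n)
    exact hk (List.cons.inj this).1.symm
  have lim : Tendsto (fun n => ρM ^ n * |F.f k1 x - x|) atTop (nhds 0) := by
    simpa using (tendsto_pow_atTop_nhds_zero_of_lt_one hρ.le h1).mul_const |F.f k1 x - x|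
  have gb : ∀ n, |g n - x| ≤ ρM ^ n * |F.f k1 x - x| := fun n => by
    have := cfl F hρ.le hM (replicate n k0) (F.f k1 x) x
    rwa [fx, length_replicate] at this
  obtain ⟨r1, hr1, i1, H1⟩ := side_piece F k0 x (τ := 1) (Or.inl rfl)
  obtain ⟨r2, hr2, i2, H2⟩ := side_piece F k0 x (τ := -1) (Or.inr rfl)
  have near : ∀ y, |y - x| ≤ min r1 r2 → ρm * |y - x| ≤ |F.f k0 y - x| := by
    intro y hy
    rcases le_total x y with h | h
    · rw [abs_of_nonneg (sub_nonneg.2 h)] at hy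
      have e1 := H1 (y - x) ⟨by linarith, hy.trans (min_le_left _ _)⟩
      have e2 := H1 0 ⟨le_rfl, hr1.le⟩
      rw [mul_zero, add_zero, hx] at e2
      rw [one_mul, add_sub_cancel] at e1
      rw [e1]
      conv_rhs => rw [e2]
      rw [show F.ρ k0 i1 * y + F.t k0 i1 - (F.ρ k0 i1 * x + F.t k0 i1) = F.ρ k0 i1 * (y - x) by ring, abs_mul]
      exact mul_le_mul_of_nonneg_right (hm _ _) (abs_nonneg _)
    · rw [abs_of_nonpos (sub_nonpos.2 h)] at hy
      have e1 := H2 (x - y) ⟨by linarith, by linarith [min_le_right r1 r2]⟩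
      have e2 := H2 0 ⟨le_rfl, hr2.le⟩
      rw [mul_zero, add_zero, hx] at e2
      rw [show x + -1 * (x - y) = y by ring] at e1
      rw [e1]
      conv_rhs => rw [e2]
      rw [show F.ρ k0 i2 * y + F.t k0 i2 - (F.ρ k0 i2 * x + F.t k0 i2) = F.ρ k0 i2 * (y - x) by ring, abs_mul]
      exact mul_le_mul_of_nonneg_right (hm _ _) (abs_nonneg _)
  obtain ⟨N, hN⟩ := eventually_atTop.1 (lim.eventually_le_const (lt_min hr1 hr2))
  have low : ∀ j, |g N - x| * ρm ^ j ≤ |g (N + j) - x| := fun j => by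
    induction j with
    | zero => simp
    | succ j ih =>
      have := near (g (N + j)) ((gb _).trans (hN _ (by omega)))
      rw [← gs] at this
      calc _ = ρm * (|g N - x| * ρm ^ j) := by ring
        _ ≤ ρm * |g (N + j) - x| := by gcongr
        _ ≤ _ := this
  refine ⟨|g N - x|, abs_pos.2 (sub_ne_zero.2 (ne N)), eventually_atTop.2 ⟨N, fun n hn => ?_⟩⟩
  obtain ⟨j, rfl⟩ := Nat.exists_eq_add_of_le hn
  calc |g N - x| * ρm ^ (N + j) ≤ |g N - x| * ρm ^ j := by
        refine mul_le_mul_of_nonneg_left (pow_le_pow_of_le_one h0.le (by linarith) (by omega)) (abs_nonneg _)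
    _ ≤ |g (N + j) - x| := low j
    _ ≤ _ := by
      have hb : Bornology.IsBounded (compFam F.f (replicate (N+j) k0) '' I) := by
        obtain ⟨C, hC⟩ := Metric.isBounded_iff.1 hIb
        refine Metric.isBounded_iff.2 ⟨ρM ^ (N+j) * C, ?_⟩
        rintro _ ⟨u, hu, rfl⟩ _ ⟨v, hv, rfl⟩
        have := cfl F hρ.le hM (replicate (N+j) k0) u v
        rw [length_replicate] at this
        rw [dist_eq]
        have h3 := hC hu hv
        rw [dist_eq] at h3
        exact this.trans (by gcongr)
      have := Metric.dist_le_diam_of_mem hb (mem_image_of_mem _ hyI) (mem_image_of_mem _ hxI)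
      rw [fx, dist_eq] at this
      exact this
lemma pres {ρM D s c κ : ℝ} (h0 : 0 < ρM) (h1 : ρM < 1) (hM : ∀ k i, |F.ρ k i| ≤ ρM) (hD0 : 0 < D) {I : Set ℝ}
    (hD : ∀ x ∈ I, ∀ y ∈ I, |x - y| ≤ D) (hs : 0 ≤ s) (hc : 0 < c) (hκ : 0 < κ) (k0 : Fin m)
    (hlb : ∀ᶠ n in atTop, c * κ ^ n ≤ diam (compFam F.f (replicate n k0) '' I))
    (hp : limsup (fun n : ℕ => (n : ℝ)⁻¹ * log (Zn F I s n)) atTop = 0) {ε : ℝ} (hε : 0 < ε) :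
    (∀ᶠ n : ℕ in atTop, Zn F I s n ≤ exp (ε * n)) ∧ ∃ᶠ n : ℕ in atTop, exp (-(ε * n)) ≤ Zn F I s n := by
  have hl : ∀ᶠ n : ℕ in atTop, (c * κ ^ n) ^ s ≤ Zn F I s n := hlb.mono (fun n hn => by
    have : (c * κ ^ n) ^ s ≤ diam (compFam F.f (ofFn (fun _ : Fin n => k0)) '' I) ^ s := by
      rw [List.ofFn_const]
      exact rpow_le_rpow (by positivity) hn hs
    exact this.trans (single_le_sum (f := fun w : Fin n → Fin m => diam (compFam F.f (ofFn w) '' I) ^ s)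
      (fun _ _ => rpow_nonneg diam_nonneg _) (Finset.mem_univ _)))
  have hpos : ∀ᶠ n : ℕ in atTop, 0 < Zn F I s n := hl.mono (fun n hn => lt_of_lt_of_le (by positivity) hn)
  have hcob : IsCoboundedUnder (· ≤ ·) atTop (fun n : ℕ => (n : ℝ)⁻¹ * log (Zn F I s n)) := by
    refine IsCoboundedUnder.of_frequently_ge (a := -(s * (|log c| + |log κ|))) (Eventually.frequently ?_)
    filter_upwards [hl, eventually_ge_atTop 1] with n hn hn1
    have hn' : (1:ℝ) ≤ n := by exact_mod_cast hn1
    have h2 := log_le_log (by positivity) hn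
    rw [log_rpow (by positivity), log_mul hc.ne' (by positivity), log_pow] at h2
    have h3 : -(s * (|log c| + |log κ|)) * n ≤ log (Zn F I s n) := by
      refine le_trans ?_ h2
      have e1 := neg_abs_le (log c)
      have e2 := neg_abs_le (log κ)
      have e3 : -(n * |log c|) ≤ log c := by nlinarith [abs_nonneg (log c)]
      have e4 : -(n * |log κ|) ≤ n * log κ := by nlinarith
      calc _ = s * (-(n * |log c|) + -(n * |log κ|)) := by ring
        _ ≤ _ := by gcongr
    rw [inv_mul_eq_div, le_div_iff₀ (by linarith)]
    exact h3
  have hmpos : (0:ℝ) < m := by have := k0.pos; exact_mod_cast this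
  have hbd : IsBoundedUnder (· ≤ ·) atTop (fun n : ℕ => (n : ℝ)⁻¹ * log (Zn F I s n)) := by
    refine ⟨log m + s * |log D|, eventually_map.2 ?_⟩
    filter_upwards [hpos, eventually_ge_atTop 1] with n hn hn1
    have hn' : (1:ℝ) ≤ n := by exact_mod_cast hn1
    have hz : Zn F I s n ≤ m ^ n * D ^ s := by
      unfold Zn
      calc _ ≤ ∑ w : Fin n → Fin m, D ^ s := sum_le_sum (fun w _ => by
            refine rpow_le_rpow diam_nonneg ((cf_diam F h0.le hM hD0.le hD (ofFn w)).1.trans ?_) hs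
            exact mul_le_of_le_one_left hD0.le (pow_le_one₀ h0.le h1.le))
        _ = _ := by simp
    have h2 := log_le_log hn hz
    rw [log_mul (by positivity) (by positivity), log_pow, log_rpow hD0] at h2
    rw [inv_mul_eq_div, div_le_iff₀ (by linarith)]
    have e1 := le_abs_self (log D)
    have e2 : s * log D ≤ s * |log D| := by gcongr
    have e3 : 0 ≤ s * |log D| := by positivity
    nlinarith
  constructor
  · have := eventually_lt_of_limsup_lt (b := ε) (by rw [hp]; exact hε) hbd
    filter_upwards [this, hpos, eventually_ge_atTop 1] with n hn hz hn1
    have hn' : (1:ℝ) ≤ n := by exact_mod_cast hn1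
    rw [inv_mul_eq_div, div_lt_iff₀ (by linarith)] at hn
    exact (Real.log_le_iff_le_exp hz).1 hn.le
  · have := frequently_lt_of_lt_limsup (b := -ε) hcob (by rw [hp]; linarith)
    refine (this.and_eventually (hpos.and (eventually_ge_atTop 1))).mono ?_
    rintro n ⟨hn, hz, hn1⟩
    have hn' : (1:ℝ) ≤ n := by exact_mod_cast hn1
    rw [inv_mul_eq_div, lt_div_iff₀ (by linarith)] at hn
    rw [← Real.le_log_iff_exp_le hz]
    linarith
lemma fixpt {ρM : ℝ} (h0 : 0 ≤ ρM) (h1 : ρM < 1) (hM : ∀ k i, |F.ρ k i| ≤ ρM) (k : Fin m) {Λ : Set ℝ} (hne : Λ.Nonempty)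
    (hΛ : IsClosed Λ) (hinv : ∀ k, ∀ y ∈ Λ, F.f k y ∈ Λ) : ∃ x ∈ Λ, F.f k x = x := by
  have hc : ContractingWith ⟨ρM, h0⟩ (F.f k) := by
    refine ⟨by exact_mod_cast h1, LipschitzWith.of_dist_le_mul (fun x y => ?_)⟩
    rw [dist_eq, dist_eq]
    exact f_lip F hM k x y
  obtain ⟨y, hy⟩ := hne
  refine ⟨ContractingWith.fixedPoint (F.f k) hc, ?_, hc.fixedPoint_isFixedPt⟩
  refine hΛ.mem_of_tendsto (hc.tendsto_iterate_fixedPoint y) (Eventually.of_forall (fun n => ?_))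
  induction n with
  | zero => exact hy
  | succ n ih => rw [Function.iterate_succ_apply']; exact hinv _ _ ih
theorem mainT (Λ : Set ℝ) (hΛne : Λ.Nonempty) (hΛc : IsCompact Λ) (hΛinv : Λ = ⋃ k, F.f k '' Λ)
    (hesc : ESCfam (rr F) (tt F)) (sF : ℝ) (hsF0 : 0 ≤ sF) (hsF : pressure F.f sF = 0) :
    dimH Λ = ofReal (min 1 sF) := by
  obtain ⟨ρm, ρM, h0, hmM, hM1, hmm⟩ := slope_bds F
  have hm : ∀ k i, ρm ≤ |F.ρ k i| := fun k i => (hmm k i).1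
  have hM : ∀ k i, |F.ρ k i| ≤ ρM := fun k i => (hmm k i).2
  have hρ : 0 < ρM := h0.trans_le hmM
  have hm2 := F.hm
  have hinv : ∀ k, ∀ y ∈ Λ, F.f k y ∈ Λ := fun k y hy => by
    rw [hΛinv]; exact mem_iUnion.2 ⟨k, y, hy, rfl⟩
  obtain ⟨k0, k1, hk⟩ : ∃ k0 k1 : Fin m, k0 ≠ k1 := ⟨⟨0, by omega⟩, ⟨1, by omega⟩, by simp [Fin.ext_iff]⟩
  obtain ⟨x, hxΛ, hx⟩ := fixpt F hρ.le hM1 hM k0 hΛne hΛc.isClosed hinv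
  have ncf : ¬ ∃ φ : ℝ, ∀ k, F.f k φ = φ := by
    rintro ⟨φ, hφ⟩
    have := uniq hesc φ [k0] [k1] rfl (hφ k0) (hφ k1)
    simp at this; exact hk this
  obtain ⟨R, hR⟩ : ∃ R, R = |x| + 1 + ∑ k, |F.f k 0| / (1 - ρM) := ⟨_, rfl⟩
  have h1M : 0 < 1 - ρM := by linarith
  have hsum : 0 ≤ ∑ k, |F.f k 0| / (1 - ρM) := sum_nonneg (fun k _ => by positivity)
  have hRx : |x| + 1 ≤ R := by linarith
  have hRpos : 0 < R := by linarith [abs_nonneg x]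
  have hRk : ∀ k, |F.f k 0| ≤ (1 - ρM) * R := fun k => by
    have : |F.f k 0| / (1 - ρM) ≤ ∑ k, |F.f k 0| / (1 - ρM) :=
      single_le_sum (f := fun k => |F.f k 0| / (1 - ρM)) (fun k _ => by positivity) (Finset.mem_univ k)
    rw [mul_comm, ← div_le_iff₀ h1M]
    linarith [abs_nonneg x]
  obtain ⟨J, hJd⟩ : ∃ J, J = Icc (-R) R := ⟨_, rfl⟩
  have hJ : ∀ k, F.f k '' J ⊆ J := by
    rintro k _ ⟨y, hy, rfl⟩
    rw [hJd] at hy ⊢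
    have a1 := f_lip F hM k y 0
    have a2 : |y| ≤ R := abs_le.2 hy
    rw [sub_zero] at a1
    have a3 : ρM * |y| ≤ ρM * R := by gcongr
    have a4 := hRk k
    have a5 : |F.f k y| ≤ |F.f k y - F.f k 0| + |F.f k 0| := by
      have := abs_add_le (F.f k y - F.f k 0) (F.f k 0)
      rwa [sub_add_cancel] at this
    exact abs_le.1 (by linarith)
  obtain ⟨D, hDd⟩ : ∃ D, D = 2 * R := ⟨_, rfl⟩
  have hD0 : 0 < D := by linarith
  have hDJ : ∀ x ∈ J, ∀ y ∈ J, |x - y| ≤ D := by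
    intro x hx y hy
    rw [hJd] at hx hy
    rw [abs_le]; constructor <;> linarith [hx.1, hx.2, hy.1, hy.2]
  obtain ⟨I, hI⟩ : ∃ I, I = suppInt F.f := ⟨_, rfl⟩
  have hI2 : I = ⋂₀ {J : Set ℝ | J.Nonempty ∧ (∃ a b : ℝ, J = Set.Icc a b) ∧ ∀ k, F.f k '' J ⊆ J} := by
    rw [hI, suppInt, dif_neg ncf]
  have hIJ : I ⊆ J := by
    rw [hI2]
    exact sInter_subset_of_mem ⟨⟨0, by rw [hJd]; constructor <;> linarith⟩, ⟨-R, R, hJd⟩, hJ⟩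
  have hΛI : Λ ⊆ I := by
    rw [hI2]
    refine subset_sInter ?_
    rintro K ⟨hKne, ⟨a, b, hab⟩, hKi⟩
    exact Λ_sub F hM1 hρ.le hM hΛc hΛinv (by rw [hab]; exact isCompact_Icc) hKne hKi
  have hDI : ∀ x ∈ I, ∀ y ∈ I, |x - y| ≤ D := fun x hx y hy => hDJ x (hIJ hx) y (hIJ hy)
  have hIb : Bornology.IsBounded I := by
    refine Bornology.IsBounded.subset ?_ hIJ
    rw [hJd]; exact Metric.isBounded_Icc _ _
  obtain ⟨c, hc, hlb⟩ := diam_lb F hesc h0 hmM hM1 hm hM hk hx (hΛI hxΛ) (hΛI (hinv k1 x hxΛ)) hIb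
  have hp : limsup (fun n : ℕ => (n : ℝ)⁻¹ * log (Zn F I sF n)) atTop = 0 := by
    rw [← hsF, hI]; rfl
  have P := fun {ε : ℝ} (hε : 0 < ε) => pres F hρ hM1 hM hD0 hDI hsF0 hc h0 k0 hlb hp hε
  obtain ⟨lam, hlam⟩ : ∃ lam, lam = -log ρM := ⟨_, rfl⟩
  have hlam0 : 0 < lam := by rw [hlam]; linarith [log_neg hρ hM1]
  have ρe : ∀ (n : ℕ) (δ : ℝ), (ρM ^ n * D) ^ δ = exp (-(lam * δ * n)) * D ^ δ := fun n δ => by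
    rw [mul_rpow (by positivity) hD0.le]
    congr 1
    rw [Real.rpow_def_of_pos (by positivity), log_pow, hlam]
    congr 1; ring
  apply le_antisymm
  · rw [ENNReal.ofReal_min]
    refine le_min ?_ ?_
    · rw [ENNReal.ofReal_one, ← Real.dimH_univ]
      exact dimH_mono (subset_univ _)
    · refine ENNReal.le_of_forall_pos_le_add (fun δ hδ _ => ?_)
      have hδ' : (0:ℝ) < δ := hδ
      have := upperd F hρ hM1 hM hD0.le hDI hΛI hΛinv (t := sF + δ) (C := D ^ (δ:ℝ)) (by linarith) (by
        refine (P (ε := lam * δ) (by positivity)).1.mono (fun n hn => ?_)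
        refine (Zn_bound F hρ.le hM hD0.le hDI hsF0 (by linarith : sF ≤ sF + δ) n).trans ?_
        rw [add_sub_cancel_left, ρe]
        calc _ ≤ exp (-(lam * δ * n)) * D ^ (δ:ℝ) * exp (lam * δ * n) := by gcongr
          _ = D ^ (δ:ℝ) * (exp (-(lam * δ * n)) * exp (lam * δ * n)) := by ring
          _ = D ^ (δ:ℝ) := by rw [← exp_add]; simp)
      rwa [ENNReal.ofReal_add hsF0 hδ'.le, ofReal_coe_nnreal] at this
  · refine le_of_forall_lt (fun q hq => ?_)
    obtain ⟨q', hq1, hq2⟩ := exists_between hq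
    have hqt : q' ≠ ⊤ := ne_top_of_lt hq2
    obtain ⟨t, ht⟩ : ∃ t, t = q'.toReal := ⟨_, rfl⟩
    have hqe : q' = ofReal t := by rw [ht, ENNReal.ofReal_toReal hqt]
    have ht0 : 0 < t := by rw [ht]; exact ENNReal.toReal_pos (ne_of_gt (lt_of_le_of_lt bot_le hq1)) hqt
    rw [hqe] at hq2
    have htm : t < min 1 sF := (ENNReal.ofReal_lt_ofReal_iff_of_nonneg ht0.le).1 hq2
    have hts : t < sF := htm.trans_le (min_le_right _ _)
    refine lt_of_lt_of_le hq1 ?_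
    rw [hqe]
    have hgr : ∃ᶠ n : ℕ in atTop, (D ^ (sF - t) * D ^ t)⁻¹ * exp (lam * (sF - t) / 2 * n) ≤ Aw F ρM t n J := by
      have hst : 0 < sF - t := by linarith
      refine (P (ε := lam * (sF - t) / 2) (by positivity)).2.mono (fun n hn => ?_)
      have b1 := Zn_bound F hρ.le hM hD0.le hDI ht0.le hts.le n
      have b2 := Zn_Aw F h0 hmM hm hM hD0.le hIJ hDI ht0.le n
      rw [ρe] at b1
      rw [inv_mul_le_iff₀ (by positivity)]
      have b3 : exp (-(lam * (sF - t) / 2 * n)) ≤ exp (-(lam * (sF - t) * n)) * (D ^ (sF - t) * D ^ t * Aw F ρM t n J) := by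
        calc _ ≤ _ := hn
          _ ≤ _ := b1
          _ ≤ exp (-(lam * (sF - t) * n)) * D ^ (sF - t) * (D ^ t * Aw F ρM t n J) := by gcongr
          _ = _ := by ring
      rw [Real.exp_neg (lam * (sF - t) * n), le_inv_mul_iff₀ (exp_pos _), ← exp_add] at b3
      refine le_trans (le_of_eq ?_) b3
      congr 1; ring
    have hst : 0 < sF - t := by linarith
    obtain ⟨a, ha, hlow, hA⟩ := Aw_growth F h0 hmM hm hM ht0 hJ (by positivity) (by positivity) hgr
    refine lower h0 hmM hM1 hm hM ht0 hesc (htm.le.trans (min_le_left _ _)) hJ (by rw [hJd]; exact ordConnected_Icc) hDJ ha hlow hA hk hx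
      ?_ hΛc.isClosed hxΛ hinv
    rw [hJd]
    have := abs_le.1 (by linarith : |x| ≤ R - 1)
    exact Icc_subset_Icc (by linarith) (by linarith)
end cpl7
end
/-- **Theorem md46.** Let `F` be a CPLIFS with attractor `Λ` whose generated
self-similar IFS satisfies the Exponential Separation Condition.  Then
`dim_H Λ = min {1, s_F}`, where `s_F` is the natural dimension of `F`. -/
theorem dimH_attractor_of_ESC
    {m : ℕ} {l : Fin m → ℕ} (F : CPLIFS m l)
    (Λ : Set ℝ) (hΛne : Λ.Nonempty) (hΛc : IsCompact Λ)
    (hΛinv : Λ = ⋃ k, F.f k '' Λ)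
    (hesc : ESCfam (fun p : CPLIFS.Idx m l => F.ρ p.1 p.2)
                   (fun p : CPLIFS.Idx m l => F.t p.1 p.2))
    (sF : ℝ) (hsF0 : 0 ≤ sF) (hsF : pressure F.f sF = 0) :
    dimH Λ = ENNReal.ofReal (min 1 sF) := by
  exact mainT F Λ hΛne hΛc hΛinv hesc sF hsF0 hsF

end
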